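/- There exist a constant C > 0 and n0 ≥ 1 such that the following holds for every even n ≥ n0 and every integer d with 3 ≤ d ≤ n^{1/10}. Let G ~ μ_{d,n}, let X be the number of triangles of G and Y the number of perfect matchings of G; assume Var(X) > 0 and set Y* = aX + b, where a = Cov(X,Y)/Var(X) and b = E[Y] − a·E[X]. Then Var(Y − Y*) ≤ C·E[Y]^2/d^4. -/

import Mathlib

open Filter Topology

/-- Degree of a vertex in a graph on `Fin n`. -/
noncomputable def gDeg {n : ℕ} (G : SimpleGraph (Fin n)) (v : Fin n) : ℕ :=
  Nat.card {w : Fin n // G.Adj v w}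

/-- `G` is a `d`-regular graph. -/
def IsRegularGraph {n : ℕ} (G : SimpleGraph (Fin n)) (d : ℕ) : Prop :=
  ∀ v, gDeg G v = d

open scoped Classical in
/-- The uniform probability distribution `μ_{d,n}` on the `d`-regular graphs on `{1,…,n}`. -/
noncomputable def mu (n d : ℕ) : SimpleGraph (Fin n) → ℝ := fun G =>
  if IsRegularGraph G d then
    (Nat.card {H : SimpleGraph (Fin n) // IsRegularGraph H d} : ℝ)⁻¹
  else 0

/-- `p` is a probability distribution on a finite or countable space. -/
def IsProbC {α : Type*} (p : α → ℝ) : Prop :=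
  (∀ x, 0 ≤ p x) ∧ ∑' x, p x = 1

/-- Probability of an event `A` under the distribution `p`. -/
noncomputable def probOf {α : Type*} (p : α → ℝ) (A : Set α) : ℝ := ∑' x : A, p x

/-- Total variation distance. -/
noncomputable def tvDist {α : Type*} (p q : α → ℝ) : ℝ := (1/2) * ∑' x, |p x - q x|

/-- `π` is a coupling of `p` and `q`. -/
def IsCoupling {α β : Type*} (π : α × β → ℝ) (p : α → ℝ) (q : β → ℝ) : Prop :=
  IsProbC π ∧ (∀ a, ∑' b, π (a, b) = p a) ∧ (∀ b, ∑' a, π (a, b) = q b)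

/-- Expectation of `f` under the distribution `p`. -/
noncomputable def expec {α : Type*} (p f : α → ℝ) : ℝ := ∑' x, p x * f x

/-- The number of triangles of `G`. -/
noncomputable def triCount {n : ℕ} (G : SimpleGraph (Fin n)) : ℕ :=
  Nat.card {s : Finset (Fin n) // G.IsNClique 3 s}

/-- The number of perfect matchings of `G` (1-regular spanning subgraphs). -/
noncomputable def pmCount {n : ℕ} (G : SimpleGraph (Fin n)) : ℕ :=
  Nat.card {M : SimpleGraph (Fin n) // M ≤ G ∧ IsRegularGraph M 1}

/-- Covariance of `f` and `g` under the distribution `p`. -/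
noncomputable def covar {α : Type*} (p f g : α → ℝ) : ℝ :=
  expec p (fun x => f x * g x) - expec p f * expec p g

/-- Variance of `f` under the distribution `p`. -/
noncomputable def varia {α : Type*} (p f : α → ℝ) : ℝ := covar p f f

namespace RegPM
open Finset

section

variable {n : ℕ}

open Classical in
/-- The adjacency indicator of a graph. -/
noncomputable def ind (G : SimpleGraph (Fin n)) (x y : Fin n) : ℝ := if G.Adj x y then 1 else 0

/-- The indicator of a pair being equal or adjacent. -/
noncomputable def bar (G : SimpleGraph (Fin n)) (x y : Fin n) : ℝ :=
  if x = y then 1 else ind G x y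

lemma ind_nonneg (G : SimpleGraph (Fin n)) (x y : Fin n) : 0 ≤ ind G x y := by
  unfold ind; split_ifs <;> norm_num

lemma ind_le_one (G : SimpleGraph (Fin n)) (x y : Fin n) : ind G x y ≤ 1 := by
  unfold ind; split_ifs <;> norm_num

lemma ind_comm (G : SimpleGraph (Fin n)) (x y : Fin n) : ind G x y = ind G y x := by
  by_cases h : G.Adj x y
  · simp [ind, h, h.symm]
  · have h' : ¬ G.Adj y x := fun h' => h h'.symm
    simp [ind, h, h']

@[simp] lemma ind_self (G : SimpleGraph (Fin n)) (x : Fin n) : ind G x x = 0 := by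
  simp [ind]

lemma ind_of_adj {G : SimpleGraph (Fin n)} {x y : Fin n} (h : G.Adj x y) : ind G x y = 1 := by
  simp [ind, h]

lemma ind_of_not_adj {G : SimpleGraph (Fin n)} {x y : Fin n} (h : ¬ G.Adj x y) :
    ind G x y = 0 := by
  simp [ind, h]

lemma ind_of_iff {G : SimpleGraph (Fin n)} {x y : Fin n} {p : Prop} [Decidable p]
    (h : G.Adj x y ↔ p) : ind G x y = if p then 1 else 0 := by
  by_cases hp : p
  · rw [if_pos hp, ind_of_adj (h.2 hp)]
  · rw [if_neg hp, ind_of_not_adj fun h' => hp (h.1 h')]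

lemma bar_nonneg (G : SimpleGraph (Fin n)) (x y : Fin n) : 0 ≤ bar G x y := by
  unfold bar; split_ifs <;> simp [ind_nonneg]

lemma bar_le_one (G : SimpleGraph (Fin n)) (x y : Fin n) : bar G x y ≤ 1 := by
  unfold bar; split_ifs <;> simp [ind_le_one]

@[simp] lemma bar_self (G : SimpleGraph (Fin n)) (x : Fin n) : bar G x x = 1 := by
  simp [bar]

lemma bar_eq (G : SimpleGraph (Fin n)) (x y : Fin n) :
    bar G x y = ind G x y + if x = y then 1 else 0 := by
  unfold bar; split_ifs with h <;> simp [h]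

open Classical in
/-- The `d`-regular graphs containing `K`. -/
noncomputable def fam (d : ℝ) (K : SimpleGraph (Fin n)) : Finset (SimpleGraph (Fin n)) :=
  univ.filter fun G => K ≤ G ∧ ∀ x, ∑ y, ind G x y = d

/-- Sum of a function over the `d`-regular graphs containing `K`. -/
noncomputable def tot (d : ℝ) (K : SimpleGraph (Fin n)) (φ : SimpleGraph (Fin n) → ℝ) : ℝ :=
  ∑ G ∈ fam d K, φ G

/-- Number of `d`-regular graphs containing `K`. -/
noncomputable def cnt (d : ℝ) (K : SimpleGraph (Fin n)) : ℝ := tot d K fun _ => 1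

/-- Residual degree. -/
noncomputable def res (d : ℝ) (K : SimpleGraph (Fin n)) (x : Fin n) : ℝ := d - ∑ y, ind K x y

/-- Total residual degree. -/
noncomputable def rsum (d : ℝ) (K : SimpleGraph (Fin n)) : ℝ := ∑ x, res d K x

variable {d : ℝ} {K : SimpleGraph (Fin n)}

lemma mem_fam {G : SimpleGraph (Fin n)} :
    G ∈ fam d K ↔ K ≤ G ∧ ∀ x, ∑ y, ind G x y = d := by
  simp [fam]

lemma ind_mono {G : SimpleGraph (Fin n)} (h : K ≤ G) (x y : Fin n) : ind K x y ≤ ind G x y := by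
  by_cases hk : K.Adj x y
  · rw [ind_of_adj hk, ind_of_adj (h hk)]
  · rw [ind_of_not_adj hk]; exact ind_nonneg _ _ _

lemma ind_mul_of_le {G : SimpleGraph (Fin n)} (h : K ≤ G) (x y : Fin n) :
    ind K x y * ind G x y = ind K x y := by
  by_cases hk : K.Adj x y
  · rw [ind_of_adj hk, ind_of_adj (h hk)]; norm_num
  · rw [ind_of_not_adj hk]; simp

lemma cnt_nonneg : 0 ≤ cnt d K := by
  unfold cnt tot; exact sum_nonneg fun _ _ => zero_le_one

lemma cnt_eq_card : cnt d K = #(fam d K) := by simp [cnt, tot]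

lemma tot_const (c : ℝ) : tot d K (fun _ => c) = c * cnt d K := by
  simp [tot, cnt, mul_comm]

lemma tot_add (φ ψ : SimpleGraph (Fin n) → ℝ) :
    tot d K (fun G => φ G + ψ G) = tot d K φ + tot d K ψ := sum_add_distrib

lemma tot_sub (φ ψ : SimpleGraph (Fin n) → ℝ) :
    tot d K (fun G => φ G - ψ G) = tot d K φ - tot d K ψ := sum_sub_distrib _ _

lemma tot_mul_left (c : ℝ) (φ : SimpleGraph (Fin n) → ℝ) :
    tot d K (fun G => c * φ G) = c * tot d K φ := (mul_sum _ _ _).symm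

lemma tot_sum {ι : Type*} (s : Finset ι) (φ : ι → SimpleGraph (Fin n) → ℝ) :
    tot d K (fun G => ∑ i ∈ s, φ i G) = ∑ i ∈ s, tot d K (φ i) := sum_comm

lemma tot_le_tot {φ ψ : SimpleGraph (Fin n) → ℝ} (h : ∀ G ∈ fam d K, φ G ≤ ψ G) :
    tot d K φ ≤ tot d K ψ := sum_le_sum h

lemma tot_congr {φ ψ : SimpleGraph (Fin n) → ℝ} (h : ∀ G ∈ fam d K, φ G = ψ G) :
    tot d K φ = tot d K ψ := sum_congr rfl h

lemma tot_nonneg {φ : SimpleGraph (Fin n) → ℝ} (h : ∀ G ∈ fam d K, 0 ≤ φ G) :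
    0 ≤ tot d K φ := sum_nonneg h

/-- Adding an edge. -/
noncomputable def addE (K : SimpleGraph (Fin n)) (u v : Fin n) : SimpleGraph (Fin n) :=
  K ⊔ SimpleGraph.edge u v

lemma addE_adj {u v x y : Fin n} (huv : u ≠ v) :
    (addE K u v).Adj x y ↔ K.Adj x y ∨ (x = u ∧ y = v ∨ x = v ∧ y = u) := by
  simp only [addE, SimpleGraph.sup_adj, SimpleGraph.edge_adj]
  constructor
  · rintro (h | h)
    · exact Or.inl h
    · exact Or.inr h.1
  · rintro (h | h)
    · exact Or.inl h
    · refine Or.inr ⟨h, ?_⟩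
      rcases h with ⟨rfl, rfl⟩ | ⟨rfl, rfl⟩
      · exact huv
      · exact huv.symm

lemma addE_comm (u v : Fin n) : addE K u v = addE K v u := by
  simp [addE, SimpleGraph.edge_comm]

lemma le_addE (u v : Fin n) : K ≤ addE K u v := le_sup_left

lemma addE_le_iff {G : SimpleGraph (Fin n)} {u v : Fin n} (huv : u ≠ v) :
    addE K u v ≤ G ↔ K ≤ G ∧ G.Adj u v := by
  simp [addE, huv]

lemma ind_addE {u v : Fin n} (huv : u ≠ v) (hK : ¬ K.Adj u v) (x y : Fin n) :
    ind (addE K u v) x y = ind K x y + (if x = u ∧ y = v then 1 else 0)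
      + (if x = v ∧ y = u then 1 else 0) := by
  classical
  have hK' : ¬ K.Adj v u := fun h => hK h.symm
  rw [ind_of_iff (addE_adj huv)]
  unfold ind
  by_cases h1 : x = u ∧ y = v
  · obtain ⟨rfl, rfl⟩ := h1
    simp [hK, huv]
  · by_cases h2 : x = v ∧ y = u
    · obtain ⟨rfl, rfl⟩ := h2
      simp [hK', huv.symm]
    · simp [h1, h2]

lemma res_addE {u v : Fin n} (huv : u ≠ v) (hK : ¬ K.Adj u v) (x : Fin n) :
    res d (addE K u v) x = res d K x - (if x = u then 1 else 0) - (if x = v then 1 else 0) := by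
  unfold res
  simp_rw [ind_addE huv hK, sum_add_distrib, ite_and]
  simp only [sum_ite_irrel, sum_const_zero, sum_ite_eq', mem_univ, if_true]
  ring

lemma rsum_addE {u v : Fin n} (huv : u ≠ v) (hK : ¬ K.Adj u v) :
    rsum d (addE K u v) = rsum d K - 2 := by
  unfold rsum
  simp_rw [res_addE huv hK, sum_sub_distrib]
  simp; ring

lemma tot_ind_mul {u v : Fin n} (huv : u ≠ v) (φ : SimpleGraph (Fin n) → ℝ) :
    tot d K (fun G => ind G u v * φ G) = tot d (addE K u v) φ := by
  classical
  have : fam d (addE K u v) = (fam d K).filter fun G => G.Adj u v := by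
    ext G; simp only [mem_filter, mem_fam, addE_le_iff huv]; tauto
  unfold tot
  rw [this, sum_filter]
  refine sum_congr rfl fun G _ => ?_
  by_cases h : G.Adj u v <;> simp [ind, h]

lemma tot_ind {u v : Fin n} (huv : u ≠ v) :
    tot d K (fun G => ind G u v) = cnt d (addE K u v) := by
  rw [cnt, ← tot_ind_mul huv]; simp

lemma sum_res_ind {G : SimpleGraph (Fin n)} (hG : G ∈ fam d K) (x : Fin n) :
    ∑ y, (1 - ind K x y) * ind G x y = res d K x := by
  rw [mem_fam] at hG
  simp_rw [sub_mul, one_mul, ind_mul_of_le hG.1, sum_sub_distrib, hG.2 x]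
  rfl

lemma sum_res_ind' {G : SimpleGraph (Fin n)} (hG : G ∈ fam d K) :
    ∑ x, ∑ y, (1 - ind K x y) * ind G x y = rsum d K :=
  sum_congr rfl fun x _ => sum_res_ind hG x

lemma res_nonneg {G : SimpleGraph (Fin n)} (hG : G ∈ fam d K) (x : Fin n) : 0 ≤ res d K x := by
  rw [← sum_res_ind hG]
  exact sum_nonneg fun y _ => mul_nonneg (by linarith [ind_le_one K x y]) (ind_nonneg _ _ _)

lemma res_le (x : Fin n) : res d K x ≤ d := by
  unfold res
  linarith [sum_nonneg fun y (_ : y ∈ univ) => ind_nonneg K x y]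

lemma sum_bar {G : SimpleGraph (Fin n)} (hG : G ∈ fam d K) (x : Fin n) :
    ∑ y, bar G x y = d + 1 := by
  simp_rw [bar_eq, sum_add_distrib, (mem_fam.1 hG).2 x]; simp

/-! ### Switchings -/

/-- The four-cycle `u v y x`. -/
noncomputable def fourCycle (u v x y : Fin n) : SimpleGraph (Fin n) :=
  addE (addE (addE (addE ⊥ u v) x y) u x) v y

lemma fourCycle_adj {u v x y : Fin n} (huv : u ≠ v) (hux : u ≠ x) (hvy : v ≠ y) (hxy : x ≠ y)
    (a b : Fin n) :
    (fourCycle u v x y).Adj a b ↔ (a = u ∧ b = v ∨ a = v ∧ b = u) ∨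
        (a = x ∧ b = y ∨ a = y ∧ b = x) ∨
      (a = u ∧ b = x ∨ a = x ∧ b = u) ∨ (a = v ∧ b = y ∨ a = y ∧ b = v) := by
  simp only [fourCycle, addE_adj huv, addE_adj hxy, addE_adj hux, addE_adj hvy,
    SimpleGraph.bot_adj]
  tauto

lemma symmDiff_adj (G C : SimpleGraph (Fin n)) (a b : Fin n) :
    (symmDiff G C).Adj a b ↔ (G.Adj a b ∧ ¬ C.Adj a b ∨ C.Adj a b ∧ ¬ G.Adj a b) := by
  simp [symmDiff]

/-- Switching preserves degrees. -/
lemma sum_ind_switch {u v x y : Fin n} (huv : u ≠ v) (hux : u ≠ x) (huy : u ≠ y) (hvx : v ≠ x)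
    (hvy : v ≠ y) (hxy : x ≠ y) {G : SimpleGraph (Fin n)} (h1 : G.Adj u v) (h2 : G.Adj x y)
    (h3 : ¬ G.Adj u x) (h4 : ¬ G.Adj v y) (a : Fin n) :
    ∑ b, ind (symmDiff G (fourCycle u v x y)) a b = ∑ b, ind G a b := by
  classical
  have key : ∀ b, ind (symmDiff G (fourCycle u v x y)) a b = ind G a b
      + ((if a = u then ((if b = x then 1 else 0) - (if b = v then 1 else 0)) else 0)
      + (if a = v then ((if b = y then 1 else 0) - (if b = u then 1 else 0)) else 0)
      + (if a = x then ((if b = u then 1 else 0) - (if b = y then 1 else 0)) else 0)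
      + (if a = y then ((if b = v then 1 else 0) - (if b = x then 1 else 0)) else 0)) := by
    intro b
    rw [ind_of_iff (symmDiff_adj _ _ _ _)]
    simp only [ind, fourCycle_adj huv hux hvy hxy]
    have h1' := h1.symm
    have h2' := h2.symm
    have h3' : ¬ G.Adj x u := fun h => h3 h.symm
    have h4' : ¬ G.Adj y v := fun h => h4 h.symm
    by_cases hau : a = u
    · subst hau
      by_cases hbx : b = x
      · subst hbx; simp [*, hvx.symm]
      · by_cases hbv : b = v
        · subst hbv; simp [*, huv.symm]
        · simp [*]
    · by_cases hav : a = v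
      · subst hav
        by_cases hbx : b = y
        · subst hbx; simp [*, huy.symm]
        · by_cases hbv : b = u
          · subst hbv; simp [*]
          · simp [*]
      · by_cases hax : a = x
        · subst hax
          by_cases hbx : b = u
          · subst hbx; simp [*]
          · by_cases hbv : b = y
            · subst hbv; simp [*]
            · simp [*]
        · by_cases hay : a = y
          · subst hay
            by_cases hbx : b = v
            · subst hbx; simp [*]
            · by_cases hbv : b = x
              · subst hbv; simp [*]
              · simp [*]
          · simp [*]
  simp_rw [key, sum_add_distrib]
  simp

lemma switch_aux {u v x y : Fin n} (huv : u ≠ v) (hux : u ≠ x) (huy : u ≠ y) (hvx : v ≠ x)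
    (hvy : v ≠ y) (hxy : x ≠ y) {G : SimpleGraph (Fin n)} (hG : G ∈ fam d K)
    (h1 : G.Adj u v) (h2 : G.Adj x y) (h3 : ¬ G.Adj u x) (h4 : ¬ G.Adj v y)
    (hK1 : ¬ K.Adj u v) (hK2 : ¬ K.Adj x y) :
    symmDiff G (fourCycle u v x y) ∈ fam d K ∧ (symmDiff G (fourCycle u v x y)).Adj u x ∧
    (symmDiff G (fourCycle u v x y)).Adj v y ∧ ¬ (symmDiff G (fourCycle u v x y)).Adj u v ∧
    ¬ (symmDiff G (fourCycle u v x y)).Adj x y := by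
  refine ⟨mem_fam.2 ⟨?_, fun a => ?_⟩, ?_, ?_, ?_, ?_⟩
  · intro a b hab
    rw [symmDiff_adj, fourCycle_adj huv hux hvy hxy]
    have hg := (mem_fam.1 hG).1 hab
    refine Or.inl ⟨hg, ?_⟩
    rintro ((⟨rfl, rfl⟩ | ⟨rfl, rfl⟩) | (⟨rfl, rfl⟩ | ⟨rfl, rfl⟩) | (⟨rfl, rfl⟩ | ⟨rfl, rfl⟩) |
      (⟨rfl, rfl⟩ | ⟨rfl, rfl⟩))
    · exact hK1 hab
    · exact hK1 hab.symm
    · exact hK2 hab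
    · exact hK2 hab.symm
    · exact h3 hg
    · exact h3 hg.symm
    · exact h4 hg
    · exact h4 hg.symm
  · rw [sum_ind_switch huv hux huy hvx hvy hxy h1 h2 h3 h4]; exact (mem_fam.1 hG).2 a
  all_goals
    rw [symmDiff_adj, fourCycle_adj huv hux hvy hxy]
    simp [*]

lemma fourCycle_comm {u v x y : Fin n} (huv : u ≠ v) (hux : u ≠ x) (hvy : v ≠ y)
    (hxy : x ≠ y) : fourCycle u v x y = fourCycle u x v y := by
  ext a b
  rw [fourCycle_adj huv hux hvy hxy, fourCycle_adj hux huv hxy hvy]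
  tauto

/-- The switching identity for a fixed quadruple. -/
lemma switch_quad {u v : Fin n} (huv : u ≠ v) (hK : ¬ K.Adj u v) (x y : Fin n) :
    tot d K (fun G => ind G u v * ((1 - ind K x y) * ind G x y) * (1 - bar G u x)
      * (1 - bar G v y)) =
    tot d K (fun G => (1 - ind G u v) * ((1 - ind K u x) * ind G u x) *
      ((1 - ind K v y) * ind G v y) * (1 - bar G x y)) := by
  classical
  by_cases hux : u = x
  · subst hux; simp
  by_cases hvy : v = y
  · subst hvy; simp
  by_cases hxy : x = y
  · subst hxy; simp
  by_cases hvx : v = x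
  · subst hvx
    refine tot_congr fun G _ => ?_
    by_cases h : G.Adj u v <;> simp [bar, ind, h, hux]
  by_cases huy : u = y
  · subst huy
    refine tot_congr fun G _ => ?_
    by_cases h : G.Adj u v <;> simp [bar, ind, h, hvy, G.adj_comm v u]
  by_cases hK2 : K.Adj x y
  · rw [ind_of_adj hK2]
    have : ∀ G ∈ fam d K, (1 - ind G u v) * ((1 - ind K u x) * ind G u x) *
      ((1 - ind K v y) * ind G v y) * (1 - bar G x y) = 0 := by
      intro G hG
      have := (mem_fam.1 hG).1 hK2
      simp [bar, hxy, ind_of_adj this]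
    rw [tot_congr this]; simp
  by_cases hK3 : K.Adj u x
  · rw [ind_of_adj hK3]
    have : ∀ G ∈ fam d K, ind G u v * ((1 - ind K x y) * ind G x y) * (1 - bar G u x)
      * (1 - bar G v y) = 0 := by
      intro G hG
      have := (mem_fam.1 hG).1 hK3
      simp [bar, hux, ind_of_adj this]
    rw [tot_congr this]; simp
  by_cases hK4 : K.Adj v y
  · rw [ind_of_adj hK4]
    have : ∀ G ∈ fam d K, ind G u v * ((1 - ind K x y) * ind G x y) * (1 - bar G u x)
      * (1 - bar G v y) = 0 := by
      intro G hG
      have := (mem_fam.1 hG).1 hK4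
      simp [bar, hvy, ind_of_adj this]
    rw [tot_congr this]; simp
  have e1 : tot d K (fun G => ind G u v * ((1 - ind K x y) * ind G x y) * (1 - bar G u x)
      * (1 - bar G v y)) =
      #((fam d K).filter fun G => G.Adj u v ∧ G.Adj x y ∧ ¬ G.Adj u x ∧ ¬ G.Adj v y) := by
    rw [tot, card_filter, Nat.cast_sum]
    refine sum_congr rfl fun G _ => ?_
    rw [ind_of_not_adj hK2]
    by_cases a1 : G.Adj u v <;> by_cases a2 : G.Adj x y <;> by_cases a3 : G.Adj u x <;>
      by_cases a4 : G.Adj v y <;> simp [bar, ind, hux, hvy, a1, a2, a3, a4]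
  have e2 : tot d K (fun G => (1 - ind G u v) * ((1 - ind K u x) * ind G u x) *
      ((1 - ind K v y) * ind G v y) * (1 - bar G x y)) =
      #((fam d K).filter fun G => G.Adj u x ∧ G.Adj v y ∧ ¬ G.Adj u v ∧ ¬ G.Adj x y) := by
    rw [tot, card_filter, Nat.cast_sum]
    refine sum_congr rfl fun G _ => ?_
    rw [ind_of_not_adj hK3, ind_of_not_adj hK4]
    by_cases a1 : G.Adj u v <;> by_cases a2 : G.Adj x y <;> by_cases a3 : G.Adj u x <;>
      by_cases a4 : G.Adj v y <;> simp [bar, ind, hxy, a1, a2, a3, a4]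
  rw [e1, e2]
  congr 1
  refine card_bij' (fun G _ => symmDiff G (fourCycle u v x y))
    (fun G _ => symmDiff G (fourCycle u v x y)) ?_ ?_ ?_ ?_
  · intro G hG
    rw [mem_filter] at hG ⊢
    obtain ⟨hG, h1, h2, h3, h4⟩ := hG
    exact switch_aux huv hux huy hvx hvy hxy hG h1 h2 h3 h4 hK hK2
  · intro G hG
    rw [mem_filter] at hG ⊢
    obtain ⟨hG, h1, h2, h3, h4⟩ := hG
    rw [fourCycle_comm huv hux hvy hxy]
    exact switch_aux hux huv huy (Ne.symm hvx) hxy hvy hG h1 h2 h3 h4 hK3 hK4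
  · intro G _; exact symmDiff_symmDiff_cancel_right _ _
  · intro G _; exact symmDiff_symmDiff_cancel_right _ _

end

section

variable {n : ℕ} {d θ : ℝ} {K : SimpleGraph (Fin n)}

/-- The indicator of an edge of `G` outside `K`. -/
noncomputable def new (K G : SimpleGraph (Fin n)) (x y : Fin n) : ℝ := (1 - ind K x y) * ind G x y

/-- The range of parameters in which switchings are effective; `θ` is the edge density. -/
structure Params (n : ℕ) (d θ : ℝ) : Prop where
  hd : 3 ≤ d
  hn : 10 ^ 6 * d ^ 2 ≤ n
  hθ : θ * n = d

lemma Params.n_pos (P : Params n d θ) : (0 : ℝ) < n := by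
  have := P.hn; have := P.hd; nlinarith

lemma Params.θ_pos (P : Params n d θ) : 0 < θ := by
  have := P.hθ; have := P.hd; have := P.n_pos
  by_contra h; push Not at h; nlinarith

lemma Params.θd (P : Params n d θ) : θ * d ≤ 1 / 10 ^ 6 := by
  have h1 := P.hθ; have h2 := P.hn; have h3 := P.n_pos
  have : θ * d * n ≤ 1 / 10 ^ 6 * n := by
    rw [show θ * d * n = d * d by rw [mul_right_comm, h1]]; linarith
  exact le_of_mul_le_mul_right this h3

lemma Params.θ_le (P : Params n d θ) : θ ≤ 1 / 10 ^ 6 := by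
  have := P.θd; have := P.hd; have := P.θ_pos; nlinarith

lemma Params.sq_le (P : Params n d θ) : d ^ 2 ≤ n * d / 3000000 := by
  have h2 := P.hn; have h3 := P.n_pos; have := P.hd; nlinarith

lemma new_nonneg (K G : SimpleGraph (Fin n)) (x y : Fin n) : 0 ≤ new K G x y :=
  mul_nonneg (by linarith [ind_le_one K x y]) (ind_nonneg _ _ _)

lemma new_comm (K G : SimpleGraph (Fin n)) (x y : Fin n) : new K G x y = new K G y x := by
  rw [new, new, ind_comm K, ind_comm G]

@[simp] lemma new_self (K G : SimpleGraph (Fin n)) (x : Fin n) : new K G x x = 0 := by simp [new]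

lemma new_of_adj (G : SimpleGraph (Fin n)) {x y : Fin n} (h : K.Adj x y) : new K G x y = 0 := by
  simp [new, ind_of_adj h]

lemma new_of_not_adj (G : SimpleGraph (Fin n)) {x y : Fin n} (h : ¬ K.Adj x y) :
    new K G x y = ind G x y := by
  simp [new, ind_of_not_adj h]

lemma ind_eq_add_new {G : SimpleGraph (Fin n)} (hG : G ∈ fam d K) (x y : Fin n) :
    ind G x y = ind K x y + new K G x y := by
  rw [new, sub_mul, ind_mul_of_le (mem_fam.1 hG).1]; ring

lemma new_addE (G : SimpleGraph (Fin n)) {u v x y : Fin n} (huv : u ≠ v) (hK : ¬ K.Adj u v)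
    (h : s(u, v) ≠ s(x, y)) : new (addE K u v) G x y = new K G x y := by
  rw [new, new, ind_addE huv hK, if_neg, if_neg]
  · ring
  · rintro ⟨rfl, rfl⟩; exact h Sym2.eq_swap
  · rintro ⟨rfl, rfl⟩; exact h rfl

lemma tot_new_mul {u v : Fin n} (huv : u ≠ v) (hK : ¬ K.Adj u v)
    (φ : SimpleGraph (Fin n) → ℝ) :
    tot d K (fun G => new K G u v * φ G) = tot d (addE K u v) φ := by
  rw [← tot_ind_mul huv]
  exact tot_congr fun G _ => by rw [new_of_not_adj G hK]

lemma tot_new {u v : Fin n} (huv : u ≠ v) (hK : ¬ K.Adj u v) :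
    tot d K (fun G => new K G u v) = cnt d (addE K u v) := by
  rw [cnt, ← tot_new_mul huv hK]; simp

lemma sum_new {G : SimpleGraph (Fin n)} (hG : G ∈ fam d K) (x : Fin n) :
    ∑ y, new K G x y = res d K x := sum_res_ind hG x

lemma sum_new_left {G : SimpleGraph (Fin n)} (hG : G ∈ fam d K) (y : Fin n) :
    ∑ x, new K G x y = res d K y := by
  rw [← sum_new hG]; exact sum_congr rfl fun x _ => new_comm _ _ _ _

lemma sum_new' {G : SimpleGraph (Fin n)} (hG : G ∈ fam d K) :
    ∑ x, ∑ y, new K G x y = rsum d K := sum_res_ind' hG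

lemma fam_addE_subset (u v : Fin n) : fam d (addE K u v) ⊆ fam d K := fun G hG => by
  rw [mem_fam] at hG ⊢
  exact ⟨(le_addE u v).trans hG.1, hG.2⟩

lemma cnt_addE_le_cnt (u v : Fin n) : cnt d (addE K u v) ≤ cnt d K := by
  rw [cnt_eq_card, cnt_eq_card]
  exact_mod_cast card_le_card (fam_addE_subset u v)

lemma mul_cnt_le_mul_cnt {a b : ℝ} (h : (fam d K).Nonempty → a ≤ b) :
    a * cnt d K ≤ b * cnt d K := by
  rcases (fam d K).eq_empty_or_nonempty with h0 | h0
  · simp [cnt, tot, h0]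
  · exact mul_le_mul_of_nonneg_right (h h0) cnt_nonneg

/-- Summation over graphs where the residual degrees are automatically nonnegative. -/
lemma tot_forward_le {u v : Fin n} :
    (rsum d K - 2 * (d * (d + 1))) * cnt d K ≤
      tot d K (fun G => ∑ x, ∑ y, new K G x y * (1 - bar G u x) * (1 - bar G v y)) := by
  rw [← tot_const]
  refine tot_le_tot fun G hG => ?_
  have h1 : ∑ x, ∑ y, bar G u x * new K G x y ≤ d * (d + 1) := by
    simp_rw [← mul_sum, sum_new hG]
    rw [mul_comm, ← sum_bar hG u, sum_mul]
    exact sum_le_sum fun x _ => mul_le_mul_of_nonneg_left (res_le x) (bar_nonneg _ _ _)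
  have h2 : ∑ x, ∑ y, bar G v y * new K G x y ≤ d * (d + 1) := by
    rw [sum_comm]
    simp_rw [← mul_sum, sum_new_left hG]
    rw [mul_comm, ← sum_bar hG v, sum_mul]
    exact sum_le_sum fun x _ => mul_le_mul_of_nonneg_left (res_le x) (bar_nonneg _ _ _)
  have h3 : ∑ x, ∑ y, (new K G x y - bar G u x * new K G x y - bar G v y * new K G x y) ≤
      ∑ x, ∑ y, new K G x y * (1 - bar G u x) * (1 - bar G v y) := by
    refine sum_le_sum fun x _ => sum_le_sum fun y _ => ?_
    have := mul_nonneg (mul_nonneg (new_nonneg K G x y) (bar_nonneg G u x)) (bar_nonneg G v y)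
    nlinarith
  simp_rw [sum_sub_distrib] at h3
  rw [sum_new' hG] at h3
  linarith

/-- The switching identity summed over all quadruples. -/
lemma switch_sum {u v : Fin n} (huv : u ≠ v) (hK : ¬ K.Adj u v) :
    tot d (addE K u v)
      (fun G => ∑ x, ∑ y, new K G x y * (1 - bar G u x) * (1 - bar G v y)) =
    tot d K (fun G => ∑ x, ∑ y, (1 - ind G u v) * new K G u x * new K G v y *
      (1 - bar G x y)) := by
  rw [← tot_ind_mul huv]
  simp_rw [mul_sum, tot_sum]
  refine sum_congr rfl fun x _ => sum_congr rfl fun y _ => ?_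
  refine Eq.trans (tot_congr fun G _ => ?_) (switch_quad huv hK x y)
  rw [new]; ring

lemma new_addE_eq {G : SimpleGraph (Fin n)} {u v x y : Fin n} (huv : u ≠ v) (hK : ¬ K.Adj u v)
    (hG : G ∈ fam d (addE K u v)) : new K G x y * (1 - bar G u x) * (1 - bar G v y) =
      new (addE K u v) G x y * (1 - bar G u x) * (1 - bar G v y) := by
  by_cases h : s(u, v) = s(x, y)
  · rw [Sym2.eq_iff] at h
    have h1 : G.Adj u v := ((addE_le_iff huv).1 (mem_fam.1 hG).1).2
    rcases h with ⟨rfl, rfl⟩ | ⟨rfl, rfl⟩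
    · simp
    · simp [bar, huv, ind_of_adj h1]
  · rw [new_addE G huv hK h]

lemma switch_sum' {u v : Fin n} (huv : u ≠ v) (hK : ¬ K.Adj u v) :
    tot d (addE K u v)
      (fun G => ∑ x, ∑ y, new (addE K u v) G x y * (1 - bar G u x) * (1 - bar G v y)) =
    tot d K (fun G => ∑ x, ∑ y, (1 - ind G u v) * new K G u x * new K G v y *
      (1 - bar G x y)) := by
  rw [← switch_sum huv hK]
  exact tot_congr fun G hG => sum_congr rfl fun x _ => sum_congr rfl fun y _ =>
    (new_addE_eq huv hK hG).symm

lemma sum_new_mul_new {G : SimpleGraph (Fin n)} (hG : G ∈ fam d K) (u v : Fin n) :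
    ∑ x, ∑ y, new K G u x * new K G v y = res d K u * res d K v := by
  simp_rw [← mul_sum, sum_new hG, ← sum_mul, sum_new hG]

lemma tot_backward_le {u v : Fin n} :
    tot d K (fun G => ∑ x, ∑ y, (1 - ind G u v) * new K G u x * new K G v y *
      (1 - bar G x y)) ≤ res d K u * res d K v * cnt d K := by
  rw [← tot_const]
  refine tot_le_tot fun G hG => ?_
  rw [← sum_new_mul_new hG]
  refine sum_le_sum fun x _ => sum_le_sum fun y _ => ?_
  have h1 := mul_nonneg (new_nonneg K G u x) (new_nonneg K G v y)
  have h2 : (1 - ind G u v) * (1 - bar G x y) ≤ 1 := by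
    nlinarith [ind_nonneg G u v, bar_nonneg G x y, ind_le_one G u v, bar_le_one G x y]
  nlinarith

lemma cnt_addE_mul_le {u v : Fin n} (huv : u ≠ v) (hK : ¬ K.Adj u v) :
    (rsum d K - 2 * (d * (d + 1)) - 2) * cnt d (addE K u v) ≤ res d K u * res d K v * cnt d K := by
  have h1 := tot_forward_le (d := d) (K := addE K u v) (u := u) (v := v)
  rw [switch_sum' huv hK, rsum_addE huv hK] at h1
  have := h1.trans tot_backward_le
  linarith

lemma res_mul_res_le {u v : Fin n} :
    res d K u * res d K v * cnt d K ≤ d ^ 2 * cnt d K := by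
  refine mul_cnt_le_mul_cnt fun ⟨G, hG⟩ => ?_
  nlinarith [res_nonneg hG u, res_nonneg hG v, res_le (d := d) (K := K) u,
    res_le (d := d) (K := K) v]

/-- Crude bound on the conditional edge probability. -/
lemma cnt_addE_le (P : Params n d θ) (hS : n * d / 4 ≤ rsum d K) {u v : Fin n} (huv : u ≠ v)
    (hK : ¬ K.Adj u v) : cnt d (addE K u v) ≤ 5 * θ * cnt d K := by
  have h1 := (cnt_addE_mul_le (d := d) huv hK).trans res_mul_res_le
  have h2 := P.sq_le; have hd := P.hd
  have h3 : n * d / 5 ≤ rsum d K - 2 * (d * (d + 1)) - 2 := by nlinarith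
  have h4 := (mul_le_mul_of_nonneg_right h3 (cnt_nonneg (d := d) (K := addE K u v))).trans h1
  have hn := P.n_pos
  have h5 : 0 < n * d / 5 := by positivity
  refine le_of_mul_le_mul_left (h4.trans (le_of_eq ?_)) h5
  have := P.hθ
  linear_combination (-cnt d K * d) * this

lemma tot_new_le (P : Params n d θ) (hS : n * d / 4 ≤ rsum d K) (u v : Fin n) :
    tot d K (fun G => new K G u v) ≤ 5 * θ * cnt d K := by
  have h0 : 0 ≤ 5 * θ * cnt d K := mul_nonneg (by linarith [P.θ_pos]) cnt_nonneg
  by_cases huv : u = v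
  · subst huv; simpa [tot] using h0
  by_cases hK : K.Adj u v
  · simp_rw [new_of_adj _ hK]; simpa [tot] using h0
  rw [tot_new huv hK]; exact cnt_addE_le P hS huv hK

end

section

variable {n : ℕ} {d θ : ℝ} {K : SimpleGraph (Fin n)}

lemma tot_zero : tot d K (fun _ => (0 : ℝ)) = 0 := by simp [tot]

/-- Joint occurrence of several distinct new edges. -/
lemma tot_prod_new_le (P : Params n d θ) (L : List (Fin n × Fin n))
    (hL : L.Pairwise fun e f => s(e.1, e.2) ≠ s(f.1, f.2))
    (hS : n * d / 4 + 2 * L.length ≤ rsum d K) :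
    tot d K (fun G => (L.map fun e => new K G e.1 e.2).prod) ≤ (5 * θ) ^ L.length * cnt d K := by
  have hθ := P.θ_pos
  induction L generalizing K with
  | nil => simp [cnt]
  | cons e L ih =>
    rw [List.pairwise_cons] at hL
    simp only [List.length_cons, Nat.cast_add, Nat.cast_one, List.map_cons, List.prod_cons] at hS ⊢
    have hl : (0 : ℝ) ≤ L.length := Nat.cast_nonneg _
    have h0 : 0 ≤ (5 * θ) ^ (L.length + 1) * cnt d K := mul_nonneg (by positivity) cnt_nonneg
    by_cases huv : e.1 = e.2
    · simpa [huv, tot_zero] using h0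
    by_cases hK : K.Adj e.1 e.2
    · simpa [new_of_adj _ hK, tot_zero] using h0
    rw [tot_new_mul huv hK]
    have h1 := ih (K := addE K e.1 e.2) hL.2 (by rw [rsum_addE huv hK]; linarith)
    have h2 : tot d (addE K e.1 e.2) (fun G => (L.map fun e => new K G e.1 e.2).prod) =
        tot d (addE K e.1 e.2)
          (fun G => (L.map fun f => new (addE K e.1 e.2) G f.1 f.2).prod) := by
      refine tot_congr fun G _ => ?_
      congr 1
      exact List.map_congr_left fun f hf => (new_addE G huv hK (hL.1 f hf)).symm
    rw [h2]
    refine h1.trans ?_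
    rw [pow_succ, mul_assoc]
    exact mul_le_mul_of_nonneg_left (cnt_addE_le P (by linarith) huv hK) (by positivity)

lemma tot_two_new_le (P : Params n d θ) (hS : n * d / 4 + 4 ≤ rsum d K) {a b c e : Fin n}
    (h : s(a, b) ≠ s(c, e)) :
    tot d K (fun G => new K G a b * new K G c e) ≤ 25 * θ ^ 2 * cnt d K := by
  have := tot_prod_new_le P (K := K) [(a, b), (c, e)] (by simpa using h) (by norm_num; linarith)
  simp only [List.map_cons, List.map_nil, List.prod_cons, List.prod_nil, mul_one,
    List.length_cons, List.length_nil] at this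
  refine this.trans (le_of_eq (by ring))

lemma tot_three_new_le (P : Params n d θ) (hS : n * d / 4 + 6 ≤ rsum d K) {a b c e f g : Fin n}
    (h1 : s(a, b) ≠ s(c, e)) (h2 : s(a, b) ≠ s(f, g)) (h3 : s(c, e) ≠ s(f, g)) :
    tot d K (fun G => new K G a b * new K G c e * new K G f g) ≤ 125 * θ ^ 3 * cnt d K := by
  have := tot_prod_new_le P (K := K) [(a, b), (c, e), (f, g)]
    (by simp only [List.pairwise_cons, List.mem_cons]; aesop) (by norm_num; linarith)
  simp only [List.map_cons, List.map_nil, List.prod_cons, List.prod_nil, mul_one,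
    List.length_cons, List.length_nil, ← mul_assoc] at this
  refine this.trans (le_of_eq (by ring))

lemma tot_four_new_le (P : Params n d θ) (hS : n * d / 4 + 8 ≤ rsum d K)
    {a b c e f g i j : Fin n}
    (h1 : s(a, b) ≠ s(c, e)) (h2 : s(a, b) ≠ s(f, g)) (h3 : s(c, e) ≠ s(f, g))
    (h4 : s(a, b) ≠ s(i, j)) (h5 : s(c, e) ≠ s(i, j)) (h6 : s(f, g) ≠ s(i, j)) :
    tot d K (fun G => new K G a b * new K G c e * new K G f g * new K G i j) ≤
      625 * θ ^ 4 * cnt d K := by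
  have := tot_prod_new_le P (K := K) [(a, b), (c, e), (f, g), (i, j)]
    (by simp only [List.pairwise_cons, List.mem_cons]; aesop) (by norm_num; linarith)
  simp only [List.map_cons, List.map_nil, List.prod_cons, List.prod_nil, mul_one,
    List.length_cons, List.length_nil, ← mul_assoc] at this
  refine this.trans (le_of_eq (by ring))

lemma sum_ind_res_le {G : SimpleGraph (Fin n)} (hG : G ∈ fam d K) (u : Fin n) :
    ∑ x, ind K u x ≤ d := by
  have := res_nonneg hG u; unfold res at this; linarith

lemma exists_mem_of_cnt_ne (h : cnt d K ≠ 0) : ∃ G, G ∈ fam d K := by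
  by_contra h'
  push Not at h'
  exact h (by rw [cnt, tot, eq_empty_of_forall_notMem h', sum_empty])

lemma tot_eq_zero_of_cnt (h : cnt d K = 0) (φ : SimpleGraph (Fin n) → ℝ) : tot d K φ = 0 := by
  rw [cnt_eq_card, Nat.cast_eq_zero, card_eq_zero] at h
  rw [tot, h, sum_empty]

lemma one_sub_ind_mul_new (G : SimpleGraph (Fin n)) (x y : Fin n) :
    (1 - ind G x y) * new K G x y = 0 := by
  by_cases h : G.Adj x y
  · simp [ind_of_adj h]
  · simp [new, ind_of_not_adj h]

/-- Expansion of the backward switchings. -/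
lemma tot_backward_eq {u v : Fin n} (huv : u ≠ v) :
    tot d K (fun G => ∑ x, ∑ y, (1 - ind G u v) * new K G u x * new K G v y *
      (1 - bar G x y)) =
    res d K u * res d K v * (cnt d K - cnt d (addE K u v))
    - ∑ x, tot d K (fun G => (1 - ind G u v) * (new K G u x * new K G v x))
    - ∑ x, ∑ y, ind K x y * tot d K (fun G => (1 - ind G u v) * (new K G u x * new K G v y))
    - ∑ x, ∑ y, tot d K (fun G => (1 - ind G u v) * (new K G u x * new K G v y * new K G x y)) := by
  have h1 : cnt d K - cnt d (addE K u v) = tot d K (fun G => 1 - ind G u v) := by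
    rw [tot_sub, tot_ind huv]; rfl
  rw [h1]
  simp_rw [← tot_mul_left, ← tot_sum, ← tot_sub]
  refine tot_congr fun G hG => ?_
  have h2 : ∀ x y, (1 - ind G u v) * new K G u x * new K G v y * (1 - bar G x y) =
      (1 - ind G u v) * (new K G u x * new K G v y)
      - (if x = y then (1 - ind G u v) * (new K G u x * new K G v y) else 0)
      - ind K x y * ((1 - ind G u v) * (new K G u x * new K G v y))
      - (1 - ind G u v) * (new K G u x * new K G v y * new K G x y) := fun x y => by
    rw [bar_eq, ind_eq_add_new hG x y]; split_ifs <;> ring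
  simp_rw [h2, sum_sub_distrib, ← mul_sum, sum_new hG, ← sum_mul, sum_new hG]
  simp only [sum_ite_eq, mem_univ, if_true, ← mul_sum]
  ring

lemma sum_sum_ind_le {G : SimpleGraph (Fin n)} (hG : G ∈ fam d K) :
    ∑ x, ∑ y, ind K x y ≤ n * d := by
  refine (sum_le_sum fun x _ => sum_ind_res_le hG x).trans ?_
  simp

lemma tot_kill_two_le (P : Params n d θ) (hS : n * d / 4 + 8 ≤ rsum d K) {u v : Fin n}
    (huv : u ≠ v) (x y : Fin n) :
    tot d K (fun G => (1 - ind G u v) * (new K G u x * new K G v y)) ≤ 25 * θ ^ 2 * cnt d K := by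
  by_cases h : s(u, x) = s(v, y)
  · have hx : x = v ∧ y = u := by
      rw [Sym2.eq_iff] at h
      rcases h with ⟨h1, _⟩ | ⟨h1, h2⟩
      · exact absurd h1 huv
      · exact ⟨h2, h1.symm⟩
    obtain ⟨rfl, rfl⟩ := hx
    simp_rw [← mul_assoc, one_sub_ind_mul_new, zero_mul, tot_zero]
    have := P.θ_pos
    exact mul_nonneg (by positivity) cnt_nonneg
  · refine (tot_le_tot fun G hG => ?_).trans (tot_two_new_le P (by linarith) h)
    have := mul_nonneg (new_nonneg K G u x) (new_nonneg K G v y)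
    nlinarith [ind_nonneg G u v]

lemma tot_kill_three_le (P : Params n d θ) (hS : n * d / 4 + 8 ≤ rsum d K) {u v : Fin n}
    (huv : u ≠ v) (x y : Fin n) :
    tot d K (fun G => (1 - ind G u v) * (new K G u x * new K G v y * new K G x y)) ≤
      125 * θ ^ 3 * cnt d K := by
  have h0 : 0 ≤ 125 * θ ^ 3 * cnt d K := mul_nonneg (by have := P.θ_pos; positivity) cnt_nonneg
  by_cases hx : x = v
  · subst hx
    simpa [← mul_assoc, one_sub_ind_mul_new, tot_zero] using h0
  by_cases hy : y = u
  · subst hy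
    simp_rw [new_comm K _ v y, mul_comm (new K _ y x) (new K _ y v)]
    simpa [← mul_assoc, one_sub_ind_mul_new, tot_zero] using h0
  refine (tot_le_tot fun G hG => ?_).trans
    (tot_three_new_le P (a := u) (b := x) (c := v) (e := y) (f := x) (g := y) (by linarith)
        ?_ ?_ ?_)
  · have := mul_nonneg (mul_nonneg (new_nonneg K G u x) (new_nonneg K G v y)) (new_nonneg K G x y)
    nlinarith [ind_nonneg G u v]
  all_goals rw [Ne, Sym2.eq_iff]; grind

/-- Bound on the number of backward switchings that are lost. -/
lemma tot_backward_ge (P : Params n d θ) (hS : n * d / 4 + 8 ≤ rsum d K) {u v : Fin n}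
    (huv : u ≠ v) (hK : ¬ K.Adj u v) :
    (res d K u * res d K v - 180 * θ * d ^ 2) * cnt d K ≤
    tot d K (fun G => ∑ x, ∑ y, (1 - ind G u v) * new K G u x * new K G v y *
      (1 - bar G x y)) := by
  rw [tot_backward_eq huv]
  by_cases h0 : cnt d K = 0
  · have h1 : cnt d (addE K u v) = 0 :=
      le_antisymm (h0 ▸ cnt_addE_le_cnt u v) cnt_nonneg
    simp [tot_eq_zero_of_cnt h0, h0, h1]
  obtain ⟨G, hG⟩ := exists_mem_of_cnt_ne h0
  have hN := cnt_nonneg (d := d) (K := K)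
  have hθ := P.θ_pos; have hθn := P.hθ; have hd := P.hd
  have b1 : ∑ x, tot d K (fun G => (1 - ind G u v) * (new K G u x * new K G v x)) ≤
      25 * d * θ * cnt d K := by
    refine (sum_le_sum fun x _ => tot_kill_two_le P hS huv x x).trans (le_of_eq ?_)
    simp only [sum_const, card_univ, Fintype.card_fin, nsmul_eq_mul]
    linear_combination (25 * θ * cnt d K) * hθn
  have b2 : ∑ x, ∑ y, ind K x y *
      tot d K (fun G => (1 - ind G u v) * (new K G u x * new K G v y)) ≤
      25 * d ^ 2 * θ * cnt d K := by
    calc _ ≤ ∑ x, ∑ y, ind K x y * (25 * θ ^ 2 * cnt d K) :=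
          sum_le_sum fun x _ => sum_le_sum fun y _ =>
            mul_le_mul_of_nonneg_left (tot_kill_two_le P hS huv x y) (ind_nonneg _ _ _)
      _ = (∑ x, ∑ y, ind K x y) * (25 * θ ^ 2 * cnt d K) := by simp_rw [sum_mul]
      _ ≤ n * d * (25 * θ ^ 2 * cnt d K) :=
          mul_le_mul_of_nonneg_right (sum_sum_ind_le hG) (by positivity)
      _ = _ := by linear_combination (25 * d * θ * cnt d K) * hθn
  have b3 : ∑ x, ∑ y,
      tot d K (fun G => (1 - ind G u v) * (new K G u x * new K G v y * new K G x y)) ≤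
      125 * d ^ 2 * θ * cnt d K := by
    refine (sum_le_sum fun x _ => sum_le_sum fun y _ => tot_kill_three_le P hS huv x y).trans
      (le_of_eq ?_)
    simp only [sum_const, card_univ, Fintype.card_fin, nsmul_eq_mul]
    linear_combination (125 * θ * cnt d K) * (n * θ + d) * hθn
  have b4 : res d K u * res d K v * cnt d (addE K u v) ≤ 5 * d ^ 2 * θ * cnt d K := by
    have h1 := cnt_addE_le P (by linarith) huv hK
    have h2 : res d K u * res d K v ≤ d ^ 2 := by
      nlinarith [res_nonneg hG u, res_nonneg hG v, res_le (d := d) (K := K) u,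
        res_le (d := d) (K := K) v]
    have h3 := mul_le_mul h2 h1 cnt_nonneg (by positivity)
    linarith
  have h5 : 25 * d * θ * cnt d K ≤ 9 * d ^ 2 * θ * cnt d K := by
    have : 0 ≤ θ * cnt d K * d := by positivity
    nlinarith
  have h6 : 0 ≤ d ^ 2 * θ * cnt d K := by positivity
  linarith

/-- First order estimate for the conditional edge probability. -/
lemma cnt_addE_first (P : Params n d θ) (hS : n * d / 4 + 8 ≤ rsum d K) {u v : Fin n}
    (huv : u ≠ v) (hK : ¬ K.Adj u v) :
    |cnt d (addE K u v) * rsum d K - res d K u * res d K v * cnt d K| ≤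
      180 * θ * d ^ 2 * cnt d K := by
  have hd := P.hd
  have h1 := cnt_addE_mul_le (d := d) huv hK
  have h2 := cnt_addE_le P (by linarith) huv hK
  have h3 := tot_backward_ge P hS huv hK
  rw [← switch_sum' huv hK] at h3
  have h4 : tot d (addE K u v) (fun G => ∑ x, ∑ y, new (addE K u v) G x y * (1 - bar G u x) *
      (1 - bar G v y)) ≤ rsum d K * cnt d (addE K u v) := by
    rw [← tot_const]
    refine tot_le_tot fun G hG => ?_
    have h5 := sum_new' hG
    rw [rsum_addE huv hK] at h5
    have h6 : ∑ x, ∑ y, new (addE K u v) G x y * (1 - bar G u x) * (1 - bar G v y) ≤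
        ∑ x, ∑ y, new (addE K u v) G x y := by
      refine sum_le_sum fun x _ => sum_le_sum fun y _ => ?_
      have := new_nonneg (addE K u v) G x y
      have h7 : (1 - bar G u x) * (1 - bar G v y) ≤ 1 := by
        nlinarith [bar_nonneg G u x, bar_nonneg G v y, bar_le_one G u x, bar_le_one G v y]
      nlinarith
    linarith
  have hN := cnt_nonneg (d := d) (K := addE K u v)
  have hN' := cnt_nonneg (d := d) (K := K)
  have hθ := P.θ_pos
  have h8 : (2 * (d * (d + 1)) + 2) * cnt d (addE K u v) ≤ 4 * d ^ 2 * (5 * θ * cnt d K) := by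
    refine mul_le_mul (by nlinarith) h2 hN (by positivity)
  have h9 : 0 ≤ d ^ 2 * θ * cnt d K := by positivity
  rw [abs_le]
  constructor <;> linarith

end

section

variable {n : ℕ} {d θ : ℝ} {K : SimpleGraph (Fin n)}

lemma abs_res_mul_le {a b d : ℝ} (ha : |a| ≤ d) (hb : |b| ≤ d) : |a * b| ≤ d ^ 2 := by
  rw [abs_mul, sq]; exact mul_le_mul ha hb (abs_nonneg _) ((abs_nonneg _).trans ha)

lemma abs_res_le {G : SimpleGraph (Fin n)} (hG : G ∈ fam d K) (x : Fin n) : |res d K x| ≤ d := by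
  rw [abs_of_nonneg (res_nonneg hG x)]; exact res_le x

lemma abs_res_sub_one_le {G : SimpleGraph (Fin n)} (hG : G ∈ fam d K) (hd : 3 ≤ d) (x : Fin n) :
    |res d K x - 1| ≤ d := by
  rw [abs_le]; constructor <;> linarith [res_nonneg hG x, res_le (d := d) (K := K) x]

lemma div_le_density (P : Params n d θ) {S ρ : ℝ} (hS : n * d / 4 ≤ S) (hρ : |ρ| ≤ d ^ 2) :
    |ρ / S| ≤ 4 * θ := by
  have hn := P.n_pos; have hd := P.hd; have hθ := P.hθ; have := P.θ_pos
  have hS0 : 0 < S := lt_of_lt_of_le (by positivity) hS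
  rw [abs_div, abs_of_pos hS0, div_le_iff₀ hS0]
  refine hρ.trans ?_
  have : d ^ 2 = 4 * θ * (n * d / 4) := by linear_combination (-d) * hθ
  rw [this]
  exact mul_le_mul_of_nonneg_left hS (by positivity)

/-- First order estimate with a perturbed normalisation. -/
lemma cnt_addE_first_div (P : Params n d θ) (hS : n * d / 4 + 8 ≤ rsum d K) {u v : Fin n}
    (huv : u ≠ v) (hK : ¬ K.Adj u v) {S : ℝ} (hS1 : n * d / 4 ≤ S) (hS2 : |S - rsum d K| ≤ 6) :
    |cnt d (addE K u v) - res d K u * res d K v / S * cnt d K| ≤ 800 * θ ^ 2 * cnt d K := by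
  have h1 := cnt_addE_first P hS huv hK
  have hn := P.n_pos; have hd := P.hd; have hθ := P.hθ; have hθ0 := P.θ_pos
  have hN := cnt_nonneg (d := d) (K := K)
  have hN1 := cnt_addE_le P (by linarith) huv hK
  have hN1' := cnt_nonneg (d := d) (K := addE K u v)
  have hS0 : 0 < S := lt_of_lt_of_le (by positivity) hS1
  have e : cnt d (addE K u v) - res d K u * res d K v / S * cnt d K =
    ((cnt d (addE K u v) * rsum d K - res d K u * res d K v * cnt d K) +
      cnt d (addE K u v) * (S - rsum d K)) / S := by field_simp; ring
  rw [e, abs_div, abs_of_pos hS0, div_le_iff₀ hS0]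
  refine (abs_add_le _ _).trans ?_
  rw [abs_mul (cnt d (addE K u v)), abs_of_nonneg hN1']
  have h2 : cnt d (addE K u v) * |S - rsum d K| ≤ 5 * θ * cnt d K * 6 :=
    mul_le_mul hN1 hS2 (abs_nonneg _) (by positivity)
  have h3 : 800 * θ ^ 2 * cnt d K * (n * d / 4) ≤ 800 * θ ^ 2 * cnt d K * S :=
    mul_le_mul_of_nonneg_left hS1 (by positivity)
  have h4 : 800 * θ ^ 2 * cnt d K * (n * d / 4) = 200 * θ * d ^ 2 * cnt d K := by
    linear_combination (200 * θ * cnt d K * d) * hθ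
  have h5 : 0 ≤ θ * cnt d K * (d ^ 2 - 9) := by
    have : 0 ≤ d ^ 2 - 9 := by nlinarith
    positivity
  nlinarith

/-- Extending an estimate for `cnt d K₂` by one more edge. -/
lemma cnt_chain (P : Params n d θ) {K₂ : SimpleGraph (Fin n)}
    (hS : n * d / 4 + 8 ≤ rsum d K₂) {c e : Fin n} (hce : c ≠ e) (hK : ¬ K₂.Adj c e) {S : ℝ}
    (hS1 : n * d / 4 ≤ S) (hS2 : |S - rsum d K₂| ≤ 6) {ρ q M E N : ℝ}
    (hρ : res d K₂ c * res d K₂ e = ρ) (hr : |ρ| ≤ d ^ 2)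
    (h : |cnt d K₂ - q * N| ≤ E * N) (hM : cnt d K₂ ≤ M * N) :
    |cnt d (addE K₂ c e) - ρ / S * q * N| ≤ (800 * θ ^ 2 * M + 4 * θ * E) * N := by
  subst hρ
  have hθ0 := P.θ_pos
  have h1 := cnt_addE_first_div P hS hce hK hS1 hS2
  have h2 := div_le_density P hS1 hr
  have e1 : cnt d (addE K₂ c e) - res d K₂ c * res d K₂ e / S * q * N =
    (cnt d (addE K₂ c e) - res d K₂ c * res d K₂ e / S * cnt d K₂) +
      res d K₂ c * res d K₂ e / S * (cnt d K₂ - q * N) := by ring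
  rw [e1]
  refine (abs_add_le _ _).trans ?_
  rw [abs_mul (res d K₂ c * res d K₂ e / S)]
  have h3 := mul_le_mul h2 h (abs_nonneg _) (by positivity)
  have h4 : 800 * θ ^ 2 * cnt d K₂ ≤ 800 * θ ^ 2 * (M * N) :=
    mul_le_mul_of_nonneg_left hM (by positivity)
  linarith

section Chains
variable {u v x y : Fin n} {G : SimpleGraph (Fin n)}

lemma res_addE_ne {u v : Fin n} (huv : u ≠ v) (hK : ¬ K.Adj u v) {x : Fin n} (h1 : x ≠ u)
    (h2 : x ≠ v) : res d (addE K u v) x = res d K x := by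
  rw [res_addE huv hK, if_neg h1, if_neg h2]; ring

lemma res_addE_left {u v : Fin n} (huv : u ≠ v) (hK : ¬ K.Adj u v) :
    res d (addE K u v) u = res d K u - 1 := by
  rw [res_addE huv hK, if_pos rfl, if_neg huv]; ring

lemma res_addE_right {u v : Fin n} (huv : u ≠ v) (hK : ¬ K.Adj u v) :
    res d (addE K u v) v = res d K v - 1 := by
  rw [res_addE huv hK, if_pos rfl, if_neg huv.symm]; ring

lemma cnt_first (P : Params n d θ) (hS : n * d / 4 + 20 ≤ rsum d K)
    (hux : u ≠ x) (h1 : ¬ K.Adj u x) :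
    |cnt d (addE K u x) - res d K u * res d K x / rsum d K * cnt d K| ≤
      800 * θ ^ 2 * cnt d K :=
  cnt_addE_first_div P (by linarith) hux h1 (by linarith) (by norm_num)

lemma cnt_cherry (P : Params n d θ) (hS : n * d / 4 + 20 ≤ rsum d K) (hG : G ∈ fam d K)
    (huv : u ≠ v) (hux : u ≠ x) (hvx : v ≠ x) (h1 : ¬ K.Adj u x) (h2 : ¬ K.Adj v x) :
    |cnt d (addE (addE K u x) v x) - res d K u * res d K v * (res d K x * (res d K x - 1)) /
      rsum d K ^ 2 * cnt d K| ≤ 7200 * θ ^ 3 * cnt d K := by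
  have h3 := cnt_first P hS hux h1
  have h4 := cnt_addE_le P (by linarith) hux h1
  have h5 := cnt_chain P (K₂ := addE K u x) (c := v) (e := x) (S := rsum d K)
    (by rw [rsum_addE hux h1]; linarith) hvx
    (by rw [addE_adj hux]; simp [h2, hvx, huv.symm]) (by linarith)
    (by rw [rsum_addE hux h1]; norm_num)
    (by rw [res_addE_ne hux h1 huv.symm hvx, res_addE_right hux h1])
    (abs_res_mul_le (abs_res_le hG _) (abs_res_sub_one_le hG P.hd _)) h3 h4
  refine (le_of_eq ?_).trans (h5.trans (le_of_eq ?_))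
  · congr 2; ring
  · ring

lemma cnt_pair (P : Params n d θ) (hS : n * d / 4 + 20 ≤ rsum d K) (hG : G ∈ fam d K)
    (huv : u ≠ v) (hux : u ≠ x) (hvy : v ≠ y) (hvx : v ≠ x) (huy : u ≠ y) (hxy : x ≠ y)
    (h1 : ¬ K.Adj u x) (h2 : ¬ K.Adj v y) :
    |cnt d (addE (addE K u x) v y) - res d K u * res d K v * (res d K x * res d K y) /
      rsum d K ^ 2 * cnt d K| ≤ 7200 * θ ^ 3 * cnt d K := by
  have h3 := cnt_first P hS hux h1
  have h4 := cnt_addE_le P (by linarith) hux h1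
  have h5 := cnt_chain P (K₂ := addE K u x) (c := v) (e := y) (S := rsum d K)
    (by rw [rsum_addE hux h1]; linarith) hvy
    (by rw [addE_adj hux]; simp [h2, hvx, huv.symm]) (by linarith)
    (by rw [rsum_addE hux h1]; norm_num)
    (by rw [res_addE_ne hux h1 huv.symm hvx, res_addE_ne hux h1 huy.symm hxy.symm])
    (abs_res_mul_le (abs_res_le hG _) (abs_res_le hG _)) h3 h4
  refine (le_of_eq ?_).trans (h5.trans (le_of_eq ?_))
  · congr 2; ring
  · ring

lemma cnt_path (P : Params n d θ) (hS : n * d / 4 + 20 ≤ rsum d K) (hG : G ∈ fam d K)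
    (huv : u ≠ v) (hux : u ≠ x) (hvy : v ≠ y) (hvx : v ≠ x) (huy : u ≠ y) (hxy : x ≠ y)
    (h1 : ¬ K.Adj u x) (h2 : ¬ K.Adj v y) (h3 : ¬ K.Adj x y) :
    |cnt d (addE (addE (addE K u x) v y) x y) - res d K u * res d K v *
      (res d K x * (res d K x - 1)) * (res d K y * (res d K y - 1)) /
      rsum d K ^ 3 * cnt d K| ≤ 48800 * θ ^ 4 * cnt d K := by
  have h4 := cnt_pair P hS hG huv hux hvy hvx huy hxy h1 h2
  have h2' : ¬ (addE K u x).Adj v y := by rw [addE_adj hux]; simp [h2, hvx, huv.symm]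
  have h5 : cnt d (addE (addE K u x) v y) ≤ 25 * θ ^ 2 * cnt d K := by
    have h6 := cnt_addE_le P (by linarith) hux h1
    have h7 := cnt_addE_le P (by rw [rsum_addE hux h1]; linarith) hvy h2'
    have := mul_le_mul_of_nonneg_left h6 (by linarith [P.θ_pos] : 0 ≤ 5 * θ)
    nlinarith
  have h6 := cnt_chain P (K₂ := addE (addE K u x) v y) (c := x) (e := y) (S := rsum d K)
    (by rw [rsum_addE hvy h2', rsum_addE hux h1]; linarith) hxy
    (by rw [addE_adj hvy, addE_adj hux]; simp [h3, hvx.symm, hux.symm, hxy, huy.symm])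
    (by linarith)
    (by rw [rsum_addE hvy h2', rsum_addE hux h1]; ring_nf; norm_num)
    (by rw [res_addE_ne hvy h2' hvx.symm hxy, res_addE_right hvy h2', res_addE_right hux h1,
          res_addE_ne hux h1 huy.symm hxy.symm])
    (abs_res_mul_le (abs_res_sub_one_le hG P.hd _) (abs_res_sub_one_le hG P.hd _)) h4 h5
  refine (le_of_eq ?_).trans (h6.trans (le_of_eq ?_))
  · congr 2; ring
  · ring
end Chains

end

section

variable {n : ℕ} {d θ : ℝ} {K : SimpleGraph (Fin n)} {u v x y : Fin n} {G : SimpleGraph (Fin n)}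

lemma sum_bar_le (hG : G ∈ fam d K) (u : Fin n) : ∑ x, bar K u x ≤ d + 1 := by
  simp_rw [bar_eq, sum_add_distrib]
  simpa using sum_ind_res_le hG u

lemma bar_eq_one_or (K : SimpleGraph (Fin n)) (x y : Fin n) :
    bar K x y = 1 ∨ (x ≠ y ∧ ¬ K.Adj x y) := by
  by_cases h : x = y
  · left; simp [bar, h]
  · by_cases h' : K.Adj x y
    · left; simp [bar, ind_of_adj h']
    · right; exact ⟨h, h'⟩

lemma res_mul_pred_nonneg_le (hG : G ∈ fam d K) (hd : 3 ≤ d) (x : Fin n) :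
    |res d K x * (res d K x - 1)| ≤ d ^ 2 :=
  abs_res_mul_le (abs_res_le hG _) (abs_res_sub_one_le hG hd _)

lemma abs_le_density_sq (P : Params n d θ) {S ρ σ : ℝ} (hS : n * d / 4 ≤ S) (hρ : |ρ| ≤ d ^ 2)
    (hσ : |σ| ≤ d ^ 2) : |ρ * σ / S ^ 2| ≤ 16 * θ ^ 2 := by
  have h := mul_le_mul (div_le_density P hS hρ) (div_le_density P hS hσ) (abs_nonneg _)
    (by linarith [P.θ_pos])
  rw [← abs_mul] at h
  refine (le_of_eq ?_).trans (h.trans (le_of_eq ?_))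
  · congr 1; rw [div_mul_div_comm, sq]
  · ring

lemma abs_le_density_cube (P : Params n d θ) {S ρ σ τ : ℝ} (hS : n * d / 4 ≤ S)
    (hρ : |ρ| ≤ d ^ 2) (hσ : |σ| ≤ d ^ 2) (hτ : |τ| ≤ d ^ 2) :
    |ρ * σ * τ / S ^ 3| ≤ 64 * θ ^ 3 := by
  have h := mul_le_mul (abs_le_density_sq P hS hρ hσ) (div_le_density P hS hτ) (abs_nonneg _)
    (by have := P.θ_pos; positivity)
  rw [← abs_mul] at h
  refine (le_of_eq ?_).trans (h.trans (le_of_eq ?_))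
  · congr 1; rw [div_mul_div_comm]; ring
  · ring

/-- Comparison for exceptional configurations. -/
lemma abs_tot_sub_le_of_bounds {φ : SimpleGraph (Fin n) → ℝ} {q A B E : ℝ}
    (h0 : ∀ G ∈ fam d K, 0 ≤ φ G)
    (h1 : tot d K φ ≤ A * cnt d K) (hq : |q| ≤ B) (hE : A + B ≤ E) :
    |tot d K φ - q * cnt d K| ≤ E * cnt d K := by
  have hN := cnt_nonneg (d := d) (K := K)
  have h0' := tot_nonneg h0
  rw [abs_le] at hq ⊢
  have h2 := mul_le_mul_of_nonneg_right hE hN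
  constructor <;> nlinarith [mul_le_mul_of_nonneg_right hq.1 hN, mul_le_mul_of_nonneg_right hq.2 hN]

/-- Comparison for generic configurations. -/
lemma abs_tot_kill_sub_le (hK : ¬ K.Adj u v) {φ : SimpleGraph (Fin n) → ℝ} {q A B E : ℝ}
    (h0 : ∀ G ∈ fam d K, 0 ≤ φ G) (h1 : |tot d K φ - q * cnt d K| ≤ A * cnt d K)
    (h2 : tot d K (fun G => new K G u v * φ G) ≤ B * cnt d K) (hE : A + B ≤ E) :
    |tot d K (fun G => (1 - ind G u v) * φ G) - q * cnt d K| ≤ E * cnt d K := by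
  have hN := cnt_nonneg (d := d) (K := K)
  have h3 : tot d K (fun G => (1 - ind G u v) * φ G) =
      tot d K φ - tot d K (fun G => new K G u v * φ G) := by
    rw [← tot_sub]
    exact tot_congr fun G _ => by rw [new_of_not_adj G hK]; ring
  have h4 : 0 ≤ tot d K (fun G => new K G u v * φ G) :=
    tot_nonneg fun G hG => mul_nonneg (new_nonneg _ _ _ _) (h0 G hG)
  have h5 := mul_le_mul_of_nonneg_right hE hN
  rw [abs_le] at h1 ⊢
  constructor <;> nlinarith

lemma new_mul_nonneg (K G : SimpleGraph (Fin n)) (a b c e : Fin n) :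
    0 ≤ new K G a b * new K G c e := mul_nonneg (new_nonneg _ _ _ _) (new_nonneg _ _ _ _)

lemma kill_nonneg {r : ℝ} (hr : 0 ≤ r) (u v : Fin n) : 0 ≤ (1 - ind G u v) * r :=
  mul_nonneg (by linarith [ind_le_one G u v]) hr

lemma tot_two_new {a b c e : Fin n} (hab : a ≠ b) (h1 : ¬ K.Adj a b) (hce : c ≠ e)
    (h2 : ¬ K.Adj c e) (h : s(a, b) ≠ s(c, e)) (φ : SimpleGraph (Fin n) → ℝ) :
    tot d K (fun G => new K G a b * (new K G c e * φ G)) = tot d (addE (addE K a b) c e) φ := by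
  rw [tot_new_mul hab h1, ← tot_new_mul hce]
  · exact tot_congr fun G _ => by rw [new_addE G hab h1 h]
  · rw [addE_adj hab]
    rintro (h' | ⟨rfl, rfl⟩ | ⟨rfl, rfl⟩)
    · exact h2 h'
    · exact h rfl
    · exact h Sym2.eq_swap

lemma tot_cherry (P : Params n d θ) (hS : n * d / 4 + 20 ≤ rsum d K) (hG : G ∈ fam d K)
    (huv : u ≠ v) (hK : ¬ K.Adj u v) (x : Fin n) :
    |tot d K (fun G => (1 - ind G u v) * (new K G u x * new K G v x)) -
      res d K u * res d K v * (res d K x * (res d K x - 1)) / rsum d K ^ 2 * cnt d K| ≤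
      (7400 * θ ^ 3 + (bar K u x + bar K v x) * (41 * θ ^ 2)) * cnt d K := by
  have hθ := P.θ_pos
  have hθ2 : 0 < θ ^ 2 := by positivity
  have hθ3 : 0 < θ ^ 3 := by positivity
  have hb1 := bar_nonneg K u x; have hb2 := bar_nonneg K v x
  have hbad : 1 ≤ bar K u x + bar K v x →
      |tot d K (fun G => (1 - ind G u v) * (new K G u x * new K G v x)) -
      res d K u * res d K v * (res d K x * (res d K x - 1)) / rsum d K ^ 2 * cnt d K| ≤
      (7400 * θ ^ 3 + (bar K u x + bar K v x) * (41 * θ ^ 2)) * cnt d K := fun hw =>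
    abs_tot_sub_le_of_bounds (fun G _ => kill_nonneg (new_mul_nonneg _ _ _ _ _ _) _ _)
      (tot_kill_two_le P (by linarith) huv x x)
      (abs_le_density_sq P (by linarith) (abs_res_mul_le (abs_res_le hG u) (abs_res_le hG v))
        (res_mul_pred_nonneg_le hG P.hd x)) (by nlinarith)
  rcases bar_eq_one_or K u x with h2 | ⟨h2, h2'⟩
  · exact hbad (by linarith)
  rcases bar_eq_one_or K v x with h3 | ⟨h3, h3'⟩
  · exact hbad (by linarith)
  have h5 := tot_two_new (d := d) h2 h2' h3 h3' (by rw [Ne, Sym2.eq_iff]; grind) fun _ => 1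
  simp_rw [mul_one] at h5
  refine abs_tot_kill_sub_le hK (fun G _ => new_mul_nonneg _ _ _ _ _ _) ?_ ?_
    (?_ : 7200 * θ ^ 3 + 125 * θ ^ 3 ≤ _)
  · rw [h5]; exact cnt_cherry P hS hG huv h2 h3 h2' h3'
  · simp_rw [← mul_assoc]
    exact tot_three_new_le P (by linarith) (by rw [Ne, Sym2.eq_iff]; grind)
      (by rw [Ne, Sym2.eq_iff]; grind) (by rw [Ne, Sym2.eq_iff]; grind)
  · nlinarith

lemma tot_pair (P : Params n d θ) (hS : n * d / 4 + 20 ≤ rsum d K) (hG : G ∈ fam d K)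
    (huv : u ≠ v) (hK : ¬ K.Adj u v) (hxy : K.Adj x y) :
    |tot d K (fun G => (1 - ind G u v) * (new K G u x * new K G v y)) -
      res d K u * res d K v * (res d K x * res d K y) / rsum d K ^ 2 * cnt d K| ≤
      (7400 * θ ^ 3 + (bar K u x + bar K v y) * (41 * θ ^ 2)) * cnt d K := by
  have hθ := P.θ_pos
  have hθ2 : 0 < θ ^ 2 := by positivity
  have hθ3 : 0 < θ ^ 3 := by positivity
  have hb1 := bar_nonneg K u x; have hb2 := bar_nonneg K v y
  have hbad : 1 ≤ bar K u x + bar K v y →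
      |tot d K (fun G => (1 - ind G u v) * (new K G u x * new K G v y)) -
      res d K u * res d K v * (res d K x * res d K y) / rsum d K ^ 2 * cnt d K| ≤
      (7400 * θ ^ 3 + (bar K u x + bar K v y) * (41 * θ ^ 2)) * cnt d K := fun hw =>
    abs_tot_sub_le_of_bounds (fun G _ => kill_nonneg (new_mul_nonneg _ _ _ _ _ _) _ _)
      (tot_kill_two_le P (by linarith) huv x y)
      (abs_le_density_sq P (by linarith) (abs_res_mul_le (abs_res_le hG u) (abs_res_le hG v))
        (abs_res_mul_le (abs_res_le hG x) (abs_res_le hG y))) (by nlinarith)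
  rcases bar_eq_one_or K u x with h2 | ⟨h2, h2'⟩
  · exact hbad (by linarith)
  rcases bar_eq_one_or K v y with h3 | ⟨h3, h3'⟩
  · exact hbad (by linarith)
  have hne := hxy.ne
  have hvx : v ≠ x := by rintro rfl; exact h3' hxy
  have huy : u ≠ y := by rintro rfl; exact h2' hxy.symm
  have h5 := tot_two_new (d := d) h2 h2' h3 h3' (by rw [Ne, Sym2.eq_iff]; grind) fun _ => 1
  simp_rw [mul_one] at h5
  refine abs_tot_kill_sub_le hK (fun G _ => new_mul_nonneg _ _ _ _ _ _) ?_ ?_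
    (?_ : 7200 * θ ^ 3 + 125 * θ ^ 3 ≤ _)
  · rw [h5]; exact cnt_pair P hS hG huv h2 h3 hvx huy hne h2' h3'
  · simp_rw [← mul_assoc]
    exact tot_three_new_le P (by linarith) (by rw [Ne, Sym2.eq_iff]; grind)
      (by rw [Ne, Sym2.eq_iff]; grind) (by rw [Ne, Sym2.eq_iff]; grind)
  · nlinarith

lemma tot_path (P : Params n d θ) (hS : n * d / 4 + 20 ≤ rsum d K) (hG : G ∈ fam d K)
    (huv : u ≠ v) (hK : ¬ K.Adj u v) (x y : Fin n) :
    |tot d K (fun G => (1 - ind G u v) * (new K G u x * new K G v y * new K G x y)) -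
      res d K u * res d K v * (res d K x * (res d K x - 1)) * (res d K y * (res d K y - 1)) /
        rsum d K ^ 3 * cnt d K| ≤
      (49500 * θ ^ 4 + (bar K u x + bar K v y + bar K x y + (if x = v then 1 else 0) +
        (if y = u then 1 else 0)) * (189 * θ ^ 3)) * cnt d K := by
  have hθ := P.θ_pos
  have hθ2 : 0 < θ ^ 3 := by positivity
  have hθ3 : 0 < θ ^ 4 := by positivity
  have hb1 := bar_nonneg K u x; have hb2 := bar_nonneg K v y; have hb3 := bar_nonneg K x y
  set w := bar K u x + bar K v y + bar K x y + (if x = v then 1 else 0) +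
        (if y = u then 1 else 0) with hw
  have h01 : (0 : ℝ) ≤ if x = v then 1 else 0 := by positivity
  have h02 : (0 : ℝ) ≤ if y = u then 1 else 0 := by positivity
  have hbad : 1 ≤ w →
      |tot d K (fun G => (1 - ind G u v) * (new K G u x * new K G v y * new K G x y)) -
      res d K u * res d K v * (res d K x * (res d K x - 1)) * (res d K y * (res d K y - 1)) /
        rsum d K ^ 3 * cnt d K| ≤
      (49500 * θ ^ 4 + w * (189 * θ ^ 3)) * cnt d K := fun hw =>
    abs_tot_sub_le_of_bounds
      (fun G _ => kill_nonneg (mul_nonneg (new_mul_nonneg _ _ _ _ _ _) (new_nonneg _ _ _ _)) _ _)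
      (tot_kill_three_le P (by linarith) huv x y)
      (abs_le_density_cube P (by linarith) (abs_res_mul_le (abs_res_le hG u) (abs_res_le hG v))
        (res_mul_pred_nonneg_le hG P.hd x) (res_mul_pred_nonneg_le hG P.hd y)) (by nlinarith)
  by_cases hvx : v = x
  · exact hbad (by rw [if_pos hvx.symm] at hw; linarith)
  by_cases huy : u = y
  · exact hbad (by rw [if_pos huy.symm] at hw; linarith)
  rcases bar_eq_one_or K u x with h2 | ⟨h2, h2'⟩
  · exact hbad (by linarith)
  rcases bar_eq_one_or K v y with h3 | ⟨h3, h3'⟩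
  · exact hbad (by linarith)
  rcases bar_eq_one_or K x y with h4 | ⟨h4, h4'⟩
  · exact hbad (by linarith)
  have h5 := tot_two_new (d := d) h2 h2' h3 h3' (by rw [Ne, Sym2.eq_iff]; grind)
    fun G => new K G x y
  have h6 : tot d K (fun G => new K G u x * new K G v y * new K G x y) =
      cnt d (addE (addE (addE K u x) v y) x y) := by
    simp_rw [mul_assoc]
    have h7 : ¬ (addE K u x).Adj v y := by rw [addE_adj h2]; grind
    rw [h5, ← tot_new h4]
    · refine tot_congr fun G _ => ?_
      rw [new_addE G h3 h7 (by rw [Ne, Sym2.eq_iff]; grind),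
        new_addE G h2 h2' (by rw [Ne, Sym2.eq_iff]; grind)]
    · rw [addE_adj h3, addE_adj h2]; grind
  refine abs_tot_kill_sub_le hK
    (fun G _ => mul_nonneg (new_mul_nonneg _ _ _ _ _ _) (new_nonneg _ _ _ _)) ?_ ?_
    (?_ : 48800 * θ ^ 4 + 625 * θ ^ 4 ≤ _)
  · rw [h6]; exact cnt_path P hS hG huv h2 h3 hvx huy h4 h2' h3' h4'
  · simp_rw [← mul_assoc]
    apply tot_four_new_le P (by linarith) <;> (rw [Ne, Sym2.eq_iff]; grind)
  · have : 0 ≤ w := by positivity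
    nlinarith

end

section

variable {n : ℕ} {d θ : ℝ} {K : SimpleGraph (Fin n)} {u v x y : Fin n} {G : SimpleGraph (Fin n)}

/-- Sum of `r (r - 1)` over the residual degrees. -/
noncomputable def s2 (d : ℝ) (K : SimpleGraph (Fin n)) : ℝ := ∑ x, res d K x * (res d K x - 1)

/-- Sum of the products of residual degrees over adjacent pairs. -/
noncomputable def tK (d : ℝ) (K : SimpleGraph (Fin n)) : ℝ :=
  ∑ x, ∑ y, ind K x y * (res d K x * res d K y)

lemma abs_sum_sub_sum_le {ι : Type*} (s : Finset ι) (f g h : ι → ℝ)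
    (H : ∀ i ∈ s, |f i - g i| ≤ h i) : |∑ i ∈ s, f i - ∑ i ∈ s, g i| ≤ ∑ i ∈ s, h i := by
  rw [← sum_sub_distrib]
  exact (abs_sum_le_sum_abs _ _).trans (sum_le_sum H)

lemma sum_tot_cherry (P : Params n d θ) (hS : n * d / 4 + 20 ≤ rsum d K) (hG : G ∈ fam d K)
    (huv : u ≠ v) (hK : ¬ K.Adj u v) :
    |∑ x, tot d K (fun G => (1 - ind G u v) * (new K G u x * new K G v x)) -
      res d K u * res d K v * (s2 d K / rsum d K ^ 2) * cnt d K| ≤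
      2510 * d ^ 2 * θ ^ 2 * cnt d K := by
  have h := abs_sum_sub_sum_le univ _ _ _ fun x _ => tot_cherry P hS hG huv hK x
  have e : ∑ x, res d K u * res d K v * (res d K x * (res d K x - 1)) / rsum d K ^ 2 * cnt d K =
      res d K u * res d K v * (s2 d K / rsum d K ^ 2) * cnt d K := by
    rw [← sum_mul, ← sum_div, ← mul_sum, s2]; ring
  rw [e, ← sum_mul] at h
  refine h.trans (mul_le_mul_of_nonneg_right ?_ cnt_nonneg)
  rw [sum_add_distrib, ← sum_mul univ (fun x => bar K u x + bar K v x),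
    sum_add_distrib (f := fun x => bar K u x)]
  simp only [sum_const, card_univ, Fintype.card_fin, nsmul_eq_mul]
  have h1 := sum_bar_le hG u; have h2 := sum_bar_le hG v
  have hθ := P.hθ; have hd := P.hd
  have h3 : 0 ≤ θ ^ 2 := sq_nonneg θ
  have h4 : n * (7400 * θ ^ 3) = 7400 * d * θ ^ 2 := by linear_combination (7400 * θ ^ 2) * hθ
  have h5 : (∑ i, bar K u i + ∑ i, bar K v i) * (41 * θ ^ 2) ≤ (2 * (d + 1)) * (41 * θ ^ 2) :=
    mul_le_mul_of_nonneg_right (by linarith) (by positivity)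
  have h6 : (7400 * d + 82 * (d + 1)) * θ ^ 2 ≤ 2510 * d ^ 2 * θ ^ 2 :=
    mul_le_mul_of_nonneg_right (by nlinarith) h3
  linarith

lemma sum_ind_mul_le (hG : G ∈ fam d K) {w : Fin n → ℝ} (hw : ∀ x, 0 ≤ w x) :
    ∑ x, ∑ y, ind K x y * w x ≤ d * ∑ x, w x := by
  rw [mul_sum]
  refine sum_le_sum fun x _ => ?_
  rw [← sum_mul]
  exact mul_le_mul_of_nonneg_right (sum_ind_res_le hG x) (hw x)

lemma sum_ind_mul_le' (hG : G ∈ fam d K) {w : Fin n → ℝ} (hw : ∀ x, 0 ≤ w x) :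
    ∑ x, ∑ y, ind K x y * w y ≤ d * ∑ x, w x := by
  rw [sum_comm]
  simp_rw [ind_comm K _ _]
  refine le_trans (le_of_eq ?_) (sum_ind_mul_le hG hw)
  exact sum_congr rfl fun x _ => sum_congr rfl fun y _ => by rw [ind_comm]

lemma sum_tot_pair (P : Params n d θ) (hS : n * d / 4 + 20 ≤ rsum d K) (hG : G ∈ fam d K)
    (huv : u ≠ v) (hK : ¬ K.Adj u v) :
    |∑ x, ∑ y, ind K x y * tot d K (fun G => (1 - ind G u v) * (new K G u x * new K G v y)) -
      res d K u * res d K v * (tK d K / rsum d K ^ 2) * cnt d K| ≤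
      7510 * d ^ 2 * θ ^ 2 * cnt d K := by
  have h := abs_sum_sub_sum_le univ _ _ _ fun x _ => abs_sum_sub_sum_le univ
    (fun y => ind K x y * tot d K (fun G => (1 - ind G u v) * (new K G u x * new K G v y)))
    (fun y => ind K x y * (res d K u * res d K v * (res d K x * res d K y) / rsum d K ^ 2 *
      cnt d K))
    (fun y => ind K x y * ((7400 * θ ^ 3 + (bar K u x + bar K v y) * (41 * θ ^ 2)) * cnt d K))
    fun y _ => by
      by_cases hxy : K.Adj x y
      · rw [ind_of_adj hxy]; simpa using tot_pair P hS hG huv hK hxy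
      · simp [ind_of_not_adj hxy]
  have e : ∑ x, ∑ y, ind K x y * (res d K u * res d K v * (res d K x * res d K y) /
      rsum d K ^ 2 * cnt d K) =
      res d K u * res d K v * (tK d K / rsum d K ^ 2) * cnt d K := by
    have : ∀ x y, ind K x y * (res d K u * res d K v * (res d K x * res d K y) /
      rsum d K ^ 2 * cnt d K) = res d K u * res d K v / rsum d K ^ 2 * cnt d K *
      (ind K x y * (res d K x * res d K y)) := fun x y => by ring
    simp_rw [this, ← mul_sum]
    rw [tK]; ring
  rw [e] at h
  refine h.trans ?_
  have e2 : ∑ x, ∑ y, ind K x y * ((7400 * θ ^ 3 + (bar K u x + bar K v y) * (41 * θ ^ 2)) *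
      cnt d K) = (7400 * θ ^ 3 * (∑ x, ∑ y, ind K x y) + 41 * θ ^ 2 *
      (∑ x, ∑ y, ind K x y * bar K u x + ∑ x, ∑ y, ind K x y * bar K v y)) * cnt d K := by
    simp only [mul_sum, sum_mul, ← sum_add_distrib]
    exact sum_congr rfl fun x _ => sum_congr rfl fun y _ => by ring
  rw [e2]
  refine mul_le_mul_of_nonneg_right ?_ cnt_nonneg
  have h1 := sum_bar_le hG u; have h2 := sum_bar_le hG v
  have hθ := P.hθ; have hd := P.hd
  have hθ0 := P.θ_pos
  have h3 := sum_ind_mul_le hG (w := fun x => bar K u x) (fun x => bar_nonneg _ _ _)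
  have h4 := sum_ind_mul_le' hG (w := fun x => bar K v x) (fun x => bar_nonneg _ _ _)
  have h5 := mul_le_mul_of_nonneg_left (sum_sum_ind_le hG) (by positivity : 0 ≤ 7400 * θ ^ 3)
  have h6 : ∑ x, ∑ y, ind K x y * bar K u x + ∑ x, ∑ y, ind K x y * bar K v y ≤
    2 * d * (d + 1) := by nlinarith
  have h7 := mul_le_mul_of_nonneg_left h6 (by positivity : 0 ≤ 41 * θ ^ 2)
  have h8 : 7400 * θ ^ 3 * (n * d) = 7400 * d ^ 2 * θ ^ 2 := by
    linear_combination (7400 * θ ^ 2 * d) * hθ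
  have h9 : (7400 * d ^ 2 + 82 * d * (d + 1)) * θ ^ 2 ≤ 7510 * d ^ 2 * θ ^ 2 :=
    mul_le_mul_of_nonneg_right (by nlinarith) (by positivity)
  linarith

lemma sum_tot_path (P : Params n d θ) (hS : n * d / 4 + 20 ≤ rsum d K) (hG : G ∈ fam d K)
    (huv : u ≠ v) (hK : ¬ K.Adj u v) :
    |∑ x, ∑ y, tot d K (fun G => (1 - ind G u v) * (new K G u x * new K G v y * new K G x y)) -
      res d K u * res d K v * (s2 d K ^ 2 / rsum d K ^ 3) * cnt d K| ≤
      50500 * d ^ 2 * θ ^ 2 * cnt d K := by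
  have h := abs_sum_sub_sum_le univ _ _ _ fun x _ => abs_sum_sub_sum_le univ _ _ _ fun y _ =>
    tot_path P hS hG huv hK x y
  have e : ∑ x, ∑ y, res d K u * res d K v * (res d K x * (res d K x - 1)) *
      (res d K y * (res d K y - 1)) / rsum d K ^ 3 * cnt d K =
      res d K u * res d K v * (s2 d K ^ 2 / rsum d K ^ 3) * cnt d K := by
    rw [s2, sq, sum_mul_sum]
    simp only [mul_sum, sum_mul, sum_div]
    exact sum_congr rfl fun x _ => sum_congr rfl fun y _ => by ring
  rw [e] at h
  refine h.trans ?_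
  simp_rw [← sum_mul]
  refine mul_le_mul_of_nonneg_right ?_ cnt_nonneg
  simp_rw [sum_add_distrib, ← sum_mul, sum_add_distrib]
  simp only [sum_const, card_univ, Fintype.card_fin, nsmul_eq_mul, sum_ite_eq', mem_univ, if_true,
    ← mul_sum, mul_one]
  have h1 := sum_bar_le hG u; have h2 := sum_bar_le hG v
  have h3 : ∑ x, ∑ y, bar K x y ≤ n * (d + 1) := by
    refine (sum_le_sum fun x _ => sum_bar_le hG x).trans (le_of_eq ?_)
    simp only [sum_const, card_univ, Fintype.card_fin, nsmul_eq_mul]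
  have hθ := P.hθ; have hd := P.hd
  have hθ0 := P.θ_pos; have hn := P.n_pos
  have h1' := mul_le_mul_of_nonneg_left h1 hn.le
  have h2' := mul_le_mul_of_nonneg_left h2 hn.le
  have h4 : n * (n * (49500 * θ ^ 4)) = 49500 * d ^ 2 * θ ^ 2 := by
    linear_combination (49500 * θ ^ 2) * (n * θ + d) * hθ
  have h5 : n * (3 * (d + 1) + 2) * (189 * θ ^ 3) = (3 * (d + 1) + 2) * d * 189 * θ ^ 2 := by
    linear_combination (3 * (d + 1) + 2) * 189 * θ ^ 2 * hθ
  have h6 : (49500 * d ^ 2 + (3 * (d + 1) + 2) * d * 189) * θ ^ 2 ≤ 50500 * d ^ 2 * θ ^ 2 :=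
    mul_le_mul_of_nonneg_right (by nlinarith) (by positivity)
  have h7 : (n * ∑ i, bar K u i + n * ∑ i, bar K v i + ∑ x, ∑ y, bar K x y + n + n) *
      (189 * θ ^ 3) ≤ n * (3 * (d + 1) + 2) * (189 * θ ^ 3) :=
    mul_le_mul_of_nonneg_right (by nlinarith) (by positivity)
  linarith

/-- Second order estimate for the number of backward switchings. -/
lemma tot_backward_second (P : Params n d θ) (hS : n * d / 4 + 20 ≤ rsum d K) (hG : G ∈ fam d K)
    (huv : u ≠ v) (hK : ¬ K.Adj u v) :
    |tot d K (fun G => ∑ x, ∑ y, (1 - ind G u v) * new K G u x * new K G v y *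
      (1 - bar G x y)) - res d K u * res d K v * (cnt d K - cnt d (addE K u v) -
        (s2 d K / rsum d K ^ 2 + tK d K / rsum d K ^ 2 + s2 d K ^ 2 / rsum d K ^ 3) * cnt d K)| ≤
      60520 * d ^ 2 * θ ^ 2 * cnt d K := by
  have h1 := sum_tot_cherry P hS hG huv hK
  have h2 := sum_tot_pair P hS hG huv hK
  have h3 := sum_tot_path P hS hG huv hK
  rw [tot_backward_eq huv]
  rw [abs_le] at *
  constructor <;> linarith

end

section

variable {n : ℕ} {d θ : ℝ} {K : SimpleGraph (Fin n)} {u v x y : Fin n} {G : SimpleGraph (Fin n)}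

/-- Sum of the residual degrees of the neighbours. -/
noncomputable def nbr (d : ℝ) (K : SimpleGraph (Fin n)) (u : Fin n) : ℝ :=
  ∑ x, ind K u x * res d K x

/-- Sum of the squared residual degrees. -/
noncomputable def q2 (d : ℝ) (K : SimpleGraph (Fin n)) : ℝ := ∑ x, res d K x ^ 2

lemma bar_eq_add_new (hG : G ∈ fam d K) (x y : Fin n) : bar G x y = bar K x y + new K G x y := by
  rw [bar_eq, bar_eq, ind_eq_add_new hG]; ring

lemma new_mul_bar (x y : Fin n) :
    new K G x y * bar G x y = new K G x y := by
  by_cases h : x = y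
  · simp [h]
  by_cases h' : G.Adj x y
  · simp [bar, h, ind_of_adj h']
  · simp [bar, h, new, ind_of_not_adj h']

/-- Expansion of the forward switchings. -/
lemma sum_forward_eq (hG : G ∈ fam d K) (huv : K.Adj u v) :
    ∑ x, ∑ y, new K G x y * (1 - bar G u x) * (1 - bar G v y) =
      rsum d K - nbr d K u - nbr d K v - ∑ x, res d K x * new K G u x
      - ∑ y, res d K y * new K G v y
      + ∑ x, ∑ y, (if x = v ∨ y = u then 0 else bar G u x * bar G v y * new K G x y) := by
  have hG' := (mem_fam.1 hG).1
  have h1 : ∀ x y, new K G x y * (1 - bar G u x) * (1 - bar G v y) =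
      new K G x y - bar G u x * new K G x y - bar G v y * new K G x y
      + (if x = v then new K G x y else 0) + (if y = u then new K G x y else 0)
      + (if x = v ∨ y = u then 0 else bar G u x * bar G v y * new K G x y) := fun x y => by
    by_cases hx : x = v
    · subst hx
      by_cases hy : y = u
      · subst hy; simp [new_of_adj G huv.symm]
      · have h2 := new_mul_bar (K := K) (G := G) x y
        have h3 : bar G u x = 1 := by simp [bar, huv.ne, ind_of_adj (hG' huv)]
        simp [hy, h3]; linarith
    · by_cases hy : y = u
      · subst hy
        have h2 := new_mul_bar (K := K) (G := G) y x
        have h3 : bar G v y = 1 := by simp [bar, huv.ne.symm, ind_of_adj (hG' huv.symm)]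
        rw [new_comm] at h2
        simp [hx, h3]; linarith
      · simp only [hx, hy, or_self, if_false]; ring
  simp_rw [h1, sum_add_distrib, sum_sub_distrib]
  rw [sum_new' hG, sum_comm (f := fun x y => bar G v y * new K G x y)]
  simp_rw [← mul_sum, sum_new hG, sum_new_left hG]
  have h2 : ∀ w, ∑ x, bar G w x * res d K x = res d K w + nbr d K w +
      ∑ x, res d K x * new K G w x := fun w => by
    have : ∀ x, bar G w x * res d K x = (if x = w then res d K x else 0) +
        ind K w x * res d K x + res d K x * new K G w x := fun x => by
      rw [bar_eq_add_new hG, bar_eq]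
      by_cases h : x = w
      · subst h; simp
      · simp [h, Ne.symm h]; ring
    simp_rw [this, sum_add_distrib]
    simp [nbr]
  rw [h2, h2]
  have h3 : ∑ x, ∑ y, (if x = v then new K G x y else 0) = res d K v := by
    rw [sum_comm]; simp [sum_new hG]
  have h4 : ∑ x, ∑ y, (if y = u then new K G x y else 0) = res d K u := by
    simp [sum_new_left hG]
  rw [h3, h4]; ring

lemma tot_rest_le (P : Params n d θ) (hS : n * d / 4 + 20 ≤ rsum d K) (hG : G ∈ fam d K)
    (huv : u ≠ v) :
    tot d K (fun G => ∑ x, ∑ y, (if x = v ∨ y = u then 0 else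
      bar G u x * bar G v y * new K G x y)) ≤ 210 * d ^ 2 * θ * cnt d K := by
  have hN := cnt_nonneg (d := d) (K := K)
  have hθ0 := P.θ_pos
  have h1 : ∀ x y, tot d K (fun G => if x = v ∨ y = u then 0 else
      bar G u x * bar G v y * new K G x y) ≤
      (bar K u x * bar K v y * (5 * θ) + (bar K u x + bar K v y) * (25 * θ ^ 2) +
        125 * θ ^ 3) * cnt d K := fun x y => by
    have b1 := bar_nonneg K u x; have b2 := bar_nonneg K v y
    by_cases h : x = v ∨ y = u
    · simp only [h, if_true, tot_zero]
      positivity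
    simp only [h, if_false]
    push Not at h
    obtain ⟨hx, hy⟩ := h
    have d1 : s(u, x) ≠ s(v, y) := by rw [Ne, Sym2.eq_iff]; grind
    have e : tot d K (fun G => bar G u x * bar G v y * new K G x y) =
        bar K u x * bar K v y * tot d K (fun G => new K G x y) +
        bar K u x * tot d K (fun G => new K G v y * new K G x y) +
        bar K v y * tot d K (fun G => new K G u x * new K G x y) +
        tot d K (fun G => new K G u x * new K G v y * new K G x y) := by
      simp_rw [← tot_mul_left, ← tot_add]
      refine tot_congr fun G hG => ?_
      rw [bar_eq_add_new hG, bar_eq_add_new hG]; ring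
    rw [e]
    by_cases hxy : x = y
    · subst hxy
      simp only [new_self, mul_zero, tot_zero, add_zero]
      positivity
    have d2 : s(v, y) ≠ s(x, y) := by rw [Ne, Sym2.eq_iff]; grind
    have d3 : s(u, x) ≠ s(x, y) := by rw [Ne, Sym2.eq_iff]; grind
    have t1 := mul_le_mul_of_nonneg_left (tot_new_le P (by linarith) x y (K := K))
      (mul_nonneg b1 b2)
    have t2 := mul_le_mul_of_nonneg_left (tot_two_new_le P (by linarith) d2 (K := K)) b1
    have t3 := mul_le_mul_of_nonneg_left (tot_two_new_le P (by linarith) d3 (K := K)) b2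
    have t4 := tot_three_new_le P (by linarith) d1 d3 d2 (K := K)
    linarith
  simp_rw [tot_sum]
  refine (sum_le_sum fun x _ => sum_le_sum fun y _ => h1 x y).trans ?_
  simp_rw [← sum_mul, sum_add_distrib, ← sum_mul, sum_add_distrib]
  refine mul_le_mul_of_nonneg_right ?_ hN
  rw [← sum_mul_sum]
  simp only [sum_const, card_univ, Fintype.card_fin, nsmul_eq_mul, ← mul_sum]
  have h1 := sum_bar_le hG u; have h2 := sum_bar_le hG v
  have h1' : 0 ≤ ∑ x, bar K u x := sum_nonneg fun x _ => bar_nonneg _ _ _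
  have hθ := P.hθ; have hd := P.hd
  have hn := P.n_pos
  have t1 := mul_le_mul h1 h2 (sum_nonneg fun x _ => bar_nonneg _ _ _) (by linarith)
  have t1' := mul_le_mul_of_nonneg_right t1 (by positivity : 0 ≤ 5 * θ)
  have t2 : (n * ∑ x, bar K u x + n * ∑ x, bar K v x) * (25 * θ ^ 2) ≤
      (n * (2 * (d + 1))) * (25 * θ ^ 2) :=
    mul_le_mul_of_nonneg_right (by nlinarith) (by positivity)
  have t3 : (n * (2 * (d + 1))) * (25 * θ ^ 2) = 50 * d * (d + 1) * θ := by
    linear_combination (50 * (d + 1) * θ) * hθ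
  have t4 : n * (n * (125 * θ ^ 3)) = 125 * d ^ 2 * θ := by
    linear_combination (125 * θ) * (n * θ + d) * hθ
  have t5 : (5 * ((d + 1) * (d + 1)) + 50 * d * (d + 1) + 125 * d ^ 2) * θ ≤ 210 * d ^ 2 * θ :=
    mul_le_mul_of_nonneg_right (by nlinarith) hθ0.le
  linarith

lemma sum_res_tot_new (P : Params n d θ) (hS : n * d / 4 + 20 ≤ rsum d K) (hG : G ∈ fam d K)
    (u : Fin n) :
    |∑ x, res d K x * tot d K (fun G => new K G u x) -
      res d K u * q2 d K / rsum d K * cnt d K| ≤ 806 * d ^ 2 * θ * cnt d K := by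
  have hN := cnt_nonneg (d := d) (K := K)
  have hθ0 := P.θ_pos
  have h1 : ∀ x, |tot d K (fun G => new K G u x) - res d K u * res d K x / rsum d K * cnt d K| ≤
      (800 * θ ^ 2 + bar K u x * (4 * θ)) * cnt d K := fun x => by
    have hq := div_le_density P (S := rsum d K) (by linarith)
      (abs_res_mul_le (abs_res_le hG u) (abs_res_le hG x))
    by_cases hux : u = x
    · subst hux
      simp only [new_self, tot_zero, bar_self, zero_sub, abs_neg, abs_mul, abs_of_nonneg hN]
      refine mul_le_mul_of_nonneg_right ?_ hN
      nlinarith [sq_nonneg θ]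
    by_cases hK : K.Adj u x
    · simp only [new_of_adj _ hK, tot_zero, bar, hux, if_false, ind_of_adj hK, zero_sub, abs_neg,
        abs_mul, abs_of_nonneg hN]
      refine mul_le_mul_of_nonneg_right ?_ hN
      nlinarith [sq_nonneg θ]
    · rw [tot_new hux hK]
      simpa [bar, hux, ind_of_not_adj hK] using cnt_first P hS hux hK
  have h2 := abs_sum_sub_sum_le univ (fun x => res d K x * tot d K (fun G => new K G u x))
    (fun x => res d K x * (res d K u * res d K x / rsum d K * cnt d K))
    (fun x => d * ((800 * θ ^ 2 + bar K u x * (4 * θ)) * cnt d K)) fun x _ => by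
      rw [← mul_sub, abs_mul]
      exact mul_le_mul (abs_res_le hG x) (h1 x) (abs_nonneg _) (by linarith [P.hd])
  have e : ∑ x, res d K x * (res d K u * res d K x / rsum d K * cnt d K) =
      res d K u * q2 d K / rsum d K * cnt d K := by
    rw [q2, mul_sum, sum_div, sum_mul]
    exact sum_congr rfl fun x _ => by ring
  rw [e] at h2
  refine h2.trans ?_
  rw [← mul_sum, ← sum_mul, ← mul_assoc]
  refine mul_le_mul_of_nonneg_right ?_ hN
  rw [sum_add_distrib, ← sum_mul univ (fun x => bar K u x)]
  simp only [sum_const, card_univ, Fintype.card_fin, nsmul_eq_mul]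
  have h1 := sum_bar_le hG u
  have hθ := P.hθ; have hd := P.hd
  have t1 : (∑ x, bar K u x) * (4 * θ) ≤ (d + 1) * (4 * θ) :=
    mul_le_mul_of_nonneg_right h1 (by positivity)
  have t2 := mul_le_mul_of_nonneg_left t1 (by linarith : 0 ≤ d)
  have t3 : d * (n * (800 * θ ^ 2)) = 800 * d ^ 2 * θ := by
    linear_combination (800 * d * θ) * hθ
  have t4 : (800 * d ^ 2 + d * (d + 1) * 4) * θ ≤ 806 * d ^ 2 * θ :=
    mul_le_mul_of_nonneg_right (by nlinarith) hθ0.le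
  rw [mul_add]
  linarith

/-- Second order estimate for the number of forward switchings. -/
lemma tot_forward_second (P : Params n d θ) (hS : n * d / 4 + 20 ≤ rsum d K) (hG : G ∈ fam d K)
    (huv : K.Adj u v) :
    |tot d K (fun G => ∑ x, ∑ y, new K G x y * (1 - bar G u x) * (1 - bar G v y)) -
      (rsum d K - nbr d K u - nbr d K v - (res d K u + res d K v) * q2 d K / rsum d K) *
        cnt d K| ≤ 1830 * d ^ 2 * θ * cnt d K := by
  have e : tot d K (fun G => ∑ x, ∑ y, new K G x y * (1 - bar G u x) * (1 - bar G v y)) =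
      (rsum d K - nbr d K u - nbr d K v) * cnt d K
      - ∑ x, res d K x * tot d K (fun G => new K G u x)
      - ∑ x, res d K x * tot d K (fun G => new K G v x)
      + tot d K (fun G => ∑ x, ∑ y, (if x = v ∨ y = u then 0 else
          bar G u x * bar G v y * new K G x y)) := by
    simp_rw [← tot_const, ← tot_mul_left, ← tot_sum, ← tot_sub, ← tot_add]
    exact tot_congr fun G hG => sum_forward_eq hG huv
  have h1 := sum_res_tot_new P hS hG u
  have h2 := sum_res_tot_new P hS hG v
  have h3 := tot_rest_le P hS hG huv.ne
  have h4 : 0 ≤ tot d K (fun G => ∑ x, ∑ y, (if x = v ∨ y = u then 0 else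
          bar G u x * bar G v y * new K G x y)) := by
    refine tot_nonneg fun G _ => sum_nonneg fun x _ => sum_nonneg fun y _ => ?_
    split_ifs
    · exact le_rfl
    · exact mul_nonneg (mul_nonneg (bar_nonneg _ _ _) (bar_nonneg _ _ _)) (new_nonneg _ _ _ _)
  have hN := mul_nonneg (mul_nonneg (sq_nonneg d) P.θ_pos.le) (cnt_nonneg (d := d) (K := K))
  rw [e]
  have e2 : (res d K u + res d K v) * q2 d K / rsum d K =
    res d K u * q2 d K / rsum d K + res d K v * q2 d K / rsum d K := by ring
  rw [e2]
  rw [abs_le] at *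
  constructor <;> linarith

/-- Second order relation between the counts with and without an additional edge. -/
lemma cnt_addE_second (P : Params n d θ) (hS : n * d / 4 + 30 ≤ rsum d K) (hG : G ∈ fam d K)
    (huv : u ≠ v) (hK : ¬ K.Adj u v) :
    |cnt d (addE K u v) * (rsum d (addE K u v) - nbr d (addE K u v) u - nbr d (addE K u v) v
        - (res d (addE K u v) u + res d (addE K u v) v) * q2 d (addE K u v) / rsum d (addE K u v)
        + res d K u * res d K v)
      - res d K u * res d K v * (1 -
        (s2 d K / rsum d K ^ 2 + tK d K / rsum d K ^ 2 + s2 d K ^ 2 / rsum d K ^ 3)) * cnt d K| ≤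
      70000 * d ^ 2 * θ ^ 2 * cnt d K := by
  have h1 := tot_backward_second P (by linarith) hG huv hK
  rw [← switch_sum' huv hK] at h1
  have hθ := P.θ_pos
  have hN := cnt_nonneg (d := d) (K := K)
  have hN1 := mul_le_mul_of_nonneg_left (cnt_addE_le P (by linarith) huv hK)
    (by positivity : 0 ≤ 1830 * d ^ 2 * θ)
  have h2 : |tot d (addE K u v) (fun G => ∑ x, ∑ y, new (addE K u v) G x y * (1 - bar G u x) *
      (1 - bar G v y)) - (rsum d (addE K u v) - nbr d (addE K u v) u - nbr d (addE K u v) v -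
        (res d (addE K u v) u + res d (addE K u v) v) * q2 d (addE K u v) /
        rsum d (addE K u v)) * cnt d (addE K u v)| ≤ 1830 * d ^ 2 * θ * cnt d (addE K u v) := by
    by_cases h0 : cnt d (addE K u v) = 0
    · simp [h0, tot_eq_zero_of_cnt h0]
    obtain ⟨G', hG'⟩ := exists_mem_of_cnt_ne h0
    exact tot_forward_second P (by rw [rsum_addE huv hK]; linarith) hG'
      ((addE_adj huv).2 (Or.inr (Or.inl ⟨rfl, rfl⟩)))
  have h3 : 0 ≤ d ^ 2 * θ ^ 2 * cnt d K := by positivity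
  rw [abs_le] at *
  constructor <;> linarith

end

section

variable {n : ℕ} {d θ : ℝ} {K : SimpleGraph (Fin n)} {u v x y : Fin n} {G : SimpleGraph (Fin n)}

/-- The exponent in the second order estimate of the number of regular extensions. -/
noncomputable def expo (d : ℝ) (K : SimpleGraph (Fin n)) : ℝ :=
  s2 d K / (2 * rsum d K) + (s2 d K / (2 * rsum d K)) ^ 2 + tK d K / (2 * rsum d K)

lemma sum_res_mul_addE (huv : u ≠ v) (hK : ¬ K.Adj u v) (φ : Fin n → ℝ) :
    ∑ x, φ x * res d (addE K u v) x = ∑ x, φ x * res d K x - φ u - φ v := by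
  simp_rw [res_addE huv hK, mul_sub, sum_sub_distrib]
  simp

lemma nbr_addE_left (huv : u ≠ v) (hK : ¬ K.Adj u v) :
    nbr d (addE K u v) u = nbr d K u + (res d K v - 1) := by
  unfold nbr
  simp_rw [ind_addE huv hK, add_mul, sum_add_distrib, sum_res_mul_addE huv hK]
  simp [ind_of_not_adj hK, huv]

lemma nbr_addE_right (huv : u ≠ v) (hK : ¬ K.Adj u v) :
    nbr d (addE K u v) v = nbr d K v + (res d K u - 1) := by
  rw [addE_comm]
  exact nbr_addE_left huv.symm fun h => hK h.symm

lemma s2_addE (huv : u ≠ v) (hK : ¬ K.Adj u v) :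
    s2 d (addE K u v) = s2 d K - 2 * (res d K u + res d K v - 2) := by
  have : ∀ x, res d (addE K u v) x * (res d (addE K u v) x - 1) = res d K x * (res d K x - 1)
      - (if x = u then 2 * (res d K x - 1) else 0) - (if x = v then 2 * (res d K x - 1)
          else 0) := by
    intro x
    rw [res_addE huv hK]
    split_ifs with h1 h2
    · exact absurd (h1.symm.trans h2) huv
    all_goals ring
  unfold s2
  simp_rw [this, sum_sub_distrib]
  simp
  ring

lemma q2_eq : q2 d K = s2 d K + rsum d K := by
  unfold q2 s2 rsum
  rw [← sum_add_distrib]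
  exact sum_congr rfl fun x _ => by ring

lemma tK_eq : tK d K = ∑ x, res d K x * nbr d K x := by
  unfold tK nbr
  exact sum_congr rfl fun x _ => by rw [mul_sum]; exact sum_congr rfl fun y _ => by ring

lemma tK_addE (huv : u ≠ v) (hK : ¬ K.Adj u v) :
    tK d (addE K u v) = tK d K - 2 * (nbr d K u + nbr d K v)
      + 2 * ((res d K u - 1) * (res d K v - 1)) := by
  have h1 : ∀ x, nbr d (addE K u v) x = nbr d K x - ind K x u - ind K x v
      + (if x = u then res d K v - 1 else 0) + (if x = v then res d K u - 1 else 0) := by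
    intro x
    unfold nbr
    simp_rw [ind_addE huv hK, add_mul, sum_add_distrib, sum_res_mul_addE huv hK, ite_and]
    simp only [sum_ite_irrel, sum_const_zero, ite_mul, one_mul, zero_mul, sum_ite_eq',
      mem_univ, if_true, if_neg huv, if_neg huv.symm]
    split_ifs <;> simp_all
  rw [tK_eq, tK_eq]
  have hs : ∀ w, ∑ x, res d K x * ind K x w = nbr d K w := fun w => by
    unfold nbr; exact sum_congr rfl fun x _ => by rw [ind_comm]; ring
  have hK' : ¬ K.Adj v u := fun h => hK h.symm
  have e := sum_res_mul_addE (d := d) huv hK fun x => nbr d (addE K u v) x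
  simp_rw [mul_comm (res d _ _)]
  rw [e]
  simp only [h1, sub_mul, add_mul, sum_add_distrib, sum_sub_distrib, ind_self, ind_of_not_adj hK,
    ind_of_not_adj hK', if_neg huv, if_neg huv.symm, if_true]
  simp only [mul_comm _ (res d K _), hs]
  simp
  ring

/-- Comparison of the exponents. -/
lemma expo_addE (huv : u ≠ v) (hK : ¬ K.Adj u v) (hS : 2 < rsum d K) {a b w ν p t : ℝ}
    (ha : a = s2 d K / rsum d K) (hb : b = tK d K / rsum d K) (hw : w = res d K u + res d K v - 2)
    (hν : ν = nbr d K u + nbr d K v) (hp : p = (res d K u - 1) * (res d K v - 1))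
    (ht : t = 1 / (rsum d K - 2)) :
    expo d (addE K u v) - expo d K =
      t * ((a - w) * (1 + a) + b - ν + p) + (a - w) ^ 2 * t ^ 2 := by
  unfold expo
  rw [rsum_addE huv hK, s2_addE huv hK, tK_addE huv hK, ← hw, ← hν, ← hp, ha, hb, ht]
  have h1 : rsum d K ≠ 0 := by linarith
  have h2 : rsum d K - 2 ≠ 0 := by linarith
  field_simp
  ring

set_option maxHeartbeats 1000000 in
lemma exp_step_aux {S t s r a b w ν p ρ d θ A B E : ℝ} (hd : 3 ≤ d) (hθ0 : 0 < θ)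
    (hθ : θ ≤ 1 / 10 ^ 6) (hS : 10 < S) (hs : s * S = 1) (ht : t * (S - 2) = 1)
    (hr : r * (S - 1) = 1) (htθ : t * d ^ 2 ≤ 5 * θ)
    (ha : |a| ≤ d) (hb : |b| ≤ d ^ 2) (hw : |w| ≤ 2 * d) (hν : |ν| ≤ 2 * d ^ 2) (hp : |p| ≤ d ^ 2)
    (hA : 0 ≤ A) (hB : 0 ≤ B) (hρ : 1 + w - ρ = - p) (hE1 : E ≤ 1)
    (h : |A * r * (S - 2 - ν - w - w * (1 + a + 2 * (a - w) * t) + ρ) -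
      B * (1 - (s * a + s * b + a ^ 2 * s))| ≤ E * B) :
    |A * Real.exp (t * ((a - w) * (1 + a) + b - ν + p) + (a - w) ^ 2 * t ^ 2) - B| ≤
      (2 * E + 10 ^ 5 * θ ^ 2) * B := by
  have ht0 : 0 < t := by by_contra h; nlinarith
  have hs0 : 0 < s := by by_contra h; nlinarith
  have hr0 : 0 < r := by by_contra h; nlinarith
  have hst : t - s = 2 * s * t := by linear_combination (-t) * hs + s * ht
  have hrt : t - r = r * t := by linear_combination (-t) * hr + r * ht
  have hst' : s ≤ t := by nlinarith [mul_pos hs0 ht0]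
  have hrt' : r ≤ t := by nlinarith [mul_pos hr0 ht0]
  have haw : |a - w| ≤ 3 * d := by rw [abs_le] at *; constructor <;> linarith
  have ha2 : |a ^ 2| ≤ d ^ 2 := by rw [abs_pow]; exact pow_le_pow_left₀ (abs_nonneg _) ha 2
  have hwa : |w * a| ≤ 2 * d * d := by
    rw [abs_mul]; exact mul_le_mul hw ha (abs_nonneg _) (by linarith)
  have haw2 : |(a - w) ^ 2| ≤ (3 * d) ^ 2 := by
    rw [abs_pow]; exact pow_le_pow_left₀ (abs_nonneg _) haw 2
  have hwaw : |w * (a - w)| ≤ 2 * d * (3 * d) := by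
    rw [abs_mul]; exact mul_le_mul hw haw (abs_nonneg _) (by linarith)
  have hawa : |(a - w) * a| ≤ 3 * d * d := by
    rw [abs_mul]; exact mul_le_mul haw ha (abs_nonneg _) (by linarith)
  have hdd : d ≤ d ^ 2 / 3 := by nlinarith
  have htd : t * 9 ≤ 5 * θ := 
    le_trans (mul_le_mul_of_nonneg_left (by nlinarith) ht0.le) htθ
  have hθθ : θ ^ 2 ≤ θ / 10 ^ 6 := by nlinarith
  set β := s * a + s * b + a ^ 2 * s with hβ
  set Δ := t * ((a - w) * (1 + a) + b - ν + p) + (a - w) ^ 2 * t ^ 2 with hΔ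
  set γ := r * (ν + w + w * a - p + 2 * (w * (a - w)) * t) with hγ
  have hβle : |β| ≤ 12 * θ := by
    have h1 : |a + b + a ^ 2| ≤ 7 / 3 * d ^ 2 := by
      rw [abs_le] at *; constructor <;> linarith
    have e : β = s * (a + b + a ^ 2) := by rw [hβ]; ring
    calc |β| = s * |a + b + a ^ 2| := by rw [e, abs_mul, abs_of_pos hs0]
      _ ≤ t * (7 / 3 * d ^ 2) := mul_le_mul hst' h1 (abs_nonneg _) ht0.le
      _ ≤ 12 * θ := by linarith
  have htt : t ^ 2 * d ^ 2 ≤ 3 * θ ^ 2 := by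
    have := mul_le_mul htd htθ (by positivity) (by positivity)
    linarith [sq_nonneg θ]
  have htt' : t ^ 2 ≤ θ ^ 2 := by
    have := mul_le_mul htd htd (by positivity) (by positivity)
    linarith [sq_nonneg θ]
  have hΔle : |Δ| ≤ 50 * θ := by
    have h1 : |(a - w) * (1 + a) + b - ν + p| ≤ 8 * d ^ 2 := by
      have : (a - w) * (1 + a) + b - ν + p = (a - w) + (a - w) * a + b - ν + p := by ring
      rw [this]
      rw [abs_le] at *; constructor <;> linarith
    calc |Δ| ≤ |t * ((a - w) * (1 + a) + b - ν + p)| + |(a - w) ^ 2 * t ^ 2| := abs_add_le _ _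
      _ = t * |(a - w) * (1 + a) + b - ν + p| + |(a - w) ^ 2| * t ^ 2 := by
        rw [abs_mul, abs_mul, abs_of_pos ht0, abs_of_pos (pow_pos ht0 2)]
      _ ≤ t * (8 * d ^ 2) + (3 * d) ^ 2 * t ^ 2 :=
        add_le_add (mul_le_mul_of_nonneg_left h1 ht0.le)
          (mul_le_mul_of_nonneg_right haw2 (by positivity))
      _ ≤ 50 * θ := by linarith
  have hd1 : Δ - (β - γ) = 2 * s * t * (a + a ^ 2 + b) - r * t * (w + w * a + ν - p)
      + (a - w) ^ 2 * t ^ 2 + 2 * (w * (a - w)) * (r * t) := by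
    rw [hΔ, hβ, hγ]
    linear_combination (a + a ^ 2 + b) * hst - (w + w * a + ν - p) * hrt
  have hd2 : |Δ - (β - γ)| ≤ 120 * θ ^ 2 := by
    rw [hd1]
    have e1 : |2 * s * t * (a + a ^ 2 + b)| ≤ 2 * t * t * (7 / 3 * d ^ 2) := by
      rw [abs_mul, abs_of_pos (by positivity : 0 < 2 * s * t)]
      refine mul_le_mul (by gcongr) ?_ (abs_nonneg _) (by positivity)
      rw [abs_le] at *; constructor <;> linarith
    have e2 : |r * t * (w + w * a + ν - p)| ≤ t * t * (6 * d ^ 2) := by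
      rw [abs_mul, abs_of_pos (by positivity : 0 < r * t)]
      refine mul_le_mul (by gcongr) ?_ (abs_nonneg _) (by positivity)
      rw [abs_le] at *; constructor <;> linarith
    have e3 : |(a - w) ^ 2 * t ^ 2| ≤ (3 * d) ^ 2 * t ^ 2 := by
      rw [abs_mul, abs_of_pos (pow_pos ht0 2)]
      exact mul_le_mul_of_nonneg_right haw2 (by positivity)
    have e4 : |2 * (w * (a - w)) * (r * t)| ≤ 2 * (2 * d * (3 * d)) * (t * t) := by
      rw [abs_mul, abs_of_pos (by positivity : 0 < r * t), abs_mul, abs_two]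
      gcongr
    have e5 : 2 * t * t * (7 / 3 * d ^ 2) + t * t * (6 * d ^ 2) + (3 * d) ^ 2 * t ^ 2 +
      2 * (2 * d * (3 * d)) * (t * t) ≤ 120 * θ ^ 2 := by
      linarith [sq_nonneg θ]
    rw [abs_le] at *
    constructor <;> linarith
  have hγle : |γ| ≤ 63 * θ := by
    rw [abs_le] at *
    have : 120 * θ ^ 2 ≤ θ := by linarith
    constructor <;> linarith
  have hbr : r * (S - 2 - ν - w - w * (1 + a + 2 * (a - w) * t) + ρ) = 1 - γ := by
    rw [hγ]
    linear_combination hr - r * hρ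
  rw [mul_assoc A, hbr] at h
  have hΔ1 : |Δ| ≤ 1 := hΔle.trans (by linarith)
  have he := Real.abs_exp_sub_one_sub_id_le hΔ1
  have hΔ2 : Δ ^ 2 ≤ 2500 * θ ^ 2 := by
    rw [← sq_abs]; calc |Δ| ^ 2 ≤ (50 * θ) ^ 2 := pow_le_pow_left₀ (abs_nonneg _) hΔle 2
      _ = _ := by ring
  have hexp : |Real.exp Δ * (1 - β) - (1 - γ)| ≤ 5000 * θ ^ 2 := by
    have e1 : Real.exp Δ * (1 - β) - (1 - γ) = (Real.exp Δ - 1 - Δ) * (1 - β) +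
        (Δ - (β - γ)) - Δ * β := by ring
    have e2 : |(Real.exp Δ - 1 - Δ) * (1 - β)| ≤ 2500 * θ ^ 2 * (1 + 12 * θ) := by
      rw [abs_mul]
      refine mul_le_mul (he.trans hΔ2) ?_ (abs_nonneg _) (by positivity)
      rw [abs_le] at *; constructor <;> linarith
    have e3 : |Δ * β| ≤ 50 * θ * (12 * θ) := by
      rw [abs_mul]; exact mul_le_mul hΔle hβle (abs_nonneg _) (by positivity)
    have e4 : 2500 * θ ^ 2 * (1 + 12 * θ) + 50 * θ * (12 * θ) + 120 * θ ^ 2 ≤ 5000 * θ ^ 2 := by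
      have := mul_le_mul_of_nonneg_left hθ (sq_nonneg θ)
      linarith [sq_nonneg θ]
    rw [e1]
    rw [abs_le] at *
    constructor <;> linarith
  have hβ1 : 1 / 2 ≤ 1 - β ∧ 1 - β ≤ 2 := by rw [abs_le] at hβle; constructor <;> linarith
  have hγ1 : 1 / 2 ≤ 1 - γ := by rw [abs_le] at hγle; linarith
  have hAB : A ≤ 6 * B := by
    have := (abs_le.1 h).2
    have e1 : B * (1 - β) ≤ B * 2 := mul_le_mul_of_nonneg_left hβ1.2 hB
    have e2 : A * (1 / 2) ≤ A * (1 - γ) := mul_le_mul_of_nonneg_left hγ1 hA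
    have e3 : E * B ≤ 1 * B := mul_le_mul_of_nonneg_right hE1 hB
    linarith [sq_nonneg θ]
  have hkey : |(A * Real.exp Δ - B) * (1 - β)| ≤ E * B + 30000 * θ ^ 2 * B := by
    have e1 : (A * Real.exp Δ - B) * (1 - β) = A * (Real.exp Δ * (1 - β) - (1 - γ)) +
      (A * (1 - γ) - B * (1 - β)) := by ring
    rw [e1]
    refine (abs_add_le _ _).trans ?_
    rw [abs_mul, abs_of_nonneg hA]
    have := mul_le_mul hAB hexp (abs_nonneg _) (by linarith)
    linarith [sq_nonneg θ]
  rw [abs_mul, abs_of_nonneg (by linarith : 0 ≤ 1 - β)] at hkey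
  have := mul_le_mul_of_nonneg_left hβ1.1 (abs_nonneg (A * Real.exp Δ - B))
  have h9 : 0 ≤ θ ^ 2 * B := by positivity
  linarith

lemma abs_nbr_le (hG : G ∈ fam d K) (hd : 3 ≤ d) (u : Fin n) : |nbr d K u| ≤ d ^ 2 := by
  have h0 : 0 ≤ nbr d K u :=
    sum_nonneg fun x _ => mul_nonneg (ind_nonneg _ _ _) (res_nonneg hG x)
  rw [abs_of_nonneg h0]
  calc nbr d K u ≤ ∑ x, ind K u x * d :=
        sum_le_sum fun x _ => mul_le_mul_of_nonneg_left (res_le x) (ind_nonneg _ _ _)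
    _ = (∑ x, ind K u x) * d := (sum_mul _ _ _).symm
    _ ≤ d * d := mul_le_mul_of_nonneg_right (sum_ind_res_le hG u) (by linarith)
    _ = d ^ 2 := by ring

/-- One step of the exponential formula. -/
lemma cnt_addE_exp (P : Params n d θ) (hS : n * d / 4 + 30 ≤ rsum d K) (huv : u ≠ v)
    (hK : ¬ K.Adj u v) {ρ : ℝ} (hu : res d K u = ρ) (hv : res d K v = ρ) (hρ : d - 1 ≤ ρ) :
    |cnt d (addE K u v) * (rsum d K - 1) * Real.exp (expo d (addE K u v) - expo d K) -
      ρ ^ 2 * cnt d K| ≤ 10 ^ 6 * θ ^ 2 * (ρ ^ 2 * cnt d K) := by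
  have hd := P.hd
  have hθ := P.θ_pos
  by_cases h0 : cnt d K = 0
  · have : cnt d (addE K u v) = 0 :=
      le_antisymm ((cnt_addE_le_cnt u v).trans h0.le) cnt_nonneg
    simp [h0, this]
  obtain ⟨G, hG⟩ := exists_mem_of_cnt_ne h0
  have hN := cnt_nonneg (d := d) (K := K)
  have hnd : 0 < n * d := mul_pos P.n_pos (by linarith)
  have hS0 : 30 < rsum d K := by linarith
  have hab : ∀ c z : ℝ, |z| ≤ c * rsum d K → |z / rsum d K| ≤ c := fun c z h => by
    rw [abs_div, abs_of_pos (by linarith : 0 < rsum d K)]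
    exact (div_le_iff₀ (by linarith)).2 h
  have h2 := cnt_addE_second P hS hG huv hK
  rw [nbr_addE_left huv hK, nbr_addE_right huv hK, q2_eq, s2_addE huv hK, res_addE_left huv hK,
    res_addE_right huv hK, rsum_addE huv hK, hu, hv] at h2
  have hS1 : rsum d K - 1 ≠ 0 := by linarith
  have hS2 : rsum d K - 2 ≠ 0 := by linarith
  have hS3 : rsum d K ≠ 0 := by linarith
  have hρ0 : ρ ≤ d := hu ▸ res_le u
  have hθ2 : 4 * d ^ 2 * (1 / 9) ≤ ρ ^ 2 := by nlinarith
  have hθ6 := P.θ_le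
  rw [expo_addE huv hK (by linarith) rfl rfl rfl rfl rfl rfl]
  refine (exp_step_aux (S := rsum d K) (t := 1 / (rsum d K - 2)) (s := 1 / rsum d K)
    (r := 1 / (rsum d K - 1)) (ρ := ρ * ρ) (E := 160000 * θ ^ 2) hd hθ P.θ_le (by linarith)
    (by field_simp) (by field_simp) (by field_simp) ?_ ?_ ?_ ?_ ?_ ?_ ?_ ?_ ?_ ?_
    ?_).trans ?_
  · rw [one_div_mul_eq_div, div_le_iff₀ (by linarith)]
    have := P.hθ
    nlinarith
  · refine hab _ _ ?_
    refine (abs_sum_le_sum_abs _ _).trans ?_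
    rw [rsum, mul_sum]
    refine sum_le_sum fun x _ => ?_
    rw [abs_mul, abs_of_nonneg (res_nonneg hG x), mul_comm]
    exact mul_le_mul_of_nonneg_right (abs_res_sub_one_le hG hd x) (res_nonneg hG x)
  · refine hab _ _ ?_
    rw [tK_eq]
    refine (abs_sum_le_sum_abs _ _).trans ?_
    rw [rsum, mul_sum]
    refine sum_le_sum fun x _ => ?_
    rw [abs_mul, abs_of_nonneg (res_nonneg hG x), mul_comm]
    exact mul_le_mul_of_nonneg_right (abs_nbr_le hG hd x) (res_nonneg hG x)
  · rw [hu, hv, abs_le]; constructor <;> linarith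
  · refine (abs_add_le _ _).trans ?_
    linarith [abs_nbr_le hG hd u, abs_nbr_le hG hd v]
  · rw [hu, hv, abs_le]; constructor <;> nlinarith
  · exact mul_nonneg cnt_nonneg (by linarith)
  · positivity
  · rw [hu, hv]; ring
  · nlinarith
  · have e : cnt d (addE K u v) * (rsum d K - 1) * (1 / (rsum d K - 1)) *
        (rsum d K - 2 - (nbr d K u + nbr d K v) - (res d K u + res d K v - 2) -
        (res d K u + res d K v - 2) * (1 + s2 d K / rsum d K +
          2 * (s2 d K / rsum d K - (res d K u + res d K v - 2)) * (1 / (rsum d K - 2))) + ρ * ρ) -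
        ρ ^ 2 * cnt d K * (1 - (1 / rsum d K * (s2 d K / rsum d K) +
        1 / rsum d K * (tK d K / rsum d K) + (s2 d K / rsum d K) ^ 2 * (1 / rsum d K))) =
        cnt d (addE K u v) * (rsum d K - 2 - (nbr d K u + (ρ - 1)) - (nbr d K v + (ρ - 1))
        - (ρ - 1 + (ρ - 1)) * (s2 d K - 2 * (ρ + ρ - 2) + (rsum d K - 2)) / (rsum d K - 2)
        + ρ * ρ)
      - ρ * ρ * (1 -
        (s2 d K / rsum d K ^ 2 + tK d K / rsum d K ^ 2 + s2 d K ^ 2 / rsum d K ^ 3)) * cnt d K := by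
      rw [hu, hv]
      field_simp
      ring
    rw [e]
    refine h2.trans ?_
    have := mul_le_mul_of_nonneg_right hθ2 (by positivity : 0 ≤ θ ^ 2 * cnt d K)
    have h9 : 0 ≤ d ^ 2 * (θ ^ 2 * cnt d K) := by positivity
    linarith [sq_nonneg θ]
  · have : 0 ≤ θ ^ 2 * (ρ ^ 2 * cnt d K) := by positivity
    linarith [sq_nonneg θ]

end

section

variable {n : ℕ} {d θ : ℝ} {K : SimpleGraph (Fin n)} {u v x y : Fin n} {G : SimpleGraph (Fin n)}

lemma rsum_anti {K₁ : SimpleGraph (Fin n)} (h : K ≤ K₁) : rsum d K₁ ≤ rsum d K :=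
  sum_le_sum fun x _ => sub_le_sub_left (sum_le_sum fun y _ => ind_mono h x y) d

lemma exists_adj_of_ne {K₁ : SimpleGraph (Fin n)} (h : K ≤ K₁) (hne : K ≠ K₁) :
    ∃ u v, K₁.Adj u v ∧ ¬ K.Adj u v := by
  by_contra! h'
  exact hne (le_antisymm h fun u v huv => h' u v huv)

lemma cnt_telescope (P : Params n d θ) {K₁ : SimpleGraph (Fin n)}
    (hS : n * d / 4 + 30 ≤ rsum d K₁) {ρ : ℝ} (hρ : d - 1 ≤ ρ) (i : ℕ) :
    ∀ K ≤ K₁, rsum d K = rsum d K₁ + 2 * i →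
    (∀ x y z, K₁.Adj x y → ¬ K.Adj x y → K₁.Adj x z → ¬ K.Adj x z → y = z) →
    (∀ x y, K₁.Adj x y → ¬ K.Adj x y → res d K x = ρ) →
    cnt d K₁ * Real.exp (expo d K₁) * ∏ l ∈ range i, (rsum d K₁ + 2 * l + 1) ≤
      ((1 + 10 ^ 6 * θ ^ 2) * ρ ^ 2) ^ i * (cnt d K * Real.exp (expo d K)) ∧
    ((1 - 10 ^ 6 * θ ^ 2) * ρ ^ 2) ^ i * (cnt d K * Real.exp (expo d K)) ≤
      cnt d K₁ * Real.exp (expo d K₁) * ∏ l ∈ range i, (rsum d K₁ + 2 * l + 1) := by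
  have hθ0 := P.θ_pos
  have hθ := P.θ_le
  have hε : 10 ^ 6 * θ ^ 2 ≤ 1 := by nlinarith
  have hnd : 0 < n * d := mul_pos P.n_pos (by linarith [P.hd])
  induction i with
  | zero =>
    intro K hK hs hm hr
    have : K = K₁ := by
      by_contra hne
      obtain ⟨u, v, h1, h2⟩ := exists_adj_of_ne hK hne
      have h3 := rsum_anti (d := d) ((addE_le_iff h1.ne).2 ⟨hK, h1⟩)
      rw [rsum_addE h1.ne h2] at h3
      push_cast at hs
      linarith
    simp [this]
  | succ i ih =>
    intro K hK hs hm hr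
    have hne : K ≠ K₁ := by rintro rfl; push_cast at hs; linarith
    obtain ⟨u, v, h1, h2⟩ := exists_adj_of_ne hK hne
    have huv := h1.ne
    have hK' := (addE_le_iff huv).2 ⟨hK, h1⟩
    have hs' := rsum_addE (d := d) huv h2
    have h2' : ¬ K.Adj v u := fun h => h2 h.symm
    have hadj : ∀ x y, ¬ (addE K u v).Adj x y → ¬ K.Adj x y := fun x y h h' => h (le_addE u v h')
    have hi := ih (addE K u v) hK' (by rw [hs', hs]; push_cast; ring)
      (fun x y z a b c e => hm x y z a (hadj _ _ b) c (hadj _ _ e)) (fun x y a b => by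
        have hx1 : x ≠ u := by
          rintro rfl
          have := hm x y v a (hadj _ _ b) h1 h2
          exact b ((addE_adj huv).2 (Or.inr (Or.inl ⟨rfl, this⟩)))
        have hx2 : x ≠ v := by
          rintro rfl
          have := hm x y u a (hadj _ _ b) h1.symm h2'
          exact b ((addE_adj huv).2 (Or.inr (Or.inr ⟨rfl, this⟩)))
        rw [res_addE_ne huv h2 hx1 hx2]
        exact hr x y a (hadj _ _ b))
    have hst := cnt_addE_exp P (K := K) (hS.trans (rsum_anti hK)) huv h2 (hr u v h1 h2)
      (hr v u h1.symm h2') hρ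
    rw [Real.exp_sub, mul_div_assoc', div_sub' (Real.exp_pos _).ne', abs_div,
      abs_of_pos (Real.exp_pos _), div_le_iff₀ (Real.exp_pos _), abs_le] at hst
    rw [prod_range_succ]
    have hs1 : rsum d K - 1 = rsum d K₁ + 2 * i + 1 := by rw [hs]; push_cast; ring
    rw [hs1] at hst
    have hs2 : 0 ≤ rsum d K₁ + 2 * i + 1 := by
      have : (0:ℝ) ≤ i := by positivity
      linarith
    have e1 := mul_le_mul_of_nonneg_right hi.1 hs2
    have e2 := mul_le_mul_of_nonneg_right hi.2 hs2
    have e3 : cnt d (addE K u v) * (rsum d K₁ + 2 * i + 1) * Real.exp (expo d (addE K u v)) ≤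
      ((1 + 10 ^ 6 * θ ^ 2) * ρ ^ 2) * (cnt d K * Real.exp (expo d K)) := by linarith [hst.2]
    have e4 : ((1 - 10 ^ 6 * θ ^ 2) * ρ ^ 2) * (cnt d K * Real.exp (expo d K)) ≤
      cnt d (addE K u v) * (rsum d K₁ + 2 * i + 1) * Real.exp (expo d (addE K u v)) := by
      linarith [hst.1]
    have e5 := mul_le_mul_of_nonneg_left e3
      (by positivity : 0 ≤ ((1 + 10 ^ 6 * θ ^ 2) * ρ ^ 2) ^ i)
    have e6 := mul_le_mul_of_nonneg_left e4
      (pow_nonneg (mul_nonneg (sub_nonneg.2 hε) (sq_nonneg ρ)) i)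
    rw [pow_succ (_ * ρ ^ 2), pow_succ (_ * ρ ^ 2), ← mul_assoc (_ * Real.exp _), mul_assoc (_ ^ i),
        mul_assoc (_ ^ i)]
    exact ⟨e1.trans (le_of_eq_of_le (by ring) e5), e6.trans (le_of_eq_of_le (by ring) e2)⟩

end

section

variable {n : ℕ} {d θ : ℝ} {K M M' : SimpleGraph (Fin n)} {u v x y : Fin n}
    {G : SimpleGraph (Fin n)}

/-! ### Perfect matchings and their residual statistics -/

lemma ind_bot (x y : Fin n) : ind (⊥ : SimpleGraph (Fin n)) x y = 0 := ind_of_not_adj (by simp)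

lemma ind_inf (x y : Fin n) : ind (M ⊓ M') x y = ind M x y * ind M' x y := by
  by_cases h : M.Adj x y <;> by_cases h' : M'.Adj x y <;>
    simp [ind, SimpleGraph.inf_adj, h, h']

lemma ind_sup (x y : Fin n) : ind (M ⊔ M') x y = ind M x y + ind M' x y - ind M x y *
    ind M' x y := by
  by_cases h : M.Adj x y <;> by_cases h' : M'.Adj x y <;>
    simp [ind, SimpleGraph.sup_adj, h, h']

lemma ind_mul_self (x y : Fin n) : ind M x y * ind M x y = ind M x y := by
  by_cases h : M.Adj x y <;> simp [ind, h]

lemma exists_partner (h : ∑ y, ind M x y = 1) : ∃ p, ∀ y, M.Adj x y ↔ y = p := by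
  classical
  have : ∑ y, ind M x y = #(univ.filter fun y => M.Adj x y) := by
    simp only [ind, sum_ite, sum_const_zero, sum_const]
    simp
  rw [this] at h
  obtain ⟨p, hp⟩ := card_eq_one.1 (by exact_mod_cast h)
  refine ⟨p, fun y => ?_⟩
  rw [← mem_singleton, ← hp]; simp

lemma ind_mul_ind_of_matching (h : ∑ y, ind M x y = 1) (y z : Fin n) :
    ind M x y * ind M x z = if y = z then ind M x y else 0 := by
  obtain ⟨p, hp⟩ := exists_partner h
  rw [ind_of_iff (hp y), ind_of_iff (hp z)]
  by_cases h1 : y = p <;> by_cases h2 : z = p <;> simp [h1, h2, eq_comm]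

lemma mem_matching : M ∈ fam 1 (⊥ : SimpleGraph (Fin n)) ↔ ∀ x, ∑ y, ind M x y = 1 := by
  simp [mem_fam]

lemma rsum_bot : rsum d (⊥ : SimpleGraph (Fin n)) = n * d := by
  simp [rsum, res, ind_bot]

lemma expo_bot (P : Params n d θ) :
    expo d (⊥ : SimpleGraph (Fin n)) = (d - 1) / 2 + (d - 1) ^ 2 / 4 := by
  have hn := P.n_pos.ne'
  have hd : d ≠ 0 := by linarith [P.hd]
  rw [expo, rsum_bot, s2, tK]
  simp only [res, ind_bot]
  simp
  field_simp
  ring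

lemma res_matching (hM : ∀ x, ∑ y, ind M x y = 1) (x : Fin n) : res d M x = d - 1 := by
  rw [res, hM]

lemma rsum_matching (hM : ∀ x, ∑ y, ind M x y = 1) : rsum d M = n * (d - 1) := by
  simp [rsum, res_matching hM]; ring

lemma expo_matching (P : Params n d θ) (hM : ∀ x, ∑ y, ind M x y = 1) :
    expo d M = (d - 2) ^ 2 / 4 + (d - 2) + 1 / 2 := by
  have hn := P.n_pos.ne'
  have hd : d - 1 ≠ 0 := by linarith [P.hd]
  rw [expo, rsum_matching hM, s2, tK]
  simp only [res_matching hM, ← sum_mul, hM]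
  simp
  field_simp
  ring

lemma sum_common (hM : ∀ x, ∑ y, ind M x y = 1) (hM' : ∀ x, ∑ y, ind M' x y = 1) (x : Fin n) :
    res d (M ⊔ M') x = d - 2 + ∑ y, ind M x y * ind M' x y := by
  rw [res]
  simp_rw [ind_sup, sum_sub_distrib, sum_add_distrib, hM, hM']
  ring

lemma ind_mul_common (hM : ∀ x, ∑ y, ind M x y = 1) (x y : Fin n) :
    ind M x y * ∑ z, ind M x z * ind M' x z = ind M x y * ind M' x y := by
  simp_rw [mul_sum, ← mul_assoc, ind_mul_ind_of_matching (hM x), ite_mul, zero_mul]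
  simp

lemma common_sq (hM : ∀ x, ∑ y, ind M x y = 1) (x : Fin n) :
    (∑ z, ind M x z * ind M' x z) * ∑ z, ind M x z * ind M' x z = ∑ z, ind M x z * ind M' x z := by
  rw [sum_mul]
  refine sum_congr rfl fun z _ => ?_
  rw [mul_right_comm, ind_mul_common hM, mul_assoc, ind_mul_self]

lemma rsum_sup (hM : ∀ x, ∑ y, ind M x y = 1) (hM' : ∀ x, ∑ y, ind M' x y = 1) :
    rsum d (M ⊔ M') = n * (d - 2) + ∑ x, ∑ y, ind M x y * ind M' x y := by
  simp [rsum, sum_common hM hM', sum_add_distrib]; ring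

lemma s2_sup (hM : ∀ x, ∑ y, ind M x y = 1) (hM' : ∀ x, ∑ y, ind M' x y = 1) :
    s2 d (M ⊔ M') = n * ((d - 2) * (d - 3)) +
      (2 * d - 4) * ∑ x, ∑ y, ind M x y * ind M' x y := by
  have : ∀ x, res d (M ⊔ M') x * (res d (M ⊔ M') x - 1) = (d - 2) * (d - 3) +
      (2 * d - 4) * ∑ y, ind M x y * ind M' x y := fun x => by
    rw [sum_common hM hM']
    linear_combination common_sq (M' := M') hM x
  simp_rw [s2, this, sum_add_distrib, mul_sum]
  simp

lemma tK_sup (hM : ∀ x, ∑ y, ind M x y = 1) (hM' : ∀ x, ∑ y, ind M' x y = 1) :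
    tK d (M ⊔ M') = 2 * n * (d - 2) ^ 2 +
      ((d - 1) ^ 2 - 2 * (d - 2) ^ 2) * ∑ x, ∑ y, ind M x y * ind M' x y := by
  have : ∀ x y, ind (M ⊔ M') x y * (res d (M ⊔ M') x * res d (M ⊔ M') y) =
      (d - 2) ^ 2 * ind M x y + (d - 2) ^ 2 * ind M' x y +
      ((d - 1) ^ 2 - 2 * (d - 2) ^ 2) * (ind M x y * ind M' x y) := fun x y => by
    have h1 := ind_mul_common (M' := M') hM x y
    have h2 := ind_mul_common (M' := M) hM' x y
    have h3 := ind_mul_common (M' := M') hM y x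
    have h4 := ind_mul_common (M' := M) hM' y x
    simp_rw [mul_comm (ind M' x _)] at h2
    simp_rw [mul_comm (ind M' y _)] at h4
    rw [ind_comm M y x, ind_comm M' y x] at h3 h4
    rw [sum_common hM hM', sum_common hM hM', ind_sup]
    set a := ind M x y
    set b := ind M' x y
    set c := ∑ z, ind M x z * ind M' x z
    set e := ∑ z, ind M y z * ind M' y z
    have ha : a * a = a := ind_mul_self _ _
    have hb : b * b = b := ind_mul_self _ _
    have h5 : a * c * e = a * b := by
      rw [h1]; linear_combination b * h3 + a * hb
    have h6 : b * c * e = a * b := by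
      rw [mul_comm b c, h2]; linear_combination a * h4 + b * ha
    have h7 : a * b * c = a * b := by linear_combination b * h1 + a * hb
    have h8 : a * b * e = a * b := by linear_combination b * h3 + a * hb
    have h9 : a * b * c * e = a * b := by rw [h7]; exact h8
    linear_combination (d - 2) * (h1 + h2 + h3 + h4 - h7 - h8) + h5 + h6 - h9
  simp_rw [tK, this, sum_add_distrib, ← mul_sum, hM, hM']
  simp
  ring

lemma expo_sup (hM : ∀ x, ∑ y, ind M x y = 1) (hM' : ∀ x, ∑ y, ind M' x y = 1)
    (P : Params n d θ) {t p c : ℝ} (ht0 : 0 ≤ t) (ht : ∑ x, ∑ y, ind M x y * ind M' x y = n * t)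
    (hc : c = d - 2) (hp : p = c * (c + 1) / (c + t)) :
    expo d (M ⊔ M') = c + (c + 1) ^ 2 / 2 - (c + 2) ^ 2 / 4 + (c + 2 - p) ^ 2 / 4 := by
  have hn := P.n_pos.ne'
  have hc1 : d = c + 2 := by linarith
  have hct : c + t ≠ 0 := by linarith [P.hd]
  rw [expo, rsum_sup hM hM', s2_sup hM hM', tK_sup hM hM', ht, hp, hc1]
  have e : (n:ℝ) * (c + 2 - 2) + n * t = n * (c + t) := by ring
  rw [e]
  field_simp
  ring

end

section

variable {n : ℕ} {d θ : ℝ} {K M M' : SimpleGraph (Fin n)} {u v x y : Fin n}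
    {G : SimpleGraph (Fin n)}

/-! ### Counting perfect matchings -/

/-- The product of the first `k` odd numbers. -/
noncomputable def oddProd (k : ℕ) : ℝ := ∏ i ∈ range k, (2 * (i : ℝ) + 1)

lemma oddProd_succ (k : ℕ) : oddProd (k + 1) = oddProd k * (2 * k + 1) := prod_range_succ _ _

lemma oddProd_pos (k : ℕ) : 0 < oddProd k := prod_pos fun i _ => by positivity

lemma cnt_one_of_rsum {k : ℕ} : ∀ K : SimpleGraph (Fin n),
    (∀ x, res 1 K x = 0 ∨ res 1 K x = 1) → rsum 1 K = 2 * k → cnt 1 K = oddProd k := by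
  induction k with
  | zero =>
    intro K hK hs
    have h0 : ∀ x, res 1 K x = 0 := by
      have := (sum_eq_zero_iff_of_nonneg fun x _ => by
        rcases hK x with h | h <;> simp [h]).1 (hs.trans (by simp))
      exact fun x => this x (mem_univ x)
    have : fam 1 K = {K} := by
      ext G
      rw [mem_singleton, mem_fam]
      refine ⟨fun h => ?_, ?_⟩
      · by_contra hne
        obtain ⟨u, v, h1, h2⟩ := exists_adj_of_ne h.1 (Ne.symm hne)
        have h3 : ∑ y, ind K u y < ∑ y, ind G u y :=
          sum_lt_sum (fun y _ => ind_mono h.1 u y)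
            ⟨v, mem_univ _, by rw [ind_of_adj h1, ind_of_not_adj h2]; norm_num⟩
        have h4 := h0 u
        rw [res] at h4
        linarith [h.2 u]
      · rintro rfl
        exact ⟨le_rfl, fun x => by have := h0 x; rw [res] at this; linarith⟩
    simp [cnt_eq_card, this, oddProd]
  | succ k ih =>
    intro K hK hs
    obtain ⟨u, hu⟩ : ∃ u, res 1 K u = 1 := by
      by_contra! h
      have h0 : rsum 1 K = 0 := sum_eq_zero fun x _ => (hK x).resolve_right (h x)
      rw [h0] at hs
      have : (0:ℝ) < (k + 1 : ℕ) := by positivity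
      linarith
    have hadj : ∀ x y, K.Adj x y → res 1 K x = 0 := fun x y h => by
      refine (hK x).resolve_right fun h1 => ?_
      rw [res] at h1
      have := single_le_sum (f := fun y => ind K x y) (fun y _ => ind_nonneg K x y) (mem_univ y)
      simp only [ind_of_adj h] at this
      linarith
    have h1 : cnt 1 K = ∑ v, tot 1 K fun G => ind G u v := by
      rw [← tot_sum]
      exact tot_congr fun G hG => ((mem_fam.1 hG).2 u).symm
    have h2 : ∀ v, (tot 1 K fun G => ind G u v) =
        oddProd k * (res 1 K v - if v = u then 1 else 0) := fun v => by
      by_cases huv : v = u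
      · subst huv; simp [hu, tot]
      have hnadj : ¬ K.Adj u v := fun h => by rw [hadj u v h] at hu; norm_num at hu
      rw [tot_ind (Ne.symm huv), if_neg huv, sub_zero]
      rcases hK v with hv | hv
      · rw [hv, mul_zero]
        by_contra h0
        obtain ⟨G, hG⟩ := exists_mem_of_cnt_ne h0
        have := res_nonneg hG v
        rw [res_addE_right (Ne.symm huv) hnadj] at this
        linarith
      · rw [hv, mul_one]
        refine ih _ (fun x => ?_) ?_
        · by_cases hxu : x = u
          · subst hxu; rw [res_addE_left (Ne.symm huv) hnadj]; left; linarith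
          by_cases hxv : x = v
          · subst hxv; rw [res_addE_right (Ne.symm huv) hnadj]; left; linarith
          rw [res_addE_ne (Ne.symm huv) hnadj hxu hxv]; exact hK x
        · rw [rsum_addE (Ne.symm huv) hnadj, hs]; push_cast; ring
    rw [h1]
    simp_rw [h2, ← mul_sum, sum_sub_distrib]
    have h3 : ∑ v, res 1 K v = 2 * (k + 1 : ℕ) := hs
    rw [h3, oddProd_succ]
    simp
    left
    ring

open Classical in
lemma sum_ind_eq_card (K : SimpleGraph (Fin n)) : ∑ x, ∑ y, ind K x y = 2 * #K.edgeFinset := by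
  have h : ∀ x, ∑ y, ind K x y = K.degree x := fun x => by
    simp only [ind, sum_ite, sum_const_zero, sum_const]
    rw [← SimpleGraph.card_neighborFinset_eq_degree, SimpleGraph.neighborFinset_eq_filter]
    simp
  simp_rw [h]
  exact_mod_cast K.sum_degrees_eq_twice_card_edges

open Classical in
lemma card_edges_matching {m : ℕ} (hn : n = 2 * m) (hM : ∀ x, ∑ y, ind M x y = 1) :
    #M.edgeFinset = m := by
  have := sum_ind_eq_card M
  simp_rw [hM] at this
  simp [hn] at this
  exact_mod_cast this.symm

open Classical in
/-- Number of perfect matchings containing a set of edges of a perfect matching. -/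
lemma card_matchings_containing {m : ℕ} (hn : n = 2 * m) (hM : ∀ x, ∑ y, ind M x y = 1)
    {B : Finset (Sym2 (Fin n))} (hB : B ⊆ M.edgeFinset) :
    ((#((fam 1 (⊥ : SimpleGraph (Fin n))).filter fun M' => B ⊆ M'.edgeFinset) : ℕ) : ℝ) =
      oddProd (m - #B) := by
  obtain ⟨F, hF⟩ : ∃ F, F = SimpleGraph.fromEdgeSet (B : Set (Sym2 (Fin n))) := ⟨_, rfl⟩
  have hFs : F.edgeSet = B := by
    rw [hF, SimpleGraph.edgeSet_fromEdgeSet, sdiff_eq_left]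
    refine Set.disjoint_left.2 fun e he hd => ?_
    have := hB (mem_coe.1 he)
    rw [SimpleGraph.mem_edgeFinset] at this
    exact M.not_isDiag_of_mem_edgeSet this hd
  have hle : ∀ G : SimpleGraph (Fin n), F ≤ G ↔ B ⊆ G.edgeFinset := fun G => by
    rw [← coe_subset, SimpleGraph.coe_edgeFinset, ← SimpleGraph.edgeSet_subset_edgeSet, hFs]
  have hFM : F ≤ M := (hle M).2 hB
  have hFe : F.edgeFinset = B := by
    rw [← coe_inj, SimpleGraph.coe_edgeFinset, hFs]
  have hcard : #B ≤ m := (card_le_card hB).trans (card_edges_matching hn hM).le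
  have h1 := cnt_one_of_rsum (k := m - #B) F (fun x => by
    obtain ⟨p, hp⟩ := exists_partner (hM x)
    have : ∑ y, ind F x y = ind F x p := by
      refine sum_eq_single p (fun y _ hy => ind_of_not_adj fun h => hy ((hp y).1 (hFM h))) (by simp)
    rw [res, this]
    by_cases h : F.Adj x p
    · left; rw [ind_of_adj h]; norm_num
    · right; rw [ind_of_not_adj h]; norm_num) (by
    rw [rsum]
    simp only [res, sum_sub_distrib, sum_ind_eq_card, hFe]
    rw [Nat.cast_sub hcard]
    simp [hn]
    ring)
  rw [← h1, cnt_eq_card]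
  congr 2
  ext G
  simp only [mem_filter, mem_fam, hle, bot_le, true_and]
  tauto

open Classical in
lemma card_matchings {m : ℕ} (hn : n = 2 * m) :
    cnt 1 (⊥ : SimpleGraph (Fin n)) = oddProd m := by
  refine cnt_one_of_rsum _ (fun x => Or.inr ?_) ?_
  · simp [res, ind_bot]
  · rw [rsum_bot, hn]; push_cast; ring

/-- Number of perfect matchings on `2 * k` vertices disjoint from a given one. -/
noncomputable def derange (k : ℕ) : ℝ := ∑ i ∈ range (k + 1), (-1) ^ i * (k.choose i) *
    oddProd (k - i)

open Classical in
lemma sum_matchings_apply {m : ℕ} (hn : n = 2 * m) (hM : ∀ x, ∑ y, ind M x y = 1) (φ : ℕ → ℝ) :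
    ∑ M' ∈ fam 1 (⊥ : SimpleGraph (Fin n)), φ #(M.edgeFinset ∩ M'.edgeFinset) =
      ∑ j ∈ range (m + 1), (m.choose j) * φ j * derange (m - j) := by
  set E := M.edgeFinset with hE
  have hcE : #E = m := card_edges_matching hn hM
  have h1 : ∀ M' : SimpleGraph (Fin n), φ #(E ∩ M'.edgeFinset) = ∑ A ∈ E.powerset, φ #A *
      ∑ C ∈ (E \ A).powerset, (-1) ^ #C * if A ∪ C ⊆ M'.edgeFinset then 1 else 0 := fun M' => by
    have key : ∀ A ∈ E.powerset, (∑ C ∈ (E \ A).powerset,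
        (-1) ^ #C * if A ∪ C ⊆ M'.edgeFinset then (1:ℝ) else 0) =
        if A = E ∩ M'.edgeFinset then 1 else 0 := fun A hA => by
      rw [mem_powerset] at hA
      by_cases hAM : A ⊆ M'.edgeFinset
      · have e : (∑ C ∈ (E \ A).powerset, (-1) ^ #C * if A ∪ C ⊆ M'.edgeFinset then (1:ℝ) else 0) =
            ((∑ C ∈ ((E ∩ M'.edgeFinset) \ A).powerset, (-1) ^ #C : ℤ) : ℝ) := by
          push_cast
          simp_rw [mul_ite, mul_one, mul_zero, ← sum_filter]
          refine sum_congr ?_ fun _ _ => rfl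
          ext C
          simp only [mem_filter, mem_powerset, subset_iff, Finset.mem_sdiff, mem_union,
              Finset.mem_inter]
          constructor
          · rintro ⟨h1, h2⟩ a ha
            exact ⟨⟨(h1 ha).1, h2 (Or.inr ha)⟩, (h1 ha).2⟩
          · intro h
            exact ⟨fun a ha => ⟨(h ha).1.1, (h ha).2⟩,
              fun a ha => ha.elim (fun h' => hAM h') fun h' => (h h').1.2⟩
        rw [e, sum_powerset_neg_one_pow_card]
        have : (E ∩ M'.edgeFinset) \ A = ∅ ↔ A = E ∩ M'.edgeFinset := by
          rw [sdiff_eq_empty_iff_subset]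
          exact ⟨fun h => Subset.antisymm (subset_inter hA hAM) h, fun h => h ▸ Subset.rfl⟩
        simp only [this]
        push_cast
        rfl
      · rw [if_neg fun h : A = E ∩ M'.edgeFinset => hAM (h ▸ inter_subset_right)]
        refine sum_eq_zero fun C _ => ?_
        rw [if_neg fun h => hAM (subset_union_left.trans h), mul_zero]
    rw [sum_congr rfl fun A hA => by rw [key A hA]]
    simp
  simp_rw [h1]
  rw [sum_comm]
  have h2 : ∀ A ∈ E.powerset, ∑ M' ∈ fam 1 (⊥ : SimpleGraph (Fin n)), φ #A *
      ∑ C ∈ (E \ A).powerset, (-1) ^ #C * (if A ∪ C ⊆ M'.edgeFinset then 1 else 0) =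
      φ #A * derange (m - #A) := fun A hA => by
    rw [mem_powerset] at hA
    rw [← mul_sum, sum_comm]
    congr 1
    have h3 : ∀ C ∈ (E \ A).powerset, ∑ M' ∈ fam 1 (⊥ : SimpleGraph (Fin n)),
        (-1) ^ #C * (if A ∪ C ⊆ M'.edgeFinset then (1:ℝ) else 0) =
        (-1) ^ #C * oddProd (m - #A - #C) := fun C hC => by
      rw [mem_powerset] at hC
      have hAC : A ∪ C ⊆ E := union_subset hA (hC.trans sdiff_subset)
      have hd : Disjoint A C := disjoint_of_subset_right hC disjoint_sdiff
      rw [← mul_sum, Nat.sub_sub, ← card_union_of_disjoint hd,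
          ← card_matchings_containing hn hM hAC]
      simp
    rw [sum_congr rfl h3, sum_powerset_apply_card (fun c => (-1) ^ c * oddProd (m - #A - c)),
      card_sdiff_of_subset hA, hcE, derange]
    exact sum_congr rfl fun i _ => by rw [nsmul_eq_mul]; ring
  rw [sum_congr rfl h2, sum_powerset_apply_card (fun c => φ c * derange (m - c)), hcE]
  exact sum_congr rfl fun i _ => by rw [nsmul_eq_mul]; ring

end

section

variable {n : ℕ} {d θ : ℝ} {K M M' : SimpleGraph (Fin n)} {u v x y : Fin n}
    {G : SimpleGraph (Fin n)}

/-! ### Bounds for matchings and pairs of matchings -/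

lemma oddProd_add (b k : ℕ) : oddProd (b + k) = oddProd b * ∏ l ∈ range k,
    (2 * b + 2 * l + 1 : ℝ) := by
  rw [oddProd, oddProd, prod_range_add]
  congr 1
  exact prod_congr rfl fun i _ => by push_cast; ring

lemma unique_of_matching (hM : ∀ x, ∑ y, ind M x y = 1) {x y z : Fin n} (h : M.Adj x y)
    (h' : M.Adj x z) : y = z := by
  obtain ⟨p, hp⟩ := exists_partner (hM x)
  rw [(hp y).1 h, (hp z).1 h']

lemma cnt_matching_ge {m c : ℕ} (hn : n = 2 * m) (P : Params n (c + 2) θ)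
    (hM : ∀ x, ∑ y, ind M x y = 1) :
    ((1 - 10 ^ 6 * θ ^ 2) * (c + 2 : ℝ) ^ 2) ^ m * oddProd ((c + 1) * m) * Real.exp (1 / 4) *
      cnt (c + 2) (⊥ : SimpleGraph (Fin n)) ≤ cnt (c + 2) M * oddProd ((c + 2) * m) := by
  have hd := P.hd
  have hnR : (n : ℝ) = 2 * m := by rw [hn]; push_cast; ring
  have h := (cnt_telescope P (K₁ := M) (ρ := c + 2) (by
      rw [rsum_matching hM]; have := P.hn; nlinarith) (by linarith) m ⊥ bot_le (by
      rw [rsum_bot, rsum_matching hM, hnR]; ring) (fun x y z h1 _ h2 _ =>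
          unique_of_matching hM h1 h2)
      (fun x y _ _ => by simp [res, ind_bot])).2
  rw [rsum_matching hM, expo_bot P, expo_matching P hM] at h
  have e1 : oddProd ((c + 2) * m) = oddProd ((c + 1) * m) *
      ∏ l ∈ range m, ((n : ℝ) * ((c : ℝ) + 2 - 1) + 2 * l + 1) := by
    rw [show (c + 2) * m = (c + 1) * m + m by ring, oddProd_add]
    congr 1
    exact prod_congr rfl fun i _ => by rw [hnR]; push_cast; ring
  have e2 : Real.exp (((c:ℝ) + 2 - 1) / 2 + (c + 2 - 1) ^ 2 / 4) = Real.exp (1 / 4) *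
      Real.exp (((c:ℝ) + 2 - 2) ^ 2 / 4 + (c + 2 - 2) + 1 / 2) := by
    rw [← Real.exp_add]; congr 1; ring
  rw [e2] at h
  have h3 := mul_le_mul_of_nonneg_right h (oddProd_pos ((c + 1) * m)).le
  have hE := Real.exp_pos (((c:ℝ) + 2 - 2) ^ 2 / 4 + (c + 2 - 2) + 1 / 2)
  refine le_of_mul_le_mul_right ?_ hE
  rw [e1]
  calc _ = _ := by ring
    _ ≤ _ := h3
    _ = _ := by ring

lemma cnt_sup_le {m c j : ℕ} (hn : n = 2 * m) (P : Params n (c + 2) θ)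
    (hM : ∀ x, ∑ y, ind M x y = 1) (hM' : ∀ x, ∑ y, ind M' x y = 1) (hjm : j ≤ m)
    (hj : ∑ x, ∑ y, ind M x y * ind M' x y = 2 * j) {p : ℝ}
    (hp : p = c * (c + 1) / (c + j / m)) :
    cnt (c + 2) (M ⊔ M') * oddProd ((c + 1) * m) ≤
      ((1 + 10 ^ 6 * θ ^ 2) * (c + 1 : ℝ) ^ 2) ^ (m - j) * oddProd (c * m + j) *
        Real.exp (1 - (c + 2 - p) ^ 2 / 4) * cnt (c + 2) M := by
  have hd := P.hd
  have hnR : (n : ℝ) = 2 * m := by rw [hn]; push_cast; ring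
  have hm : (0:ℝ) < m := by have := P.n_pos; linarith
  have hsup := rsum_sup (d := (c:ℝ) + 2) hM hM'
  rw [hj] at hsup
  have h := (cnt_telescope P (K₁ := M ⊔ M') (ρ := c + 1) (by
      rw [hsup]; have := P.hn; have : (0:ℝ) ≤ j := by positivity
      nlinarith) (by linarith) (m - j) M le_sup_left (by
      rw [hsup, rsum_matching hM, hnR, Nat.cast_sub hjm]; ring)
      (fun x y z h1 h1' h2 h2' => unique_of_matching hM' (h1.resolve_left h1')
          (h2.resolve_left h2'))
      (fun x y _ _ => by rw [res_matching hM]; ring)).1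
  rw [hsup, expo_matching P hM, expo_sup hM hM' P (t := j / m) (c := c) (p := p) (by positivity)
    (by rw [hj, hnR]; field_simp) (by ring) hp] at h
  have e1 : oddProd ((c + 1) * m) = oddProd (c * m + j) *
      ∏ l ∈ range (m - j), ((n : ℝ) * ((c : ℝ) + 2 - 2) + 2 * j + 2 * l + 1) := by
    rw [show (c + 1) * m = (c * m + j) + (m - j) by rw [add_mul, one_mul]; omega, oddProd_add]
    congr 1
    exact prod_congr rfl fun i _ => by rw [hnR]; push_cast; ring
  have e2 : Real.exp (((c:ℝ) + 2 - 2) ^ 2 / 4 + (c + 2 - 2) + 1 / 2) =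
      Real.exp (1 - (c + 2 - p) ^ 2 / 4) *
      Real.exp ((c:ℝ) + (c + 1) ^ 2 / 2 - (c + 2) ^ 2 / 4 + (c + 2 - p) ^ 2 / 4) := by
    rw [← Real.exp_add]; congr 1; ring
  rw [e2] at h
  have h3 := mul_le_mul_of_nonneg_right h (oddProd_pos (c * m + j)).le
  have hE := Real.exp_pos ((c:ℝ) + (c + 1) ^ 2 / 2 - (c + 2) ^ 2 / 4 + (c + 2 - p) ^ 2 / 4)
  refine le_of_mul_le_mul_right ?_ hE
  rw [e1]
  calc _ = _ := by ring
    _ ≤ _ := h3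
    _ = _ := by ring

/-- Upper bound for the ratio of the second and the squared first moment of the number of perfect
matchings. -/
noncomputable def momentRatio (m c : ℕ) (ε : ℝ) : ℝ :=
  (∑ j ∈ range (m + 1), (m.choose j) * (((1 + ε) * (c + 1 : ℝ) ^ 2) ^ (m - j) *
      oddProd (c * m + j) *
        Real.exp (3 / 4 - (c + 2 - c * (c + 1) / (c + j / m)) ^ 2 / 4)) * derange (m - j)) *
    oddProd ((c + 2) * m) /
    (oddProd m * oddProd ((c + 1) * m) ^ 2 * ((1 - ε) * (c + 2 : ℝ) ^ 2) ^ m)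

lemma sum_cnt_sup_le {m c : ℕ} (hn : n = 2 * m) (P : Params n (c + 2) θ) :
    (∑ M ∈ fam 1 (⊥ : SimpleGraph (Fin n)), ∑ M' ∈ fam 1 (⊥ : SimpleGraph (Fin n)),
      cnt (c + 2) (M ⊔ M')) * cnt (c + 2) (⊥ : SimpleGraph (Fin n)) ≤
    momentRatio m c (10 ^ 6 * θ ^ 2) * (∑ M ∈ fam 1 (⊥ : SimpleGraph (Fin n)), cnt (c + 2) M)
        ^ 2 := by
  classical
  set ε := 10 ^ 6 * θ ^ 2 with hε
  have hε1 : 0 < 1 - ε := by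
    have := P.θ_le; have := P.θ_pos; rw [hε]; nlinarith
  set D := ((1 - ε) * (c + 2 : ℝ) ^ 2) ^ m with hD
  have hD0 : 0 < D := by positivity
  have hx := oddProd_pos ((c + 1) * m)
  have hdm := oddProd_pos ((c + 2) * m)
  have hom := oddProd_pos m
  set A := ∑ j ∈ range (m + 1), (m.choose j) * (((1 + ε) * (c + 1 : ℝ) ^ 2) ^ (m - j) *
    oddProd (c * m + j) * Real.exp (3 / 4 - (c + 2 - c * (c + 1) / (c + j / m)) ^ 2 / 4)) *
    derange (m - j) with hA
  set S := ∑ M ∈ fam 1 (⊥ : SimpleGraph (Fin n)), cnt (c + 2) M with hS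
  set N := cnt (c + 2) (⊥ : SimpleGraph (Fin n)) with hN
  have h1 : ∀ M ∈ fam 1 (⊥ : SimpleGraph (Fin n)),
      (∑ M' ∈ fam 1 (⊥ : SimpleGraph (Fin n)), cnt (c + 2) (M ⊔ M')) * oddProd ((c + 1) * m) ≤
        A * Real.exp (1 / 4) * cnt (c + 2) M := fun M hM => by
    rw [mem_matching] at hM
    rw [hA, ← sum_matchings_apply hn hM (fun j => ((1 + ε) * (c + 1 : ℝ) ^ 2) ^ (m - j) *
      oddProd (c * m + j) * Real.exp (3 / 4 - (c + 2 - c * (c + 1) / (c + j / m)) ^ 2 / 4)),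
      sum_mul, sum_mul, sum_mul]
    refine sum_le_sum fun M' hM' => ?_
    rw [mem_matching] at hM'
    have hjm : #(M.edgeFinset ∩ M'.edgeFinset) ≤ m :=
      (card_le_card inter_subset_left).trans (card_edges_matching hn hM).le
    refine (cnt_sup_le hn P hM hM' hjm ?_ rfl).trans (le_of_eq ?_)
    · simp_rw [← ind_inf]
      rw [sum_ind_eq_card]
      congr 3
      ext e
      simp
    · rw [mul_assoc _ (Real.exp _) (Real.exp _), ← Real.exp_add]
      congr 3
      ring
  have h2 : D * oddProd ((c + 1) * m) * Real.exp (1 / 4) * N * oddProd m ≤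
      S * oddProd ((c + 2) * m) := by
    rw [hS, sum_mul, ← card_matchings hn, cnt_eq_card, mul_comm, ← nsmul_eq_mul]
    exact card_nsmul_le_sum _ _ _ fun M hM => cnt_matching_ge hn P (mem_matching.1 hM)
  have h3 : (∑ M ∈ fam 1 (⊥ : SimpleGraph (Fin n)), ∑ M' ∈ fam 1 (⊥ : SimpleGraph (Fin n)),
      cnt (c + 2) (M ⊔ M')) * oddProd ((c + 1) * m) ≤ A * Real.exp (1 / 4) * S := by
    rw [sum_mul, hS, mul_sum]
    exact sum_le_sum h1
  set T := ∑ M ∈ fam 1 (⊥ : SimpleGraph (Fin n)), ∑ M' ∈ fam 1 (⊥ : SimpleGraph (Fin n)),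
      cnt (c + 2) (M ⊔ M') with hT
  have hT0 : 0 ≤ T := sum_nonneg fun M _ => sum_nonneg fun M' _ => cnt_nonneg
  have hS0 : 0 ≤ S := sum_nonneg fun M _ => cnt_nonneg
  have hN0 : 0 ≤ N := cnt_nonneg
  have hAe : 0 ≤ A * Real.exp (1 / 4) * S := (mul_nonneg hT0 hx.le).trans h3
  have h4 := mul_le_mul h3 h2 (by positivity) hAe
  rw [momentRatio, div_mul_eq_mul_div, le_div_iff₀ (by positivity)]
  refine le_of_mul_le_mul_right ?_ (Real.exp_pos (1 / 4))
  calc _ = _ := by ring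
    _ ≤ _ := h4
    _ = _ := by ring

end

section

/-! ### Asymptotics of the numbers of matchings -/

lemma choose_mul_oddProd {k i : ℕ} (hik : i ≤ k) :
    (k.choose i) * oddProd (k - i) * (i.factorial * 2 ^ i) *
      ∏ l ∈ range i, (2 * k - 2 * l - 1 : ℝ) =
      oddProd k * ∏ l ∈ range i, (2 * k - 2 * l : ℝ) := by
  induction i with
  | zero => simp
  | succ i ih =>
    have ih := ih (by omega)
    have h1 : ((k.choose (i + 1) : ℕ) : ℝ) * (i + 1) = k.choose i * (k - i) := by
      have := Nat.choose_succ_right_eq k i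
      rw [← Nat.cast_sub (by omega)]
      exact_mod_cast this
    have h2 : oddProd (k - i) = oddProd (k - (i + 1)) * (2 * k - 2 * i - 1) := by
      rw [show k - i = k - (i + 1) + 1 by omega, oddProd_succ, Nat.cast_sub hik]
      push_cast; ring
    rw [h2] at ih
    rw [prod_range_succ, prod_range_succ, Nat.factorial_succ, pow_succ]
    push_cast
    calc _ = (((k.choose (i + 1) : ℕ) : ℝ) * (i + 1)) * oddProd (k - (i + 1)) *
          (i.factorial * 2 ^ i) * 2 * ((∏ l ∈ range i, (2 * k - 2 * l - 1 : ℝ)) *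
          (2 * k - 2 * i - 1)) := by ring
      _ = (k.choose i * (oddProd (k - (i + 1)) * (2 * k - 2 * i - 1)) * (i.factorial * 2 ^ i) *
          ∏ l ∈ range i, (2 * k - 2 * l - 1 : ℝ)) * (2 * k - 2 * i) := by rw [h1]; ring
      _ = _ := by rw [ih]; ring

/-- The relative weight in the inclusion-exclusion formula for `derange`. -/
noncomputable def dratio (k i : ℕ) : ℝ := ∏ l ∈ range i, ((2 * k - 2 * l : ℝ) / (2 * k - 2 * l - 1))

lemma choose_mul_oddProd' {k i : ℕ} (hik : i ≤ k) :
    (k.choose i) * oddProd (k - i) = oddProd k * dratio k i / (i.factorial * 2 ^ i) := by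
  have h := choose_mul_oddProd hik
  have hp : 0 < ∏ l ∈ range i, (2 * k - 2 * l - 1 : ℝ) := prod_pos fun l hl => by
    have : (l + 1 : ℝ) ≤ k := by exact_mod_cast (mem_range.1 hl).trans_le hik
    linarith
  rw [dratio, prod_div_distrib, ← mul_div_assoc, div_div, eq_div_iff (by positivity)]
  linarith

lemma dratio_bounds {k i : ℕ} (hik : i ≤ k) :
    1 ≤ dratio k i ∧ dratio k i ≤ 2 ^ i ∧ k * (dratio k i - 1) ≤ i * 2 ^ i := by
  induction i with
  | zero => simp [dratio]
  | succ i ih =>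
    obtain ⟨h1, h2, h3⟩ := ih (by omega)
    have hk : (i + 1 : ℝ) ≤ k := by exact_mod_cast hik
    have hi : (0:ℝ) ≤ i := by positivity
    have hq : (0:ℝ) < 2 * k - 2 * i - 1 := by linarith
    have e : dratio k (i + 1) = dratio k i * (1 + 1 / (2 * k - 2 * i - 1)) := by
      rw [dratio, dratio, prod_range_succ]
      congr 1
      rw [div_eq_iff hq.ne', add_mul, one_div_mul_cancel hq.ne']
      ring
    have hle : 1 / (2 * k - 2 * i - 1 : ℝ) ≤ 1 := by rw [div_le_one hq]; linarith
    have hpos : 0 < 1 / (2 * k - 2 * i - 1 : ℝ) := by positivity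
    have hk' : k * (1 / (2 * k - 2 * i - 1 : ℝ)) ≤ i + 1 := by
      rw [mul_one_div, div_le_iff₀ hq]; nlinarith
    rw [e]
    refine ⟨?_, ?_, ?_⟩
    · nlinarith
    · rw [pow_succ]; nlinarith
    · have : dratio k i * (k * (1 / (2 * k - 2 * i - 1 : ℝ))) ≤ 2 ^ i * (i + 1) :=
        mul_le_mul h2 hk' (by positivity) (by positivity)
      rw [pow_succ]
      push_cast
      have : (0:ℝ) ≤ i * 2 ^ i := by positivity
      have : (0:ℝ) ≤ 2 ^ i := by positivity
      nlinarith

lemma derange_le (k : ℕ) : derange k ≤ oddProd k * (Real.exp (-(1 / 2)) + 10 / (k + 1)) := by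
  rcases Nat.eq_zero_or_pos k with rfl | hk
  · have := Real.exp_pos (-(1 / 2))
    simp [derange, oddProd] at *
    linarith
  have hkR : (1:ℝ) ≤ k := by exact_mod_cast hk
  have h1 : derange k = oddProd k * ∑ i ∈ range (k + 1),
      ((-(1/2)) ^ i / i.factorial + (-1) ^ i * ((dratio k i - 1) / (i.factorial * 2 ^ i)) : ℝ) := by
    rw [derange, mul_sum]
    refine sum_congr rfl fun i hi => ?_
    rw [mul_assoc, choose_mul_oddProd' (by simpa [Nat.lt_succ_iff] using hi),
      show (-(1/2) : ℝ) = (-1) / 2 by norm_num, div_pow]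
    field_simp
    ring
  rw [h1]
  refine mul_le_mul_of_nonneg_left ?_ (oddProd_pos k).le
  rw [sum_add_distrib]
  have h2 := Real.exp_bound (x := -(1/2)) (by norm_num [abs_of_nonneg]) (n := k + 1) (by omega)
  have h3 : |(-(1/2) : ℝ)| ^ (k + 1) * ((k + 1).succ / ((k + 1).factorial * (k + 1 : ℕ))) ≤
      2 / (k + 1) := by
    have e1 : |(-(1/2) : ℝ)| ^ (k + 1) ≤ 1 := pow_le_one₀ (abs_nonneg _)
        (by norm_num [abs_of_nonneg])
    have e2 : ((k + 1).succ / ((k + 1).factorial * (k + 1 : ℕ)) : ℝ) ≤ 2 / (k + 1) := by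
      have : (k + 1 : ℝ) ≤ (k+1).factorial := by exact_mod_cast (k+1).self_le_factorial
      push_cast
      rw [div_le_div_iff₀ (by positivity) (by positivity)]
      have : (0:ℝ) ≤ ((k+1).factorial - (k + 1)) * (k + 1) := mul_nonneg (by linarith)
          (by positivity)
      nlinarith
    calc _ ≤ 1 * (2 / (k + 1 : ℝ)) := mul_le_mul e1 e2 (by positivity) (by positivity)
      _ = _ := one_mul _
  have h4 : ∑ i ∈ range (k + 1), (-1) ^ i * ((dratio k i - 1) / (i.factorial * 2 ^ i)) ≤
      ∑ i ∈ range (k + 1), (1 / k : ℝ) * (i / i.factorial) := by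
    refine sum_le_sum fun i hi => ?_
    obtain ⟨e1, -, e3⟩ := dratio_bounds (k := k) (i := i) (by simpa [Nat.lt_succ_iff] using hi)
    have e0 : 0 ≤ (dratio k i - 1) / (i.factorial * 2 ^ i) := div_nonneg (by linarith)
        (by positivity)
    calc _ ≤ 1 * ((dratio k i - 1) / (i.factorial * 2 ^ i)) := by
          refine mul_le_mul_of_nonneg_right ?_ e0
          exact (le_abs_self _).trans (by simp)
      _ ≤ _ := by
          rw [one_mul, div_le_iff₀ (by positivity)]
          calc _ ≤ i * 2 ^ i / (k:ℝ) := by rw [le_div_iff₀ (by linarith)]; linarith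
            _ = _ := by field_simp
  have h5 : ∑ i ∈ range (k + 1), ((i : ℝ) / i.factorial) ≤ 3 := by
    rw [sum_range_succ']
    have : ∀ i ∈ range k, (((i + 1 : ℕ) : ℝ) / (i + 1).factorial) = 1 ^ i / i.factorial :=
      fun i _ => by rw [Nat.factorial_succ]; push_cast; field_simp; simp
    rw [sum_congr rfl this]
    have := Real.sum_le_exp_of_nonneg (x := 1) (by norm_num) k
    have := Real.exp_one_lt_d9
    simp at *
    linarith
  rw [← mul_sum] at h4
  have h6 : (1 / k : ℝ) * ∑ i ∈ range (k + 1), ((i : ℝ) / i.factorial) ≤ 6 / (k + 1) := by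
    calc _ ≤ (1 / k : ℝ) * 3 := mul_le_mul_of_nonneg_left h5 (by positivity)
      _ ≤ _ := by
        rw [one_div_mul_eq_div, div_le_div_iff₀ (by positivity) (by positivity)]; linarith
  have h7 := (abs_le.1 h2).1
  have h8 : (10 : ℝ) / (k + 1) = 2 / (k + 1) + 6 / (k + 1) + 2 / (k + 1) := by ring
  have h9 : (0:ℝ) ≤ 2 / (k + 1) := by positivity
  linarith

lemma dratio_le_sqrt {m j : ℕ} (hj : j ≤ m) :
    dratio m j ≤ Real.sqrt ((m + 1 / 4) / (m - j + 1 / 4)) := by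
  induction j with
  | zero =>
    simp [dratio]
    rw [div_self (by positivity)]
  | succ j ih =>
    have ih := ih (by omega)
    have hk : (j + 1 : ℝ) ≤ m := by exact_mod_cast hj
    rw [dratio, prod_range_succ, ← dratio]
    set k : ℝ := m - j with hk'
    have hk1 : 1 ≤ k := by linarith
    have e1 : (2 * m - 2 * j : ℝ) / (2 * m - 2 * j - 1) ≤
        Real.sqrt ((k + 1 / 4) / (k - 3 / 4)) := by
      rw [show (2 * m - 2 * j : ℝ) = 2 * k by rw [hk']; ring]
      refine Real.le_sqrt_of_sq_le ?_
      rw [div_pow, div_le_div_iff₀ (by nlinarith) (by linarith)]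
      nlinarith
    have h0 : (0:ℝ) ≤ (2 * m - 2 * j : ℝ) / (2 * m - 2 * j - 1) :=
      div_nonneg (by linarith) (by linarith)
    calc _ ≤ _ := mul_le_mul ih e1 h0 (Real.sqrt_nonneg _)
      _ = _ := by
        rw [← Real.sqrt_mul (by positivity)]
        congr 1
        push_cast
        rw [show (m - (j + 1) + 1 / 4 : ℝ) = k - 3 / 4 by rw [hk']; ring]
        have : k - 3 / 4 ≠ 0 := by linarith
        have : k + 1 / 4 ≠ 0 := by linarith
        field_simp

end

section

/-! ### The negative binomial series -/

/-- The terms of the negative binomial series. -/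
noncomputable def negBin (b y : ℝ) (j : ℕ) : ℝ := (∏ l ∈ range j, (b + l)) / j.factorial * y ^ j

lemma negBin_nonneg {b y : ℝ} (hb : 0 ≤ b) (hy : 0 ≤ y) (j : ℕ) : 0 ≤ negBin b y j :=
  mul_nonneg (div_nonneg (prod_nonneg fun l _ => by positivity) (by positivity)) (by positivity)

lemma ring_choose_eq (b : ℝ) (j : ℕ) :
    Ring.choose (b + j - 1) j = (∏ l ∈ range j, (b + l)) / j.factorial := by
  rw [Ring.choose, eq_div_iff (by positivity), mul_comm, ← nsmul_eq_mul,
    Ring.factorial_nsmul_multichoose_eq_ascPochhammer, show b + j - 1 - j + 1 = b by ring,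
    Polynomial.ascPochhammer_smeval_eq_eval]
  induction j with
  | zero => simp
  | succ j ih => rw [ascPochhammer_succ_eval, ih, prod_range_succ]

lemma hasSum_negBin {b y : ℝ} (hy0 : 0 ≤ y) (hy : y < 1) :
    HasSum (negBin b y) (1 / (1 - y) ^ b) := by
  have h := (Real.one_div_one_sub_rpow_hasFPowerSeriesOnBall_zero b).hasSum (y := y) (by
    simp [enorm_eq_nnnorm]
    rw [← NNReal.coe_lt_coe]
    simpa [abs_of_nonneg hy0])
  simp only [zero_add] at h
  refine h.congr_fun fun j => ?_
  rw [negBin, FormalMultilinearSeries.ofScalars_apply_eq, ring_choose_eq]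
  simp

lemma succ_mul_negBin (b y : ℝ) (j : ℕ) :
    ((j + 1 : ℕ) : ℝ) * negBin b y (j + 1) = b * y * negBin (b + 1) y j := by
  rw [negBin, negBin, prod_range_succ', Nat.factorial_succ, pow_succ]
  have : ∀ l ∈ range j, b + ((l + 1 : ℕ) : ℝ) = b + 1 + l := fun l _ => by push_cast; ring
  rw [prod_congr rfl this]
  push_cast
  field_simp
  ring

lemma hasSum_mul_negBin {b y : ℝ} (hy0 : 0 ≤ y) (hy : y < 1) :
    HasSum (fun j : ℕ => j * negBin b y j) (b * y / (1 - y) * (1 / (1 - y) ^ b)) := by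
  rw [← hasSum_nat_add_iff' 1]
  simp only [succ_mul_negBin]
  have h := (hasSum_negBin (b := b + 1) hy0 hy).mul_left (b * y)
  rw [Real.rpow_add (by linarith), Real.rpow_one] at h
  have h1 : (1 - y) ^ b ≠ 0 := (Real.rpow_pos_of_pos (by linarith) b).ne'
  have h2 : 1 - y ≠ 0 := by linarith
  refine (congrArg (HasSum _) ?_).mp h
  simp
  field_simp

lemma hasSum_mul_mul_negBin {b y : ℝ} (hy0 : 0 ≤ y) (hy : y < 1) :
    HasSum (fun j : ℕ => j * (j - 1) * negBin b y j)
      (b * (b + 1) * (y / (1 - y)) ^ 2 * (1 / (1 - y) ^ b)) := by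
  rw [← hasSum_nat_add_iff' 1]
  have e : ∀ j : ℕ, ((j + 1 : ℕ) : ℝ) * (((j + 1 : ℕ) : ℝ) - 1) * negBin b y (j + 1) =
      b * y * (j * negBin (b + 1) y j) := fun j => by
    rw [mul_right_comm, succ_mul_negBin]; push_cast; ring
  simp only [e]
  have h := (hasSum_mul_negBin (b := b + 1) hy0 hy).mul_left (b * y)
  rw [Real.rpow_add (by linarith), Real.rpow_one] at h
  have h1 : (1 - y) ^ b ≠ 0 := (Real.rpow_pos_of_pos (by linarith) b).ne'
  have h2 : 1 - y ≠ 0 := by linarith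
  refine (congrArg (HasSum _) ?_).mp h
  simp
  field_simp

/-- Second moment of the negative binomial series around `μ`. -/
lemma hasSum_sq_negBin {b y : ℝ} (hy0 : 0 ≤ y) (hy : y < 1) (μ : ℝ) :
    HasSum (fun j : ℕ => (j - μ) ^ 2 * negBin b y j)
      ((b * y / (1 - y) ^ 2 + (b * y / (1 - y) - μ) ^ 2) * (1 / (1 - y) ^ b)) := by
  have h := ((hasSum_mul_mul_negBin (b := b) hy0 hy).add
    ((hasSum_mul_negBin (b := b) hy0 hy).mul_left (1 - 2 * μ))).add
    ((hasSum_negBin (b := b) hy0 hy).mul_left (μ ^ 2))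
  have h1 : 1 - y ≠ 0 := by linarith
  convert h using 1
  · ext j; ring
  · field_simp
    ring

end

section

/-! ### Stirling-type comparison of products of odd numbers -/

/-- Logarithmic deviation of `oddProd k` from `(2 * k / e) ^ k`. -/
noncomputable def oddDev (k : ℕ) : ℝ := Real.log (oddProd k) - k * Real.log (2 * k) + k

lemma oddProd_eq_exp (k : ℕ) : oddProd k = Real.exp (oddDev k + k * Real.log (2 * k) - k) := by
  rw [oddDev, show Real.log (oddProd k) - k * Real.log (2 * k) + k + k * Real.log (2 * k) - k =
    Real.log (oddProd k) by ring, Real.exp_log (oddProd_pos k)]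

lemma abs_oddDev_succ_sub {k : ℕ} (hk : 2 ≤ k) : |oddDev (k + 1) - oddDev k| ≤ 4 / k ^ 2 := by
  have hkR : (2:ℝ) ≤ k := by exact_mod_cast hk
  have hk0 : (k:ℝ) ≠ 0 := by linarith
  have e1 : oddDev (k + 1) - oddDev k =
      1 + Real.log (1 - 1 / (2 * (k + 1))) - k * Real.log (1 - -(1 / k)) := by
    rw [show (1 - 1 / (2 * (k + 1)) : ℝ) = (2 * k + 1) / (2 * (k + 1)) by field_simp; ring,
      show (1 - -(1 / k) : ℝ) = 2 * (k + 1) / (2 * k) by field_simp; ring,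
      Real.log_div (by positivity) (by positivity), Real.log_div (by positivity) (by positivity),
      oddDev, oddDev, oddProd_succ, Real.log_mul (oddProd_pos k).ne' (by positivity)]
    push_cast
    ring
  have a1 : |(-(1 / k) : ℝ)| = 1 / k := by rw [abs_neg, abs_of_nonneg (by positivity)]
  have a2 : |(1 / (2 * (k + 1)) : ℝ)| = 1 / (2 * (k + 1)) := abs_of_nonneg (by positivity)
  have i1 : (1 / k : ℝ) ≤ 1 / 2 := one_div_le_one_div_of_le (by norm_num) hkR
  have i2 : (1 / (2 * (k + 1)) : ℝ) ≤ 1 / (2 * k) :=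
    one_div_le_one_div_of_le (by linarith) (by linarith)
  have i3 : (1 / (2 * k) : ℝ) = 1 / k / 2 := by field_simp
  have l1 := Real.abs_log_sub_add_sum_range_le (x := -(1 / k)) (by rw [a1]; linarith) 2
  have l2 := Real.abs_log_sub_add_sum_range_le (x := (1 / (2 * (k + 1)) : ℝ))
    (by rw [a2]; linarith) 1
  rw [a1] at l1
  rw [a2] at l2
  simp only [sum_range_succ, sum_range_zero, zero_add] at l1 l2
  norm_num at l1 l2
  simp only [← inv_pow] at l1
  set s : ℝ := (k:ℝ)⁻¹ with hs
  have hks : k * s = 1 := mul_inv_cancel₀ hk0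
  have hs0 : 0 < s := by positivity
  have hs2 : s ≤ 1 / 2 := by simpa [hs] using i1
  set w : ℝ := ((k:ℝ) + 1)⁻¹ with hw
  have hw0 : 0 < w := by positivity
  have hws : w ≤ s := by
    rw [hw, hs]; exact inv_anti₀ (by linarith) (by linarith)
  have hsw : s - w ≤ s ^ 2 := by
    rw [show s - w = s * w by rw [hs, hw]; field_simp; ring, pow_two]
    exact mul_le_mul_of_nonneg_left hws hs0.le
  have b1 : s ^ 3 / (1 - s) ≤ 2 * s ^ 3 := by
    rw [div_le_iff₀ (by linarith)]
    have : 0 < s ^ 3 := by positivity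
    nlinarith
  have b2 : (w * (1 / 2)) ^ 2 / (1 - w * (1 / 2)) ≤ s ^ 2 / 2 := by
    rw [div_le_iff₀ (by linarith)]
    have : w ^ 2 ≤ s ^ 2 := pow_le_pow_left₀ hw0.le hws 2
    nlinarith [sq_nonneg s]
  have l1' := abs_le.1 (l1.trans b1)
  have l2' := abs_le.1 (l2.trans b2)
  rw [e1]
  have g1 : (1 - 1 / (2 * (k + 1)) : ℝ) = 1 - w * (1 / 2) := by rw [hw]; field_simp
  have g2 : (1 - -(1 / k) : ℝ) = 1 + s := by rw [hs]; ring
  have g3 : (4 / k ^ 2 : ℝ) = 4 * s ^ 2 := by rw [hs]; field_simp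
  rw [g1, g2, g3]
  set L1 := Real.log (1 + s)
  set L2 := Real.log (1 - w * (1 / 2))
  have m1 : k * L1 ≤ 1 - s / 2 + 2 * s ^ 2 := by
    have h := mul_le_mul_of_nonneg_left l1'.2 (by linarith : (0:ℝ) ≤ k)
    have e : (k:ℝ) * (2 * s ^ 3) = 2 * s ^ 2 * (k * s) := by ring
    have e' : (k:ℝ) * (-s + s ^ 2 / 2 + L1) = -(k * s) + (k * s) * s / 2 + k * L1 := by ring
    rw [e, e', hks] at h
    linarith
  have m2 : 1 - s / 2 - 2 * s ^ 2 ≤ k * L1 := by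
    have h := mul_le_mul_of_nonneg_left l1'.1 (by linarith : (0:ℝ) ≤ k)
    have e : (k:ℝ) * (-(2 * s ^ 3)) = -2 * s ^ 2 * (k * s) := by ring
    have e' : (k:ℝ) * (-s + s ^ 2 / 2 + L1) = -(k * s) + (k * s) * s / 2 + k * L1 := by ring
    rw [e, e', hks] at h
    linarith
  have := sq_nonneg s
  rw [abs_le]
  constructor <;> linarith [l2'.1, l2'.2]

lemma abs_oddDev_sub {a : ℕ} (ha : 2 ≤ a) (k : ℕ) :
    |oddDev (a + k) - oddDev a| ≤ 4 * k / a ^ 2 := by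
  have haR : (2:ℝ) ≤ a := by exact_mod_cast ha
  induction k with
  | zero => simp
  | succ k ih =>
    have h := abs_oddDev_succ_sub (k := a + k) (by omega)
    have h2 : (4 : ℝ) / ((a + k : ℕ) : ℝ) ^ 2 ≤ 4 / a ^ 2 := by
      gcongr
      linarith
    rw [← add_assoc, show oddDev (a + k + 1) - oddDev a =
      (oddDev (a + k + 1) - oddDev (a + k)) + (oddDev (a + k) - oddDev a) by ring]
    refine (abs_add_le _ _).trans ((add_le_add (h.trans h2) ih).trans (le_of_eq ?_))
    push_cast
    ring

lemma prefactor_le {m c : ℕ} (hm : 2 ≤ m) (hc : 1 ≤ c) :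
    (c + 1 : ℝ) ^ (2 * m) * oddProd (c * m) * oddProd ((c + 2) * m) /
      (oddProd ((c + 1) * m) ^ 2 * (c + 2 : ℝ) ^ (2 * m)) *
      (1 / (1 - 1 / (c + 1 : ℝ) ^ 2) ^ (c * m + 1 / 2 : ℝ)) ≤
    Real.exp (8 / m + Real.log (c + 1) - (Real.log c + Real.log (c + 2)) / 2) := by
  have hmR : (2:ℝ) ≤ m := by exact_mod_cast hm
  have hcR : (1:ℝ) ≤ c := by exact_mod_cast hc
  have e1 : ∀ (z : ℝ), 0 < z → z ^ (2 * m) = Real.exp (2 * m * Real.log z) := fun z hz => by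
    rw [← Real.rpow_natCast, Real.rpow_def_of_pos hz]; push_cast; congr 1; ring
  have e2 : 1 - 1 / (c + 1 : ℝ) ^ 2 = c * (c + 2) / (c + 1) ^ 2 := by field_simp; ring
  have e3 : Real.log (1 - 1 / (c + 1 : ℝ) ^ 2) =
      Real.log c + Real.log (c + 2) - 2 * Real.log (c + 1) := by
    rw [e2, Real.log_div (by positivity) (by positivity), Real.log_mul (by positivity)
        (by positivity),
      Real.log_pow]
    push_cast; ring
  have e4 : 0 < 1 - 1 / (c + 1 : ℝ) ^ 2 := by rw [e2]; positivity
  have e5 : ∀ k : ℕ, 0 < k → Real.log (2 * ((k * m : ℕ) : ℝ)) = Real.log (2 * m) + Real.log k :=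
    fun k hk => by
      rw [← Real.log_mul (by positivity) (by positivity)]; push_cast; congr 1; ring
  rw [e1 _ (by positivity), e1 _ (by positivity), Real.rpow_def_of_pos e4, e3,
      oddProd_eq_exp (c * m),
    oddProd_eq_exp ((c + 1) * m), oddProd_eq_exp ((c + 2) * m), e5 c (by omega),
    e5 (c + 1) (by omega), e5 (c + 2) (by omega), one_div (Real.exp _), ← Real.exp_neg,
    ← Real.exp_nat_mul, ← Real.exp_add, ← Real.exp_add, ← Real.exp_add, ← Real.exp_sub,
    ← Real.exp_add]
  apply Real.exp_le_exp.2
  have d1 := abs_oddDev_sub (a := c * m) (by nlinarith) m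
  have d2 := abs_oddDev_sub (a := (c + 1) * m) (by nlinarith) m
  rw [show c * m + m = (c + 1) * m by ring] at d1
  rw [show (c + 1) * m + m = (c + 2) * m by ring] at d2
  have b : ∀ k : ℕ, 1 ≤ k → (4 * m / ((k * m : ℕ) : ℝ) ^ 2) ≤ 4 / m := fun k hk => by
    have : (1:ℝ) ≤ k := by exact_mod_cast hk
    rw [div_le_div_iff₀ (by positivity) (by positivity)]
    push_cast
    have : (m:ℝ) ≤ k * m := by nlinarith
    nlinarith
  have d1' := (abs_le.1 (d1.trans (b c hc))).1
  have d2' := (abs_le.1 (d2.trans (b (c + 1) (by omega)))).2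
  push_cast
  have h8 : (8 / m : ℝ) = 4 / m + 4 / m := by ring
  rw [h8]
  set U0 := oddDev (c * m)
  set U1 := oddDev ((c + 1) * m)
  set U2 := oddDev ((c + 2) * m)
  have : U0 + U2 - 2 * U1 ≤ 4 / m + 4 / m := by linarith
  linarith

end

section

/-! ### The second moment ratio -/

/-- The exponent occurring in the ratio of counts for two matchings sharing a fraction `t` of their
edges. -/
noncomputable def overlapExp (c t : ℝ) : ℝ := 3 / 4 - (c + 2 - c * (c + 1) / (c + t)) ^ 2 / 4

lemma overlapExp_le (c t : ℝ) : overlapExp c t ≤ 3 / 4 := by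
  rw [overlapExp]; nlinarith [sq_nonneg (c + 2 - c * (c + 1) / (c + t))]

lemma overlapExp_typical {c : ℝ} (hc : 1 ≤ c) :
    overlapExp c (1 / (c + 2)) = 1 / 2 - 1 / (2 * (c + 1)) - 1 / (4 * (c + 1) ^ 2) := by
  have : c * (c + 1) / (c + 1 / (c + 2)) = (c + 1) - 1 / (c + 1) := by
    have : c + 1 / (c + 2) = (c + 1) ^ 2 / (c + 2) := by field_simp; ring
    rw [this]; field_simp; ring
  rw [overlapExp, this]
  field_simp
  ring

lemma overlapExp_sub_le {c s t : ℝ} (hc : 1 ≤ c) (hs0 : 0 ≤ s) (hs : s ≤ 1) (ht0 : 0 ≤ t)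
    (ht : t ≤ 1) : overlapExp c s ≤ overlapExp c t + 2 * |s - t| := by
  have hb : ∀ r : ℝ, 0 ≤ r → r ≤ 1 → 1 ≤ c + 2 - c * (c + 1) / (c + r) ∧
      c + 2 - c * (c + 1) / (c + r) ≤ 2 := fun r h0 h1 => by
    have e1 : c * (c + 1) / (c + r) ≤ c + 1 := by rw [div_le_iff₀ (by linarith)]; nlinarith
    have e2 : c ≤ c * (c + 1) / (c + r) := by rw [le_div_iff₀ (by linarith)]; nlinarith
    constructor <;> linarith
  have hp : |c * (c + 1) / (c + s) - c * (c + 1) / (c + t)| ≤ 2 * |s - t| := by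
    have : c * (c + 1) / (c + s) - c * (c + 1) / (c + t) =
        c * (c + 1) / ((c + s) * (c + t)) * (t - s) := by
      have : c + s ≠ 0 := by linarith
      have : c + t ≠ 0 := by linarith
      field_simp
      ring
    rw [this, abs_mul, abs_sub_comm t s]
    refine mul_le_mul_of_nonneg_right ?_ (abs_nonneg _)
    have h0 : 0 < (c + s) * (c + t) := by nlinarith
    rw [abs_of_nonneg (by positivity), div_le_iff₀ h0]
    have : c * c ≤ (c + s) * (c + t) := mul_le_mul (by linarith) (by linarith) (by linarith)
        (by linarith)
    nlinarith
  obtain ⟨a1, a2⟩ := hb s hs0 hs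
  obtain ⟨b1, b2⟩ := hb t ht0 ht
  rw [overlapExp, overlapExp]
  set A := c * (c + 1) / (c + s)
  set B := c * (c + 1) / (c + t)
  have h1 : (3 / 4 - (c + 2 - A) ^ 2 / 4) - (3 / 4 - (c + 2 - B) ^ 2 / 4) =
      (A - B) * ((c + 2 - A + (c + 2 - B)) / 4) := by ring
  have h2 : (A - B) * ((c + 2 - A + (c + 2 - B)) / 4) ≤ |A - B| * 1 :=
    mul_le_mul (le_abs_self _) (by linarith) (by linarith) (abs_nonneg _)
  linarith

lemma exp_le_one_add_mul_exp (z : ℝ) : Real.exp z ≤ 1 + z * Real.exp z := by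
  have h := Real.add_one_le_exp (-z)
  have h2 := mul_le_mul_of_nonneg_right h (Real.exp_pos z).le
  rw [← Real.exp_add, neg_add_cancel, Real.exp_zero] at h2
  linarith

lemma exp_neg_half_ge : (1 : ℝ) / 2 ≤ Real.exp (-(1 / 2)) := by
  have := Real.add_one_le_exp (-(1 / 2) : ℝ)
  linarith

lemma exp_two_mul_le {δ : ℝ} (h0 : 0 ≤ δ) (h1 : δ ≤ 1) : Real.exp (2 * δ) ≤ 1 + 15 * δ := by
  have h := exp_le_one_add_mul_exp (2 * δ)
  have h2 : Real.exp (2 * δ) ≤ 7.5 := by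
    refine (Real.exp_le_exp.2 (by linarith : 2 * δ ≤ 1 + 1)).trans ?_
    rw [Real.exp_add]
    have := Real.exp_one_lt_d9
    have := Real.exp_pos 1
    nlinarith
  nlinarith

set_option maxHeartbeats 1000000 in
lemma weight_le {m j c : ℕ} (hc : 1 ≤ c) (hm : 1 ≤ m) (hj : j ≤ m) :
    dratio m j * (Real.exp (-(1 / 2)) + 10 / ((m - j : ℕ) + 1)) * Real.exp (overlapExp c (j / m)) ≤
      Real.sqrt ((c + 2) / (c + 1)) * Real.exp (-(1 / 2)) * Real.exp (overlapExp c (1 / (c + 2))) *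
        (1 + 4000 / Real.sqrt m + 4000 * Real.sqrt m * ((j / m : ℝ) - 1 / (c + 2)) ^ 2) := by
  have hmR : (1:ℝ) ≤ m := by exact_mod_cast hm
  have hcR : (1:ℝ) ≤ c := by exact_mod_cast hc
  have hjR : (j:ℝ) ≤ m := by exact_mod_cast hj
  have hj0 : (0:ℝ) ≤ j := by positivity
  set s : ℝ := j / m with hs
  have hjs : (j:ℝ) = s * m := by rw [hs]; field_simp
  have hs0 : 0 ≤ s := by positivity
  have hs1 : s ≤ 1 := by rw [hs, div_le_one (by linarith)]; exact hjR
  set s0 : ℝ := 1 / (c + 2) with hs0'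
  have hs00 : 0 ≤ s0 := by positivity
  have hs03 : s0 ≤ 1 / 3 := one_div_le_one_div_of_le (by norm_num) (by linarith)
  set δ := |s - s0| with hδ
  have hδ0 : 0 ≤ δ := abs_nonneg _
  have hδ1 : δ ≤ 1 := abs_le.2 ⟨by linarith, by linarith⟩
  have hδ2 : (s - s0) ^ 2 = δ ^ 2 := (sq_abs _).symm
  rw [hδ2, Nat.cast_sub hj]
  set r := Real.sqrt m with hr
  have hr1 : 1 ≤ r := Real.one_le_sqrt.2 hmR
  have hrr : r * r = m := Real.mul_self_sqrt (by linarith)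
  have hA1 : (1:ℝ) ≤ Real.sqrt ((c + 2) / (c + 1)) :=
    Real.one_le_sqrt.2 (by rw [one_le_div (by linarith)]; linarith)
  have hE := exp_neg_half_ge
  have hE1 : Real.exp (-(1 / 2)) ≤ 1 := Real.exp_le_one_iff.2 (by norm_num)
  have hdr := dratio_le_sqrt hj
  have hdr0 : 0 ≤ dratio m j := zero_le_one.trans (dratio_bounds hj).1
  set A := Real.sqrt (((c:ℝ) + 2) / (c + 1))
  set E := Real.exp (-(1 / 2))
  by_cases hcase : s ≤ 2 / 3
  · have h1 : Real.sqrt ((m + 1 / 4) / (m - j + 1 / 4)) ≤ A * (1 + 3 * δ) := by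
      have e1 : ((m:ℝ) + 1 / 4) / (m - j + 1 / 4) ≤ ((c + 2) / (c + 1)) * (1 + 3 * δ) := by
        have e2 : ((c:ℝ) + 2) / (c + 1) = 1 / (1 - s0) := by
          rw [hs0', one_sub_div (by positivity), one_div_div]; congr 1; ring
        have e3 : ((m:ℝ) + 1 / 4) / (m - j + 1 / 4) ≤ 1 / (1 - s) := by
          rw [div_le_div_iff₀ (by linarith) (by linarith), hjs]; nlinarith
        rw [e2]
        refine e3.trans ?_
        rw [div_mul_eq_mul_div, one_mul, div_le_div_iff₀ (by linarith) (by linarith)]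
        have := le_abs_self (s - s0)
        nlinarith
      refine (Real.sqrt_le_sqrt e1).trans ?_
      rw [Real.sqrt_mul (by positivity)]
      refine mul_le_mul_of_nonneg_left ?_ (Real.sqrt_nonneg _)
      rw [Real.sqrt_le_left (by linarith)]
      nlinarith
    have h2 : E + 10 / ((m:ℝ) - j + 1) ≤ E * (1 + 60 / m) := by
      have : (10:ℝ) / (m - j + 1) ≤ 30 / m := by
        rw [div_le_div_iff₀ (by linarith) (by linarith), hjs]; nlinarith
      have h3 : 1 / 2 * (60 / m : ℝ) ≤ E * (60 / m) := mul_le_mul_of_nonneg_right hE (by positivity)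
      have : (30:ℝ) / m = 1 / 2 * (60 / m) := by ring
      linarith
    have h3 : Real.exp (overlapExp c s) ≤ Real.exp (overlapExp c s0) * (1 + 15 * δ) := by
      refine (Real.exp_le_exp.2 (overlapExp_sub_le hcR hs0 hs1 hs00 (by linarith))).trans ?_
      rw [Real.exp_add]
      exact mul_le_mul_of_nonneg_left (exp_two_mul_le hδ0 hδ1) (Real.exp_pos _).le
    have h20 : 0 ≤ E + 10 / ((m:ℝ) - j + 1) :=
      add_nonneg (by linarith) (div_nonneg (by norm_num) (by linarith))
    have h4 := mul_le_mul (mul_le_mul (hdr.trans h1) h2 h20 (by positivity)) h3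
      (Real.exp_pos _).le (by positivity)
    refine h4.trans ?_
    have hpos : 0 ≤ A * E * Real.exp (overlapExp c s0) := by positivity
    refine le_trans (le_of_eq ?_) (mul_le_mul_of_nonneg_left
      (?_ : (1 + 3 * δ) * (1 + 60 / m) * (1 + 15 * δ) ≤ _) hpos)
    · ring
    · set w := 1 / r with hw
      have hwr : w * r = 1 := by rw [hw]; field_simp
      have hw0 : 0 < w := by positivity
      have hw1 : w ≤ 1 := by rw [hw, div_le_one (by linarith)]; exact hr1
      have e1 : (60 / m : ℝ) = 60 * w ^ 2 := by rw [← hrr, hw]; field_simp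
      have e2 : 4000 / r = 4000 * w := by rw [hw]; ring
      rw [e1, e2]
      have e3 : δ ≤ (w + r * δ ^ 2) / 2 := by
        have h : 0 ≤ r * (δ - w) ^ 2 := by positivity
        have : r * (δ - w) ^ 2 = r * δ ^ 2 - 2 * δ * (w * r) + w * (w * r) := by ring
        rw [this, hwr] at h
        linarith
      have e4 : w ^ 2 ≤ w := pow_le_of_le_one hw0.le hw1 (by norm_num)
      have e4' : δ ^ 2 ≤ δ := pow_le_of_le_one hδ0 hδ1 (by norm_num)
      have e4'' : δ * w ^ 2 ≤ δ * 1 := mul_le_mul_of_nonneg_left (e4.trans hw1) hδ0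
      have e5 : (1 + 3 * δ) * (1 + 15 * δ) ≤ 1 + 63 * δ := by linarith
      have e6 : (1 + 63 * δ) * (1 + 60 * w ^ 2) ≤ 1 + 63 * δ + 60 * w + 3780 * δ := by linarith
      have e7 : (1 + 3 * δ) * (1 + 15 * δ) * (1 + 60 * w ^ 2) ≤ (1 + 63 * δ) * (1 + 60 * w ^ 2) :=
        mul_le_mul_of_nonneg_right e5 (by positivity)
      have e8 : 0 ≤ r * δ ^ 2 := by positivity
      calc _ = (1 + 3 * δ) * (1 + 15 * δ) * (1 + 60 * w ^ 2) := by ring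
        _ ≤ _ := e7.trans e6
        _ ≤ _ := by linarith
  · push Not at hcase
    have hδ3 : 1 / 3 ≤ δ := by rw [hδ]; exact le_trans (by linarith) (le_abs_self _)
    have h1 : Real.sqrt ((m + 1 / 4) / (m - j + 1 / 4)) ≤ 3 * r := by
      rw [Real.sqrt_le_left (by linarith), div_le_iff₀ (by linarith)]
      nlinarith
    have h2 : E + 10 / ((m:ℝ) - j + 1) ≤ 11 := by
      have : (10:ℝ) / (m - j + 1) ≤ 10 := by
        rw [div_le_iff₀ (by linarith)]; nlinarith
      linarith
    have h3 : Real.exp (overlapExp c s) ≤ 3 := by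
      refine (Real.exp_le_exp.2 ((overlapExp_le c s).trans (by norm_num : (3:ℝ)/4 ≤ 1))).trans ?_
      have := Real.exp_one_lt_d9
      linarith
    have h20 : 0 ≤ E + 10 / ((m:ℝ) - j + 1) :=
      add_nonneg (by linarith) (div_nonneg (by norm_num) (by linarith))
    have h4 := mul_le_mul (mul_le_mul (hdr.trans h1) h2 h20 (by positivity)) h3
      (Real.exp_pos _).le (by positivity)
    refine h4.trans ?_
    have h5 : (1:ℝ) ≤ Real.exp (overlapExp c s0) := by
      apply Real.one_le_exp
      rw [hs0', overlapExp_typical hcR]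
      have e1 : 1 / (2 * ((c:ℝ) + 1)) ≤ 1 / 4 := one_div_le_one_div_of_le (by norm_num)
          (by linarith)
      have e2 : 1 / (4 * ((c:ℝ) + 1) ^ 2) ≤ 1 / 16 :=
        one_div_le_one_div_of_le (by norm_num) (by nlinarith)
      linarith
    have h6 : 1 / 2 ≤ A * E * Real.exp (overlapExp c s0) := by
      have : 1 * (1 / 2) * 1 ≤ A * E * Real.exp (overlapExp c s0) :=
        mul_le_mul (mul_le_mul hA1 hE (by norm_num) (by linarith)) h5 (by norm_num) (by positivity)
      linarith
    have h7 : 3 * r * 11 * 3 ≤ 1 / 2 * (1 + 4000 / r + 4000 * r * δ ^ 2) := by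
      have : 0 < 4000 / r := by positivity
      have : 1 / 9 ≤ δ ^ 2 := by nlinarith
      have : r * (1 / 9) ≤ r * δ ^ 2 := mul_le_mul_of_nonneg_left this (by linarith)
      linarith
    exact h7.trans (mul_le_mul_of_nonneg_right h6 (by positivity))

end

section

lemma sum_negBin_mul_weight_le {m c : ℕ} (hc : 1 ≤ c) (hm : 1 ≤ m) :
    ∑ j ∈ range (m + 1), negBin (c * m + 1 / 2) (1 / (c + 1 : ℝ) ^ 2) j *
      (1 + 4000 / Real.sqrt m + 4000 * Real.sqrt m * ((j / m : ℝ) - 1 / (c + 2)) ^ 2) ≤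
    1 / (1 - 1 / (c + 1 : ℝ) ^ 2) ^ (c * m + 1 / 2 : ℝ) * (1 + 16000 / Real.sqrt m) := by
  have hmR : (1:ℝ) ≤ m := by exact_mod_cast hm
  have hcR : (1:ℝ) ≤ c := by exact_mod_cast hc
  set y : ℝ := 1 / (c + 1 : ℝ) ^ 2 with hy
  set b : ℝ := c * m + 1 / 2 with hb
  have hb0 : 0 ≤ b := by positivity
  have hy0 : 0 ≤ y := by positivity
  have hy1 : y < 1 := by rw [hy, div_lt_one (by positivity)]; nlinarith
  set B := 1 / (1 - y) ^ b with hB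
  have hB0 : 0 ≤ B := by rw [hB]; exact div_nonneg zero_le_one (Real.rpow_nonneg (by linarith) _)
  set r := Real.sqrt m with hr
  have hr1 : 1 ≤ r := Real.one_le_sqrt.2 hmR
  have hrr : r * r = m := Real.mul_self_sqrt (by linarith)
  have h1 : ∑ j ∈ range (m + 1), negBin b y j ≤ B :=
    sum_le_hasSum _ (fun j _ => negBin_nonneg hb0 hy0 j) (hasSum_negBin hy0 hy1)
  have h2 : ∑ j ∈ range (m + 1), ((j:ℝ) - m / (c + 2)) ^ 2 * negBin b y j ≤ 3 * m * B := by
    refine (sum_le_hasSum _ (fun j _ => mul_nonneg (sq_nonneg _) (negBin_nonneg hb0 hy0 j))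
      (hasSum_sq_negBin hy0 hy1 _)).trans (mul_le_mul_of_nonneg_right ?_ hB0)
    have e1 : 1 - y = c * (c + 2) / (c + 1) ^ 2 := by rw [hy]; field_simp; ring
    have e2 : b * y / (1 - y) - m / (c + 2) = 1 / (2 * c * (c + 2)) := by
      rw [e1, hy, hb]; field_simp; ring
    have e3 : b * y / (1 - y) ^ 2 ≤ 2 * m := by
      have : b * y / (1 - y) ^ 2 = b * (c + 1) ^ 2 / (c * (c + 2)) ^ 2 := by
        rw [e1, hy]; field_simp
      rw [this, div_le_iff₀ (by positivity)]
      have i1 : b ≤ 2 * m * c := by rw [hb]; nlinarith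
      have i2 : ((c:ℝ) + 1) ^ 2 ≤ (c + 2) ^ 2 * c := by nlinarith
      have := mul_le_mul i1 i2 (by positivity) (by positivity)
      calc _ ≤ _ := this
        _ = _ := by ring
    have e4 : (b * y / (1 - y) - m / (c + 2)) ^ 2 ≤ m := by
      rw [e2]
      have : 1 / (2 * c * (c + 2) : ℝ) ≤ 1 := by rw [div_le_one (by positivity)]; nlinarith
      exact (pow_le_one₀ (by positivity) this).trans hmR
    linarith
  have h3 : ∀ j : ℕ, negBin b y j *
      (1 + 4000 / r + 4000 * r * ((j / m : ℝ) - 1 / (c + 2)) ^ 2) =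
      (1 + 4000 / r) * negBin b y j +
        4000 * r / m ^ 2 * (((j:ℝ) - m / (c + 2)) ^ 2 * negBin b y j) := fun j => by
    field_simp
  simp_rw [h3]
  rw [sum_add_distrib, ← mul_sum, ← mul_sum]
  have h4 := mul_le_mul_of_nonneg_left h1 (by positivity : 0 ≤ 1 + 4000 / r)
  have h5 := mul_le_mul_of_nonneg_left h2 (by positivity : 0 ≤ 4000 * r / (m:ℝ) ^ 2)
  refine (add_le_add h4 h5).trans (le_of_eq ?_)
  rw [← hrr]
  field_simp
  ring

lemma momentRatio_le_aux {m c : ℕ} (hc : 1 ≤ c) (hm : 2 ≤ m) {ε : ℝ} (hε0 : 0 ≤ ε)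
    (hε : ε ≤ 1 / 2) :
    momentRatio m c ε ≤ Real.exp (1 / (6 * (c + 1 : ℝ) ^ 3) + 1 / (c + 1 : ℝ) ^ 4 + 8 / m +
      4 * m * ε + 16000 / Real.sqrt m) := by
  have hmR : (2:ℝ) ≤ m := by exact_mod_cast hm
  have hcR : (1:ℝ) ≤ c := by exact_mod_cast hc
  set y : ℝ := 1 / (c + 1 : ℝ) ^ 2 with hy
  set b : ℝ := c * m + 1 / 2 with hb
  have hb0 : 0 ≤ b := by positivity
  have hy0 : 0 ≤ y := by positivity
  set H := Real.sqrt ((c + 2) / (c + 1)) * Real.exp (-(1 / 2)) *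
    Real.exp (overlapExp c (1 / (c + 2))) with hH
  have hterm : ∀ j ∈ range (m + 1), (m.choose j) * (((1 + ε) * (c + 1 : ℝ) ^ 2) ^ (m - j) *
      oddProd (c * m + j) * Real.exp (3 / 4 - (c + 2 - c * (c + 1) / (c + j / m)) ^ 2 / 4)) *
      derange (m - j) ≤ (1 + ε) ^ m * (c + 1 : ℝ) ^ (2 * m) * oddProd (c * m) * oddProd m * H *
      (negBin b y j *
      (1 + 4000 / Real.sqrt m + 4000 * Real.sqrt m * ((j / m : ℝ) - 1 / (c + 2)) ^ 2)) := by
    intro j hj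
    have hjm : j ≤ m := by simpa [Nat.lt_succ_iff] using hj
    have e1 : oddProd (c * m + j) = oddProd (c * m) * (2 ^ j * ∏ l ∈ range j, (b + l)) := by
      rw [oddProd_add, ← card_range j, ← prod_const, card_range, ← prod_mul_distrib]
      congr 1
      exact prod_congr rfl fun l _ => by rw [hb]; push_cast; ring
    have e2 : ((c + 1 : ℝ) ^ 2) ^ (m - j) = (c + 1 : ℝ) ^ (2 * m) * y ^ j := by
      rw [hy, div_pow, one_pow, ← pow_mul, ← pow_mul, mul_one_div, eq_div_iff (by positivity),
        ← pow_add]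
      congr 1; omega
    have e3 : (1 + ε) ^ (m - j) ≤ (1 + ε) ^ m := pow_le_pow_right₀ (by linarith) (by omega)
    have e4 := choose_mul_oddProd' hjm
    have e5 := derange_le (m - j)
    have e6 := weight_le hc (by omega) hjm
    have e7 := overlapExp_le c (j / m)
    rw [← hH] at e6
    rw [← overlapExp]
    set W := Real.exp (overlapExp c (j / m))
    have hW : 0 < W := Real.exp_pos _
    have hP : 0 ≤ ∏ l ∈ range j, (b + l) := prod_nonneg fun l _ => by positivity
    have hQ := oddProd_pos (c * m)
    have hQm := oddProd_pos m
    rw [mul_pow, e2, e1]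
    calc _ = (m.choose j * derange (m - j)) * ((1 + ε) ^ (m - j) * ((c + 1 : ℝ) ^ (2 * m) * y ^ j *
          (oddProd (c * m) * (2 ^ j * ∏ l ∈ range j, (b + l))) * W)) := by ring
      _ ≤ (m.choose j * (oddProd (m - j) * (Real.exp (-(1 / 2)) + 10 / ((m - j : ℕ) + 1)))) *
          ((1 + ε) ^ m * ((c + 1 : ℝ) ^ (2 * m) * y ^ j *
          (oddProd (c * m) * (2 ^ j * ∏ l ∈ range j, (b + l))) * W)) := by
          refine mul_le_mul (mul_le_mul_of_nonneg_left e5 (by positivity))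
            (mul_le_mul_of_nonneg_right e3 (by positivity)) (by positivity) ?_
          have := oddProd_pos (m - j)
          positivity
      _ = (1 + ε) ^ m * (c + 1 : ℝ) ^ (2 * m) * oddProd (c * m) * oddProd m * (negBin b y j *
          (dratio m j * (Real.exp (-(1 / 2)) + 10 / ((m - j : ℕ) + 1)) * W)) := by
          rw [← mul_assoc (m.choose j : ℝ), e4, negBin]
          field_simp
      _ ≤ (1 + ε) ^ m * (c + 1 : ℝ) ^ (2 * m) * oddProd (c * m) * oddProd m * (negBin b y j *
          (H * (1 + 4000 / Real.sqrt m +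
            4000 * Real.sqrt m * ((j / m : ℝ) - 1 / (c + 2)) ^ 2))) := by
          refine mul_le_mul_of_nonneg_left (mul_le_mul_of_nonneg_left e6 (negBin_nonneg hb0 hy0 j))
              ?_
          positivity
      _ = _ := by ring
  have hsum := sum_le_sum hterm
  rw [← mul_sum] at hsum
  have hQ := oddProd_pos (c * m)
  have hQm := oddProd_pos m
  have hQ1 := oddProd_pos ((c + 1) * m)
  have hQ2 := oddProd_pos ((c + 2) * m)
  have hH0 : 0 ≤ H := by positivity
  have hsum2 := hsum.trans (mul_le_mul_of_nonneg_left (sum_negBin_mul_weight_le hc (by omega))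
      (by positivity))
  have hpre := prefactor_le hm hc
  set B := 1 / (1 - y) ^ b with hB
  have hε1 : 0 < 1 - ε := by linarith
  have hr0 : 0 < Real.sqrt m := Real.sqrt_pos.2 (by linarith)
  have h1 : momentRatio m c ε ≤ ((1 + ε) / (1 - ε)) ^ m * H * (1 + 16000 / Real.sqrt m) *
      ((c + 1 : ℝ) ^ (2 * m) * oddProd (c * m) * oddProd ((c + 2) * m) /
      (oddProd ((c + 1) * m) ^ 2 * (c + 2 : ℝ) ^ (2 * m)) * B) := by
    rw [momentRatio, div_le_iff₀ (by positivity)]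
    refine (mul_le_mul_of_nonneg_right hsum2 hQ2.le).trans (le_of_eq ?_)
    rw [mul_pow (1 - ε), div_pow, ← pow_mul (c + 2 : ℝ)]
    field_simp
  have h2 : ((1 + ε) / (1 - ε)) ^ m ≤ Real.exp (4 * m * ε) := by
    have a1 : (1 + ε) / (1 - ε) ≤ 1 + 4 * ε := by
      rw [div_le_iff₀ hε1]; nlinarith
    refine (pow_le_pow_left₀ (by positivity) (a1.trans ?_) m).trans (le_of_eq
      (Real.exp_nat_mul (4 * ε) m).symm) |>.trans (le_of_eq (by congr 1; ring))
    have := Real.add_one_le_exp (4 * ε)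
    linarith
  have h3 : 1 + 16000 / Real.sqrt m ≤ Real.exp (16000 / Real.sqrt m) := by
    have := Real.add_one_le_exp (16000 / Real.sqrt m); linarith
  have h4 : H = Real.exp ((Real.log (c + 2) - Real.log (c + 1)) / 2 - 1 / (2 * (c + 1)) -
      1 / (4 * (c + 1) ^ 2)) := by
    rw [hH, overlapExp_typical hcR, Real.sqrt_eq_rpow, Real.rpow_def_of_pos (by positivity),
      Real.log_div (by positivity) (by positivity), ← Real.exp_add, ← Real.exp_add]
    congr 1; ring
  have hlog : (Real.log (c + 1) - Real.log c) / 2 ≤ 1 / (2 * (c + 1)) + 1 / (4 * (c + 1) ^ 2) +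
      1 / (6 * (c + 1 : ℝ) ^ 3) + 1 / (c + 1 : ℝ) ^ 4 := by
    have hw : |(1 / (c + 1) : ℝ)| = 1 / (c + 1) := abs_of_nonneg (by positivity)
    have hw2 : (1 / (c + 1) : ℝ) ≤ 1 / 2 := one_div_le_one_div_of_le (by norm_num) (by linarith)
    have l := Real.abs_log_sub_add_sum_range_le (x := (1 / (c + 1) : ℝ)) (by rw [hw]; linarith) 3
    rw [hw, show (1 - 1 / (c + 1) : ℝ) = c / (c + 1) by field_simp; ring,
      Real.log_div (by positivity) (by positivity)] at l
    have l2 : (1 / (c + 1) : ℝ) ^ (3 + 1) / (c / (c + 1)) ≤ 2 / (c + 1) ^ 4 := by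
      rw [div_pow, one_pow, div_div, mul_div_assoc', div_le_div_iff₀ (by positivity)
          (by positivity)]
      have : (1:ℝ) ≤ 2 * c / (c + 1) := by rw [le_div_iff₀ (by positivity)]; linarith
      have e : (2:ℝ) * ((c + 1) ^ (3 + 1) * c / (c + 1)) = (c + 1) ^ 4 * (2 * c / (c + 1)) := by
          ring
      rw [e, one_mul]
      exact le_mul_of_one_le_right (by positivity) this
    have l' := (abs_le.1 (l.trans l2)).1
    simp only [sum_range_succ, sum_range_zero, zero_add] at l'
    norm_num at l'
    have e1 : (2:ℝ) / (c + 1) ^ 4 = 2 * (1 / (c + 1) ^ 4) := by ring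
    have e2 : 1 / (2 * ((c:ℝ) + 1)) = ((c:ℝ) + 1)⁻¹ / 2 := by field_simp
    have e3 : 1 / (4 * ((c:ℝ) + 1) ^ 2) = (((c:ℝ) + 1) ^ 2)⁻¹ / 4 := by field_simp
    have e4 : 1 / (6 * ((c:ℝ) + 1) ^ 3) = (((c:ℝ) + 1) ^ 3)⁻¹ / 6 := by field_simp
    rw [e2, e3, e4]
    rw [e1] at l'
    linarith
  calc _ ≤ _ := h1
    _ ≤ Real.exp (4 * m * ε) * H * Real.exp (16000 / Real.sqrt m) *
        Real.exp (8 / m + Real.log (c + 1) - (Real.log c + Real.log (c + 2)) / 2) := by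
        refine mul_le_mul (mul_le_mul (mul_le_mul_of_nonneg_right h2 hH0) h3 (by positivity)
          (by positivity)) hpre ?_ (by positivity)
        rw [hB]
        have : 0 < 1 - y := by
          rw [hy, sub_pos, div_lt_one (by positivity)]; nlinarith
        positivity
    _ ≤ _ := by
        rw [h4, ← Real.exp_add, ← Real.exp_add, ← Real.exp_add]
        apply Real.exp_le_exp.2
        linarith

lemma exists_momentRatio_le : ∃ C : ℝ, 0 < C ∧ ∀ m c : ℕ, 1 ≤ c → (c + 2 : ℝ) ^ 10 ≤ 2 * m →
    10 ^ 6 * (c + 2 : ℝ) ^ 2 ≤ 2 * m →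
    momentRatio m c (10 ^ 6 * ((c + 2) / (2 * m)) ^ 2) ≤
      1 + 1 / (6 * (c + 1 : ℝ) ^ 3) + C / (c + 1 : ℝ) ^ 4 := by
  obtain ⟨D, hD⟩ : ∃ D : ℝ, D = 1 + 16 + 4 * 10 ^ 6 + 32000 := ⟨_, rfl⟩
  have hD0 : 0 < D := by rw [hD]; norm_num
  refine ⟨D + (1 + D) ^ 2 * Real.exp (1 + D), by positivity, fun m c hc h10 h6 => ?_⟩
  have hcR : (1:ℝ) ≤ c := by exact_mod_cast hc
  have hm0 : (2:ℝ) ≤ m := by nlinarith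
  have hm : 2 ≤ m := by exact_mod_cast hm0
  set x : ℝ := c + 1 with hx
  have hx2 : 2 ≤ x := by linarith
  have hd : (c + 2 : ℝ) = x + 1 := by rw [hx]; ring
  rw [hd] at h10 h6 ⊢
  set ε : ℝ := 10 ^ 6 * ((x + 1) / (2 * m)) ^ 2 with hε
  have hmε : m * ε ≤ 10 ^ 6 / x ^ 4 := by
    have : m * ε = 10 ^ 6 * (x + 1) ^ 2 / (4 * m) := by rw [hε]; field_simp; ring
    rw [this, div_le_div_iff₀ (by positivity) (by positivity)]
    have h1 : x ^ 4 ≤ (x + 1) ^ 8 := by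
      calc x ^ 4 ≤ (x + 1) ^ 4 := pow_le_pow_left₀ (by linarith) (by linarith) 4
        _ ≤ _ := pow_le_pow_right₀ (by linarith) (by norm_num)
    have h2 : (x + 1) ^ 2 * x ^ 4 ≤ (x + 1) ^ 2 * (x + 1) ^ 8 :=
      mul_le_mul_of_nonneg_left h1 (by positivity)
    have h3 : (x + 1) ^ 2 * (x + 1) ^ 8 = (x + 1) ^ 10 := by ring
    rw [mul_assoc]
    linarith
  have hε1 : ε ≤ 1 / 2 := by
    have e : ε * (4 * m ^ 2) = 10 ^ 6 * (x + 1) ^ 2 := by rw [hε]; field_simp; ring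
    have : ε * (4 * m ^ 2) ≤ 1 / 2 * (4 * m ^ 2) := by rw [e]; nlinarith
    exact le_of_mul_le_mul_right this (by positivity)
  have hsq : x ^ 4 / 2 ≤ Real.sqrt m := by
    refine Real.le_sqrt_of_sq_le ?_
    have h1 : x ^ 8 ≤ (x + 1) ^ 10 := by
      calc x ^ 8 ≤ (x + 1) ^ 8 := pow_le_pow_left₀ (by linarith) (by linarith) 8
        _ ≤ _ := pow_le_pow_right₀ (by linarith) (by norm_num)
    have : (x ^ 4 / 2) ^ 2 = x ^ 8 / 4 := by ring
    rw [this]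
    linarith
  have hsq0 : 0 < x ^ 4 / 2 := by positivity
  have h16 : 16000 / Real.sqrt m ≤ 32000 / x ^ 4 := by
    rw [div_le_div_iff₀ (by linarith) (by positivity)]; linarith
  have h8 : 8 / (m : ℝ) ≤ 16 / x ^ 4 := by
    have : Real.sqrt m ≤ m := by
      rw [Real.sqrt_le_left (by linarith)]; nlinarith
    rw [div_le_div_iff₀ (by linarith) (by positivity)]; linarith
  have hz := momentRatio_le_aux hc hm (ε := ε) (by positivity) hε1
  rw [← hx] at hz
  set z := 1 / (6 * x ^ 3) + 1 / x ^ 4 + 8 / m + 4 * m * ε + 16000 / Real.sqrt m with hz'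
  have hzle : z ≤ 1 / (6 * x ^ 3) + D / x ^ 4 := by
    have : D / x ^ 4 = 1 / x ^ 4 + 16 / x ^ 4 + 4 * (10 ^ 6 / x ^ 4) + 32000 / x ^ 4 := by
      rw [hD]; ring
    rw [this, hz']
    linarith
  set w := 1 / (6 * x ^ 3) + D / x ^ 4 with hw
  have hw0 : 0 ≤ w := by positivity
  have hw1 : w ≤ (1 + D) / x ^ 2 := by
    have e1 : 1 / (6 * x ^ 3) ≤ 1 / x ^ 2 := one_div_le_one_div_of_le (by positivity)
        (by nlinarith [sq_nonneg x])
    have e2 : D / x ^ 4 ≤ D / x ^ 2 :=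
      div_le_div_of_nonneg_left hD0.le (by positivity) (pow_le_pow_right₀ (by linarith)
          (by norm_num))
    rw [hw, add_div]; linarith
  have hw2 : w ≤ 1 + D := hw1.trans (div_le_self (by linarith) (by nlinarith))
  have hw3 : w ^ 2 ≤ (1 + D) ^ 2 / x ^ 4 := by
    refine (pow_le_pow_left₀ hw0 hw1 2).trans (le_of_eq ?_)
    rw [div_pow]; ring
  have hew : Real.exp w ≤ Real.exp (1 + D) := Real.exp_le_exp.2 hw2
  have h1 := exp_le_one_add_mul_exp w
  have h2 := mul_le_mul_of_nonneg_left h1 hw0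
  have h3 : w ^ 2 * Real.exp w ≤ (1 + D) ^ 2 / x ^ 4 * Real.exp (1 + D) :=
    mul_le_mul hw3 hew (Real.exp_pos _).le (by positivity)
  have h4 : Real.exp z ≤ Real.exp w := Real.exp_le_exp.2 hzle
  have h5 : (D + (1 + D) ^ 2 * Real.exp (1 + D)) / x ^ 4 =
      D / x ^ 4 + (1 + D) ^ 2 / x ^ 4 * Real.exp (1 + D) := by ring
  rw [h5]
  have h6 : w * (1 + w * Real.exp w) = w + w ^ 2 * Real.exp w := by ring
  linarith

end

section

section Triangles
variable {n : ℕ} {d θ : ℝ} {K : SimpleGraph (Fin n)} {a b c : Fin n}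

/-- Upper bound on the effect of adding an edge. -/
lemma cnt_addE_le_mul (P : Params n d θ) {S : ℝ} (hS : n * d / 4 ≤ S) (h : S - 4 ≤ rsum d K)
    (hab : a ≠ b) (hK : ¬ K.Adj a b) :
    cnt d (addE K a b) ≤ (1 + 17 * θ) * (res d K a * res d K b / S) * cnt d K := by
  have h1 := cnt_addE_mul_le (d := d) hab hK
  have hn := P.n_pos; have hd := P.hd; have hθ := P.hθ; have hθ0 := P.θ_pos; have hθ1 := P.θ_le
  have hS0 : 0 < S := lt_of_lt_of_le (by positivity) hS
  have hN := cnt_nonneg (d := d) (K := K)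
  have hN' := cnt_nonneg (d := d) (K := addE K a b)
  have h2 : S * (1 - 16 * θ) ≤ rsum d K - 2 * (d * (d + 1)) - 2 := by
    have : n * d / 4 * θ ≤ S * θ := mul_le_mul_of_nonneg_right hS hθ0.le
    have e : n * d / 4 * θ = d ^ 2 / 4 := by rw [← hθ]; ring
    nlinarith
  have h3 : S * (1 - 16 * θ) * cnt d (addE K a b) ≤ res d K a * res d K b * cnt d K :=
    (mul_le_mul_of_nonneg_right h2 hN').trans h1
  have h4 : 1 ≤ (1 + 17 * θ) * (1 - 16 * θ) := by nlinarith
  rw [show (1 + 17 * θ) * (res d K a * res d K b / S) * cnt d K =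
    (1 + 17 * θ) * (res d K a * res d K b * cnt d K) / S by ring, le_div_iff₀ hS0]
  calc cnt d (addE K a b) * S ≤ (1 + 17 * θ) * (1 - 16 * θ) * (cnt d (addE K a b) * S) :=
        le_mul_of_one_le_left (by positivity) h4
    _ = (1 + 17 * θ) * (S * (1 - 16 * θ) * cnt d (addE K a b)) := by ring
    _ ≤ _ := mul_le_mul_of_nonneg_left h3 (by positivity)

lemma tot_cherry_le (P : Params n d θ) (hS : n * d / 4 + 2 ≤ rsum d K)
    (hr : ∀ v, 0 ≤ res d K v) (hr' : ∀ v, 0 ≤ res d K v * (res d K v - 1)) (hab : a ≠ b) :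
    tot d K (fun G => new K G b c * new K G c a) ≤ (1 + 17 * θ) ^ 2 *
      (res d K a * res d K b * (res d K c * (res d K c - 1)) / rsum d K ^ 2) * cnt d K := by
  have hn := P.n_pos; have hd := P.hd; have hθ0 := P.θ_pos
  have hS0 : 0 < rsum d K := lt_of_lt_of_le (by positivity) hS
  have hN := cnt_nonneg (d := d) (K := K)
  have hp : 0 ≤ (1 + 17 * θ) ^ 2 * (res d K a * res d K b * (res d K c * (res d K c - 1)) /
      rsum d K ^ 2) * cnt d K := by
    have := hr a; have := hr b; have := hr' c; positivity
  have hz (h : ∀ G, new K G b c * new K G c a = 0) :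
      tot d K (fun G => new K G b c * new K G c a) ≤ (1 + 17 * θ) ^ 2 *
      (res d K a * res d K b * (res d K c * (res d K c - 1)) / rsum d K ^ 2) * cnt d K := by
    simp only [h]; rw [tot_zero]; exact hp
  by_cases hbc : b = c
  · exact hz fun G => by subst hbc; simp
  by_cases hca : c = a
  · exact hz fun G => by subst hca; simp
  by_cases kbc : K.Adj b c
  · exact hz fun G => by simp [new_of_adj G kbc]
  by_cases kca : K.Adj c a
  · exact hz fun G => by simp [new_of_adj G kca]
  have k2 : ¬ (addE K b c).Adj c a := by
    rw [addE_adj hbc]; simp [kca, hab, Ne.symm hbc]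
  have e : tot d K (fun G => new K G b c * new K G c a) = cnt d (addE (addE K b c) c a) := by
    rw [tot_new_mul hbc kbc, ← tot_new hca k2]
    refine tot_congr fun G _ => ?_
    rw [new_addE G hbc kbc (by simp; tauto)]
  rw [e]
  have rc : res d (addE K b c) c * res d (addE K b c) a = (res d K c - 1) * res d K a := by
    rw [res_addE_right hbc kbc, res_addE_ne hbc kbc hab (Ne.symm hca)]
  by_cases h0 : cnt d (addE (addE K b c) c a) = 0
  · rw [h0]; exact hp
  obtain ⟨G, hG⟩ := exists_mem_of_cnt_ne h0
  have hG2 := fam_addE_subset _ _ hG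
  have s1 := cnt_addE_le_mul P (S := rsum d K) (by linarith) (by linarith) hbc kbc
  have s2 := cnt_addE_le_mul P (S := rsum d K) (by linarith)
    (by rw [rsum_addE hbc kbc]; linarith) hca k2
  have p2 := mul_nonneg (res_nonneg hG2 c) (res_nonneg hG2 a)
  rw [rc] at p2 s2
  calc _ ≤ _ := s2
    _ ≤ (1 + 17 * θ) * ((res d K c - 1) * res d K a / rsum d K) *
      ((1 + 17 * θ) * (res d K b * res d K c / rsum d K) * cnt d K) :=
      mul_le_mul_of_nonneg_left s1 (by positivity)
    _ = _ := by ring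

lemma tot_triangle_le (P : Params n d θ) (hS : n * d / 4 + 2 ≤ rsum d K)
    (hr' : ∀ v, 0 ≤ res d K v * (res d K v - 1)) :
    tot d K (fun G => new K G a b * new K G b c * new K G c a) ≤ (1 + 17 * θ) ^ 3 *
      ((res d K a * (res d K a - 1)) * (res d K b * (res d K b - 1)) *
        (res d K c * (res d K c - 1)) / rsum d K ^ 3) * cnt d K := by
  have hn := P.n_pos; have hd := P.hd; have hθ0 := P.θ_pos
  have hS0 : 0 < rsum d K := lt_of_lt_of_le (by positivity) hS
  have hN := cnt_nonneg (d := d) (K := K)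
  have hp : 0 ≤ (1 + 17 * θ) ^ 3 *
      ((res d K a * (res d K a - 1)) * (res d K b * (res d K b - 1)) *
        (res d K c * (res d K c - 1)) / rsum d K ^ 3) * cnt d K := by
    have := hr' a; have := hr' b; have := hr' c; positivity
  have hz (h : ∀ G, new K G a b * new K G b c * new K G c a = 0) : tot d K
      (fun G => new K G a b * new K G b c * new K G c a) ≤ (1 + 17 * θ) ^ 3 *
      ((res d K a * (res d K a - 1)) * (res d K b * (res d K b - 1)) *
        (res d K c * (res d K c - 1)) / rsum d K ^ 3) * cnt d K := by
    simp only [h]; rw [tot_zero]; exact hp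
  by_cases hab : a = b
  · exact hz fun G => by subst hab; simp
  by_cases hbc : b = c
  · exact hz fun G => by subst hbc; simp
  by_cases hca : c = a
  · exact hz fun G => by subst hca; simp
  by_cases kab : K.Adj a b
  · exact hz fun G => by simp [new_of_adj G kab]
  by_cases kbc : K.Adj b c
  · exact hz fun G => by simp [new_of_adj G kbc]
  by_cases kca : K.Adj c a
  · exact hz fun G => by simp [new_of_adj G kca]
  have k1 : ¬ (addE K a b).Adj b c := by
    rw [addE_adj hab]; simp [kbc, hca, Ne.symm hab]
  have k2 : ¬ (addE (addE K a b) b c).Adj c a := by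
    rw [addE_adj hbc, addE_adj hab]; simp [kca, hca, hab, Ne.symm hbc]
  have e : tot d K (fun G => new K G a b * new K G b c * new K G c a) =
      cnt d (addE (addE (addE K a b) b c) c a) := by
    simp_rw [mul_assoc]
    rw [tot_new_mul hab kab, ← tot_new hca k2, ← tot_new_mul hbc k1]
    refine tot_congr fun G _ => ?_
    rw [new_addE G hab kab (by simp; tauto), new_addE G hbc k1 (by simp; tauto),
      new_addE G hab kab (by simp; tauto)]
  rw [e]
  have rb : res d (addE K a b) b * res d (addE K a b) c = (res d K b - 1) * res d K c := by
    rw [res_addE_right hab kab, res_addE_ne hab kab hca (Ne.symm hbc)]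
  have rc : res d (addE (addE K a b) b c) c * res d (addE (addE K a b) b c) a =
      (res d K c - 1) * (res d K a - 1) := by
    rw [res_addE_right hbc k1, res_addE_ne hbc k1 hab (Ne.symm hca), res_addE_left hab kab,
      res_addE_ne hab kab hca (Ne.symm hbc)]
  by_cases h0 : cnt d (addE (addE (addE K a b) b c) c a) = 0
  · rw [h0]; exact hp
  obtain ⟨G, hG⟩ := exists_mem_of_cnt_ne h0
  have hG2 := fam_addE_subset _ _ hG
  have hG1 := fam_addE_subset _ _ hG2
  have s1 := cnt_addE_le_mul P (S := rsum d K) (by linarith) (by linarith) hab kab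
  have s2 := cnt_addE_le_mul P (S := rsum d K) (by linarith)
    (by rw [rsum_addE hab kab]; linarith) hbc k1
  have s3 := cnt_addE_le_mul P (S := rsum d K) (by linarith)
    (by rw [rsum_addE hbc k1, rsum_addE hab kab]; linarith) hca k2
  have p1 := mul_nonneg (res_nonneg hG1 b) (res_nonneg hG1 c)
  have p2 := mul_nonneg (res_nonneg hG2 c) (res_nonneg hG2 a)
  rw [rb] at p1 s2
  rw [rc] at p2 s3
  calc _ ≤ _ := s3
    _ ≤ (1 + 17 * θ) * ((res d K c - 1) * (res d K a - 1) / rsum d K) *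
      ((1 + 17 * θ) * ((res d K b - 1) * res d K c / rsum d K) *
      ((1 + 17 * θ) * (res d K a * res d K b / rsum d K) * cnt d K)) :=
      mul_le_mul_of_nonneg_left (s2.trans (mul_le_mul_of_nonneg_left s1 (by positivity)))
        (by positivity)
    _ = _ := by ring

/-- Number of homomorphisms from a triangle, six times the number of triangles. -/
noncomputable def triHom (G : SimpleGraph (Fin n)) : ℝ :=
  ∑ a, ∑ b, ∑ c, ind G a b * ind G b c * ind G c a

lemma sum_rotate (f : Fin n → Fin n → Fin n → ℝ) :
    ∑ a, ∑ b, ∑ c, f b c a = ∑ a, ∑ b, ∑ c, f a b c := by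
  rw [sum_comm]
  refine (sum_congr rfl fun b _ => ?_)
  rw [sum_comm]

/-- Triangles of a graph containing a transitive graph, sorted by their number of new edges. -/
lemma triHom_eq {G : SimpleGraph (Fin n)} (hG : G ∈ fam d K)
    (hK : ∀ a b c, K.Adj a b → K.Adj b c → a ≠ c → K.Adj a c) :
    triHom G = triHom K + 3 * ∑ a, ∑ b, ∑ c, ind K a b * (new K G b c * new K G c a) +
      ∑ a, ∑ b, ∑ c, new K G a b * new K G b c * new K G c a := by
  have hz (a b c : Fin n) : ind K a b * ind K b c * new K G c a = 0 := by
    by_cases h1 : K.Adj a b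
    · by_cases h2 : K.Adj b c
      · by_cases h3 : c = a
        · subst h3; simp
        · rw [new_of_adj G (hK a b c h1 h2 (Ne.symm h3)).symm]; ring
      · rw [ind_of_not_adj h2]; ring
    · rw [ind_of_not_adj h1]; ring
  have e (a b c : Fin n) : ind G a b * ind G b c * ind G c a = ind K a b * ind K b c * ind K c a +
      (ind K a b * (new K G b c * new K G c a) + ind K b c * (new K G c a * new K G a b) +
        ind K c a * (new K G a b * new K G b c)) + new K G a b * new K G b c * new K G c a := by
    rw [ind_eq_add_new hG a b, ind_eq_add_new hG b c, ind_eq_add_new hG c a]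
    linear_combination hz a b c + hz b c a + hz c a b
  simp only [triHom, e, sum_add_distrib]
  rw [sum_rotate fun a b c => ind K a b * (new K G b c * new K G c a),
    ← sum_rotate fun a b c => ind K c a * (new K G a b * new K G b c)]
  ring

lemma tot_triHom_le (P : Params n d θ) (hS : n * d / 4 + 2 ≤ rsum d K)
    (hK : ∀ a b c, K.Adj a b → K.Adj b c → a ≠ c → K.Adj a c)
    (hr : ∀ v, 0 ≤ res d K v) (hr' : ∀ v, 0 ≤ res d K v * (res d K v - 1)) :
    tot d K triHom ≤ (triHom K + (1 + 17 * θ) ^ 3 *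
      (3 * ((∑ a, ∑ b, ind K a b * (res d K a * res d K b)) *
        (∑ c, res d K c * (res d K c - 1)) / rsum d K ^ 2) +
        (∑ c, res d K c * (res d K c - 1)) ^ 3 / rsum d K ^ 3)) * cnt d K := by
  have hn := P.n_pos; have hd := P.hd; have hθ0 := P.θ_pos
  have hS0 : 0 < rsum d K := lt_of_lt_of_le (by positivity) hS
  have hN := cnt_nonneg (d := d) (K := K)
  rw [tot_congr fun G hG => triHom_eq hG hK, tot_add, tot_add, tot_const, tot_mul_left]
  simp_rw [tot_sum, tot_mul_left]
  have h1 : ∑ a, ∑ b, ∑ c, ind K a b * tot d K (fun G => new K G b c * new K G c a) ≤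
      (1 + 17 * θ) ^ 3 * ((∑ a, ∑ b, ind K a b * (res d K a * res d K b)) *
        (∑ c, res d K c * (res d K c - 1)) / rsum d K ^ 2) * cnt d K := by
    have e : (1 + 17 * θ) ^ 3 * ((∑ a, ∑ b, ind K a b * (res d K a * res d K b)) *
        (∑ c, res d K c * (res d K c - 1)) / rsum d K ^ 2) * cnt d K =
        ∑ a, ∑ b, ∑ c, ind K a b * ((1 + 17 * θ) ^ 3 *
      (res d K a * res d K b * (res d K c * (res d K c - 1)) / rsum d K ^ 2) * cnt d K) := by
      rw [← sum_rotate fun a b c => ind K a b * ((1 + 17 * θ) ^ 3 *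
        (res d K a * res d K b * (res d K c * (res d K c - 1)) / rsum d K ^ 2) * cnt d K)]
      simp only [sum_mul, mul_sum, sum_div]
      refine sum_congr rfl fun a _ => sum_congr rfl fun b _ => sum_congr rfl fun c _ => ?_
      ring
    rw [e]
    refine sum_le_sum fun a _ => sum_le_sum fun b _ => sum_le_sum fun c _ => ?_
    by_cases hab : a = b
    · subst hab; rw [ind_of_not_adj (by simp)]; simp
    refine mul_le_mul_of_nonneg_left ((tot_cherry_le P hS hr hr' hab).trans ?_) (ind_nonneg _ _ _)
    have := hr a; have := hr b; have := hr' c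
    have h2 : (1 + 17 * θ) ^ 2 ≤ (1 + 17 * θ) ^ 3 :=
      pow_le_pow_right₀ (by linarith) (by norm_num)
    gcongr
  have h2 : ∑ a, ∑ b, ∑ c, tot d K (fun G => new K G a b * new K G b c * new K G c a) ≤
      (1 + 17 * θ) ^ 3 * ((∑ c, res d K c * (res d K c - 1)) ^ 3 / rsum d K ^ 3) * cnt d K := by
    have e : (1 + 17 * θ) ^ 3 * ((∑ c, res d K c * (res d K c - 1)) ^ 3 / rsum d K ^ 3) * cnt d K =
        ∑ a, ∑ b, ∑ c, (1 + 17 * θ) ^ 3 *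
      ((res d K a * (res d K a - 1)) * (res d K b * (res d K b - 1)) *
        (res d K c * (res d K c - 1)) / rsum d K ^ 3) * cnt d K := by
      simp only [← mul_sum, ← sum_mul, ← sum_div]
      ring
    rw [e]
    exact sum_le_sum fun a _ => sum_le_sum fun b _ => sum_le_sum fun c _ => tot_triangle_le P hS hr'
  linarith

end Triangles

end

section TriangleMoments
variable {n : ℕ} {d θ : ℝ} {M : SimpleGraph (Fin n)} {a b c : Fin n}

/-- The triangle on `a`, `b`, `c`. -/
noncomputable def triG (a b c : Fin n) : SimpleGraph (Fin n) := addE (addE (addE ⊥ a b) b c) c a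

lemma triG_adj (hab : a ≠ b) (hbc : b ≠ c) (hca : c ≠ a) {x y : Fin n} :
    (triG a b c).Adj x y ↔ x ≠ y ∧ (x = a ∨ x = b ∨ x = c) ∧ (y = a ∨ y = b ∨ y = c) := by
  rw [triG, addE_adj hca, addE_adj hbc, addE_adj hab]
  simp only [SimpleGraph.bot_adj]
  grind

lemma tot_triG (hab : a ≠ b) (hbc : b ≠ c) (hca : c ≠ a) (φ : SimpleGraph (Fin n) → ℝ) :
    tot d ⊥ (fun G => ind G a b * ind G b c * ind G c a * φ G) = tot d (triG a b c) φ := by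
  rw [triG, ← tot_ind_mul hca, ← tot_ind_mul hbc, ← tot_ind_mul hab]
  simp_rw [mul_assoc]

lemma triG_step (hab : a ≠ b) (hbc : b ≠ c) (hca : c ≠ a) :
    ¬ (addE ⊥ a b).Adj b c ∧ ¬ (addE (addE ⊥ a b) b c).Adj c a := by
  rw [addE_adj hbc, addE_adj hab, addE_adj hab]
  simp only [SimpleGraph.bot_adj]
  grind

lemma rsum_triG (hab : a ≠ b) (hbc : b ≠ c) (hca : c ≠ a) : rsum d (triG a b c) = n * d - 6 := by
  obtain ⟨k1, k2⟩ := triG_step hab hbc hca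
  rw [triG, rsum_addE hca k2, rsum_addE hbc k1, rsum_addE hab (by simp), rsum_bot]
  ring

lemma res_triG_ge (hab : a ≠ b) (hbc : b ≠ c) (hca : c ≠ a) (x : Fin n) :
    d - 2 ≤ res d (triG a b c) x := by
  obtain ⟨k1, k2⟩ := triG_step hab hbc hca
  rw [triG, res_addE hca k2, res_addE hbc k1, res_addE hab (by simp)]
  simp only [res, ind_bot, sum_const_zero]
  split_ifs <;> first | linarith | (exfalso; grind)

lemma sum_triangle_eq_six {G : SimpleGraph (Fin n)} (hab : G.Adj a b) (hbc : G.Adj b c)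
    (hca : G.Adj c a) : ∑ x ∈ ({a, b, c} : Finset (Fin n)), ∑ y ∈ ({a, b, c} : Finset (Fin n)),
      ∑ z ∈ ({a, b, c} : Finset (Fin n)), ind G x y * ind G y z * ind G z x = 6 := by
  have h0 (x : Fin n) : ind G x x = 0 := ind_of_not_adj (by simp)
  have n1 : a ∉ ({b, c} : Finset (Fin n)) := by simp [hab.ne, hca.ne.symm]
  have n2 : b ∉ ({c} : Finset (Fin n)) := by simp [hbc.ne]
  simp only [sum_insert n1, sum_insert n2, sum_singleton, h0, ind_of_adj hab, ind_of_adj hbc,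
    ind_of_adj hca, ind_of_adj hab.symm, ind_of_adj hbc.symm, ind_of_adj hca.symm]
  norm_num

lemma triHom_triG (hab : a ≠ b) (hbc : b ≠ c) (hca : c ≠ a) : triHom (triG a b c) = 6 := by
  have hz (x y : Fin n) (h : x ∉ ({a, b, c} : Finset (Fin n))) : ind (triG a b c) x y = 0 := by
    refine ind_of_not_adj ?_
    rw [triG_adj hab hbc hca]
    simp only [mem_insert, mem_singleton] at h
    tauto
  rw [← sum_triangle_eq_six (G := triG a b c) (a := a) (b := b) (c := c)
      (by rw [triG_adj hab hbc hca]; simp [hab]) (by rw [triG_adj hab hbc hca]; simp [hbc])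
      (by rw [triG_adj hab hbc hca]; simp [hca]),
    triHom, ← sum_subset (subset_univ ({a, b, c} : Finset (Fin n)))]
  · refine sum_congr rfl fun x _ => ?_
    rw [← sum_subset (subset_univ ({a, b, c} : Finset (Fin n)))]
    · refine sum_congr rfl fun y _ => ?_
      rw [← sum_subset (subset_univ ({a, b, c} : Finset (Fin n)))]
      intro z _ hzz; rw [hz z x hzz]; ring
    · intro y _ hy; simp [hz y _ hy]
  · intro x _ hx; simp [hz x _ hx]

lemma one_add_mul_cube_le (P : Params n d θ) : (1 + 17 * θ) ^ 3 ≤ 1 + 52 * θ := by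
  have hθ0 := P.θ_pos; have hθ1 := P.θ_le
  have : θ ^ 2 ≤ θ / 10 ^ 6 := by nlinarith
  have : θ ^ 3 ≤ θ / 10 ^ 6 := by nlinarith
  nlinarith

lemma tot_bot_triHom_le (P : Params n d θ) :
    tot d (⊥ : SimpleGraph (Fin n)) triHom ≤ (d - 1) ^ 3 * (1 + 52 * θ) *
        cnt d (⊥ : SimpleGraph (Fin n)) := by
  have hn := P.n_pos; have hd := P.hd; have hθ0 := P.θ_pos
  have r0 (x : Fin n) : res d ⊥ x = d := by simp [res, ind_bot]
  have h := tot_triHom_le P (K := ⊥) (by rw [rsum_bot]; nlinarith [P.hn]) (by simp)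
    (fun v => by rw [r0]; linarith) (fun v => by rw [r0]; nlinarith)
  simp only [triHom, ind_bot, r0, rsum_bot] at h
  refine h.trans (mul_le_mul_of_nonneg_right ?_ cnt_nonneg)
  have e : (n * (d * (d - 1))) ^ 3 / (n * d) ^ 3 = (d - 1) ^ 3 := by field_simp
  simp only [zero_mul, sum_const_zero, zero_div, mul_zero, sum_const, card_univ, Fintype.card_fin,
    nsmul_eq_mul, zero_add, e]
  rw [mul_comm]
  exact mul_le_mul_of_nonneg_left (one_add_mul_cube_le P) (by have : 0 ≤ d - 1 := by linarith
                                                              positivity)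

lemma tot_matching_triHom_le (P : Params n d θ) (hM : M ∈ fam 1 ⊥) :
    tot d M triHom ≤ ((d - 1) ^ 3 - 1) * (1 + 52 * θ) * cnt d M := by
  rw [mem_matching] at hM
  have hn := P.n_pos; have hd := P.hd; have hθ0 := P.θ_pos
  have hu {x y z : Fin n} (h1 : M.Adj x y) (h2 : M.Adj x z) : y = z := by
    have := ind_mul_ind_of_matching (hM x) y z
    rw [ind_of_adj h1, ind_of_adj h2] at this
    by_contra h; simp [h] at this
  have h := tot_triHom_le P (K := M) (by rw [rsum_matching hM]; nlinarith [P.hn])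
    (fun a b c h1 h2 h3 => absurd (hu h1.symm h2) h3)
    (fun v => by rw [res_matching hM]; linarith) (fun v => by rw [res_matching hM]; nlinarith)
  simp only [res_matching hM, rsum_matching hM, ← sum_mul, hM] at h
  have h0 : triHom M = 0 := by
    refine sum_eq_zero fun x _ => sum_eq_zero fun y _ => sum_eq_zero fun z _ => ?_
    by_cases h1 : M.Adj x y
    · by_cases h2 : M.Adj y z
      · rw [hu h1.symm h2, ind_of_not_adj (x := z) (y := z) (by simp)]; ring
      · rw [ind_of_not_adj h2]; ring
    · rw [ind_of_not_adj h1]; ring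
  refine h.trans (mul_le_mul_of_nonneg_right ?_ cnt_nonneg)
  simp only [h0, sum_const, card_univ, Fintype.card_fin, nsmul_eq_mul, mul_one, zero_add]
  have hd1 : d - 1 ≠ 0 := by linarith
  have e : 3 * (n * ((d - 1) * (d - 1)) * (n * (d - 1) * (d - 1 - 1)) / (n * (d - 1)) ^ 2) +
      (n * (d - 1) * (d - 1 - 1)) ^ 3 / (n * (d - 1)) ^ 3 = (d - 1) ^ 3 - 1 := by
    field_simp; ring
  rw [e, mul_comm]
  refine mul_le_mul_of_nonneg_left (one_add_mul_cube_le P) ?_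
  have : 1 ≤ (d - 1) ^ 3 := one_le_pow₀ (by linarith)
  linarith

lemma cube_perturb_le {x : ℝ} (hθ0 : 0 < θ) (hθ1 : θ ≤ 1 / 10 ^ 6) (hx : 1 ≤ x) :
    (1 + 52 * θ) * (3 * (7 * θ * (x * (1 + 2 * θ))) + (x * (1 + 2 * θ)) ^ 3) ≤
      x ^ 3 * (1 + 100 * θ) := by
  have h4 : x ≤ x ^ 3 := le_self_pow₀ hx (by norm_num)
  have h5 : 3 * (7 * θ * (x * (1 + 2 * θ))) + (x * (1 + 2 * θ)) ^ 3 ≤ x ^ 3 * (1 + 30 * θ) := by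
    have h1 : 3 * (7 * θ * (x * (1 + 2 * θ))) ≤ 22 * θ * x ^ 3 := by
      have h : 21 * (1 + 2 * θ) ≤ 22 := by linarith
      calc 3 * (7 * θ * (x * (1 + 2 * θ))) = 21 * (1 + 2 * θ) * (θ * x) := by ring
        _ ≤ 22 * (θ * x ^ 3) := by gcongr
        _ = _ := by ring
    have h6 : (1 + 2 * θ) ^ 3 ≤ 1 + 8 * θ := by
      have : θ ^ 2 ≤ θ / 10 ^ 6 := by nlinarith
      have : θ ^ 3 ≤ θ / 10 ^ 6 := by nlinarith
      nlinarith
    rw [mul_pow]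
    have := mul_le_mul_of_nonneg_left h6 (by positivity : 0 ≤ x ^ 3)
    linarith
  have h6 : (1 + 52 * θ) * (1 + 30 * θ) ≤ 1 + 100 * θ := by nlinarith
  calc _ ≤ (1 + 52 * θ) * (x ^ 3 * (1 + 30 * θ)) := mul_le_mul_of_nonneg_left h5 (by positivity)
    _ = x ^ 3 * ((1 + 52 * θ) * (1 + 30 * θ)) := by ring
    _ ≤ _ := mul_le_mul_of_nonneg_left h6 (by positivity)

lemma triG_ratio_le (P : Params n d θ) {A F : ℝ} (hF0 : 0 ≤ F) (hF : F ≤ n * d * (d - 1))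
    (hA : A ≤ 6 * d ^ 2) :
    (1 + 17 * θ) ^ 3 * (3 * (A * F / (n * d - 6) ^ 2) + F ^ 3 / (n * d - 6) ^ 3) ≤
      (d - 1) ^ 3 * (1 + 100 * θ) := by
  have hn := P.n_pos; have hd := P.hd; have hθ0 := P.θ_pos; have hθ1 := P.θ_le
  have e : n * d * θ = d ^ 2 := by rw [← P.hθ]; ring
  have hS1 : n * d * (1 - θ) ≤ n * d - 6 := by nlinarith
  have hnd : 10 ^ 6 ≤ n * d := by nlinarith [P.hn]
  have hS0 : 0 < n * d - 6 := by linarith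
  have hF1 : F / (n * d - 6) ≤ (d - 1) * (1 + 2 * θ) := by
    rw [div_le_iff₀ hS0]
    have h1 : n * d ≤ (1 + 2 * θ) * (n * d - 6) := by
      have h2 : 1 ≤ (1 + 2 * θ) * (1 - θ) := by nlinarith
      calc n * d ≤ n * d * ((1 + 2 * θ) * (1 - θ)) := le_mul_of_one_le_right (by positivity) h2
        _ = (1 + 2 * θ) * (n * d * (1 - θ)) := by ring
        _ ≤ _ := mul_le_mul_of_nonneg_left hS1 (by positivity)
    have := mul_le_mul_of_nonneg_right h1 (by linarith : 0 ≤ d - 1)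
    linarith
  have hA1 : A / (n * d - 6) ≤ 7 * θ := by
    rw [div_le_iff₀ hS0]
    have := sq_nonneg d
    nlinarith
  have hF2 : 0 ≤ F / (n * d - 6) := div_nonneg hF0 hS0.le
  have e1 : A * F / (n * d - 6) ^ 2 = A / (n * d - 6) * (F / (n * d - 6)) := by
    rw [div_mul_div_comm, sq]
  rw [e1, ← div_pow]
  have h1 := mul_le_mul hA1 hF1 hF2 (by positivity)
  have h2 := pow_le_pow_left₀ hF2 hF1 3
  have h3 := one_add_mul_cube_le P
  have hx : 0 ≤ d - 1 := by linarith
  refine le_trans ?_ (cube_perturb_le (x := d - 1) hθ0 hθ1 (by linarith))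
  calc _ ≤ (1 + 17 * θ) ^ 3 * (3 * (7 * θ * ((d - 1) * (1 + 2 * θ))) +
        ((d - 1) * (1 + 2 * θ)) ^ 3) := mul_le_mul_of_nonneg_left (by linarith) (by positivity)
    _ ≤ _ := mul_le_mul_of_nonneg_right h3 (by positivity)

lemma tot_triG_triHom_le (P : Params n d θ) (hab : a ≠ b) (hbc : b ≠ c) (hca : c ≠ a) :
    tot d (triG a b c) triHom ≤ (6 + (d - 1) ^ 3 * (1 + 100 * θ)) * cnt d (triG a b c) := by
  have hn := P.n_pos; have hd := P.hd
  have hr := res_triG_ge (d := d) hab hbc hca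
  have hS := rsum_triG (d := d) hab hbc hca
  have hnd : 10 ^ 6 ≤ n * d := by nlinarith [P.hn]
  have h := tot_triHom_le P (K := triG a b c) (by rw [hS]; nlinarith)
    (fun x y z => by rw [triG_adj hab hbc hca, triG_adj hab hbc hca, triG_adj hab hbc hca]; tauto)
    (fun v => by linarith [hr v]) (fun v => by nlinarith [hr v])
  refine h.trans (mul_le_mul_of_nonneg_right ?_ cnt_nonneg)
  have hF0 : 0 ≤ ∑ v, res d (triG a b c) v * (res d (triG a b c) v - 1) :=
    sum_nonneg fun v _ => by nlinarith [hr v]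
  have hF : ∑ v, res d (triG a b c) v * (res d (triG a b c) v - 1) ≤ n * d * (d - 1) := by
    refine (sum_le_sum (g := fun _ => d * (d - 1)) fun v _ => ?_).trans (le_of_eq ?_)
    · have := res_le (d := d) (K := triG a b c) v
      nlinarith [hr v]
    · simp; ring
  have hA : ∑ x, ∑ y, ind (triG a b c) x y * (res d (triG a b c) x * res d (triG a b c) y) ≤
      6 * d ^ 2 := by
    have : ∑ x, ∑ y, ind (triG a b c) x y = 6 := by
      have := hS; simp only [rsum, res, sum_sub_distrib] at this
      simp at this; linarith
    rw [← this, sum_mul]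
    refine sum_le_sum fun x _ => ?_
    rw [sum_mul]
    refine sum_le_sum fun y _ => mul_le_mul_of_nonneg_left ?_ (ind_nonneg _ _ _)
    rw [sq]
    exact mul_le_mul (res_le _) (res_le _) (by linarith [hr y]) (by linarith)
  rw [hS]
  linarith [triHom_triG hab hbc hca, triG_ratio_le P hF0 hF hA]

end TriangleMoments

section TriangleSecondMoment
variable {n : ℕ} {d θ : ℝ} {a b c : Fin n}

lemma tri_eq_zero (G : SimpleGraph (Fin n)) (h : ¬ (a ≠ b ∧ b ≠ c ∧ c ≠ a)) :
    ind G a b * ind G b c * ind G c a = 0 := by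
  have h0 (x : Fin n) : ind G x x = 0 := ind_of_not_adj (by simp)
  by_cases h1 : a = b
  · subst h1; rw [h0]; ring
  by_cases h2 : b = c
  · subst h2; rw [h0]; ring
  by_cases h3 : c = a
  · subst h3; rw [h0]; ring
  exact absurd ⟨h1, h2, h3⟩ h

lemma tot_triHom_sq_le (P : Params n d θ) :
    tot d (⊥ : SimpleGraph (Fin n)) (fun G => triHom G * triHom G) ≤
      (6 + (d - 1) ^ 3 * (1 + 100 * θ)) * tot d (⊥ : SimpleGraph (Fin n)) triHom := by
  have e1 : tot d (⊥ : SimpleGraph (Fin n)) (fun G => triHom G * triHom G) =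
      ∑ a, ∑ b, ∑ c, tot d (⊥ : SimpleGraph (Fin n))
        (fun G => ind G a b * ind G b c * ind G c a * triHom G) := by
    simp_rw [← tot_sum, ← sum_mul]; rfl
  have e2 : tot d (⊥ : SimpleGraph (Fin n)) triHom = ∑ a, ∑ b, ∑ c,
      tot d (⊥ : SimpleGraph (Fin n)) (fun G => ind G a b * ind G b c * ind G c a * 1) := by
    simp_rw [← tot_sum, mul_one]; rfl
  rw [e1, e2]
  simp_rw [mul_sum]
  refine sum_le_sum fun a _ => sum_le_sum fun b _ => sum_le_sum fun c _ => ?_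
  by_cases h : a ≠ b ∧ b ≠ c ∧ c ≠ a
  · rw [tot_triG h.1 h.2.1 h.2.2, tot_triG h.1 h.2.1 h.2.2]
    exact tot_triG_triHom_le P h.1 h.2.1 h.2.2
  · simp_rw [tri_eq_zero _ h, zero_mul, tot_zero]; simp

lemma cnt_triG_ge (P : Params n d θ) (hab : a ≠ b) (hbc : b ≠ c) (hca : c ≠ a) :
    (((d - 1) / n) ^ 3 - 48800 * θ ^ 4) * cnt d (⊥ : SimpleGraph (Fin n)) ≤
      cnt d (triG a b c) := by
  by_cases h0 : cnt d (⊥ : SimpleGraph (Fin n)) = 0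
  · rw [h0, mul_zero]; exact cnt_nonneg
  obtain ⟨G, hG⟩ := exists_mem_of_cnt_ne h0
  have hn := P.n_pos; have hd := P.hd
  have r0 (x : Fin n) : res d ⊥ x = d := by simp [res, ind_bot]
  have hnd : 10 ^ 6 ≤ n * d := by nlinarith [P.hn]
  have hS := rsum_bot (n := n) (d := d)
  have k0 (x y : Fin n) : ¬ (⊥ : SimpleGraph (Fin n)).Adj x y := by simp
  obtain ⟨k1, k2⟩ := triG_step hab hbc hca
  have hc := cnt_cherry P (K := ⊥) (u := a) (v := c) (x := b) (by rw [hS]; linarith) hG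
    hca.symm hab hbc.symm (k0 _ _) (k0 _ _)
  rw [addE_comm c b] at hc
  have h1 := cnt_addE_le P (K := ⊥) (by rw [hS]; linarith) hab (k0 _ _)
  have h2 := cnt_addE_le P (K := addE ⊥ a b) (by rw [rsum_addE hab (k0 _ _), hS]; linarith) hbc k1
  have h3 := cnt_chain P (K₂ := addE (addE ⊥ a b) b c) (c := c) (e := a) (S := n * d)
    (M := 25 * θ ^ 2)
    (by rw [rsum_addE hbc k1, rsum_addE hab (k0 _ _), hS]; linarith) hca k2 (by linarith)
    (by rw [rsum_addE hbc k1, rsum_addE hab (k0 _ _), hS]; ring_nf; norm_num) rfl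
    (abs_res_mul_le ?_ ?_) hc (by
      have := mul_le_mul_of_nonneg_left h1 (by linarith [P.θ_pos] : 0 ≤ 5 * θ)
      linarith)
  · rw [res_addE_right hbc k1, res_addE_ne hbc k1 hab hca.symm, res_addE_ne hab (k0 _ _) hca
      hbc.symm, res_addE_left hab (k0 _ _)] at h3
    simp only [r0, hS] at h3
    have h4 := (abs_le.1 h3).1
    have e : (d - 1) * (d - 1) / (n * d) * (d * d * (d * (d - 1)) / (n * d) ^ 2) =
        ((d - 1) / n) ^ 3 := by field_simp
    rw [e] at h4
    unfold triG
    linarith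
  · rw [res_addE_right hbc k1, res_addE_ne hab (k0 _ _) hca hbc.symm, r0, abs_le]
    constructor <;> linarith
  · rw [res_addE_ne hbc k1 hab hca.symm, res_addE_left hab (k0 _ _), r0, abs_le]
    constructor <;> linarith

lemma tot_bot_triHom_ge (P : Params n d θ) :
    (d - 1) ^ 3 * (1 - 200000 * θ) * cnt d (⊥ : SimpleGraph (Fin n)) ≤
      tot d (⊥ : SimpleGraph (Fin n)) triHom := by
  have hn := P.n_pos; have hd := P.hd; have hθ0 := P.θ_pos; have hθ1 := P.θ_le
  have hN := cnt_nonneg (d := d) (K := (⊥ : SimpleGraph (Fin n)))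
  set q := ((d - 1) / n) ^ 3 - 48800 * θ ^ 4 with hq
  have hx : 2 / 3 * d ≤ d - 1 := by linarith
  have hx3 : 8 / 27 * d ^ 3 ≤ (d - 1) ^ 3 := by
    have := pow_le_pow_left₀ (by linarith) hx 3
    linarith
  have hnq : n ^ 3 * q = (d - 1) ^ 3 - 48800 * θ * d ^ 3 := by
    rw [hq, ← P.hθ]; field_simp
  have hq0 : 0 ≤ q := by
    have : 0 ≤ n ^ 3 * q := by
      rw [hnq]
      have : θ * d ^ 3 ≤ 1 / 10 ^ 6 * d ^ 3 := mul_le_mul_of_nonneg_right hθ1 (by positivity)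
      have : 0 ≤ d ^ 3 := by positivity
      linarith
    exact nonneg_of_mul_nonneg_right this (by positivity)
  have e2 : tot d (⊥ : SimpleGraph (Fin n)) triHom = ∑ a, ∑ b, ∑ c,
      tot d (⊥ : SimpleGraph (Fin n)) (fun G => ind G a b * ind G b c * ind G c a * 1) := by
    simp_rw [← tot_sum, mul_one]; rfl
  have h1 : ∑ a : Fin n, ∑ b : Fin n, ∑ c : Fin n, (1 - (if a = b then 1 else 0) -
      (if b = c then 1 else 0) - (if c = a then 1 else 0)) * (q * cnt d (⊥ : SimpleGraph (Fin n))) ≤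
      tot d (⊥ : SimpleGraph (Fin n)) triHom := by
    rw [e2]
    refine sum_le_sum fun a _ => sum_le_sum fun b _ => sum_le_sum fun c _ => ?_
    by_cases h : a ≠ b ∧ b ≠ c ∧ c ≠ a
    · rw [tot_triG h.1 h.2.1 h.2.2, if_neg h.1, if_neg h.2.1, if_neg h.2.2]
      refine le_trans (le_of_eq ?_) (cnt_triG_ge P h.1 h.2.1 h.2.2)
      ring
    · simp_rw [tri_eq_zero _ h, zero_mul, tot_zero]
      refine mul_nonpos_of_nonpos_of_nonneg ?_ (mul_nonneg hq0 hN)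
      split_ifs <;> first | norm_num; done | tauto
  refine le_trans ?_ h1
  simp_rw [← sum_mul, sum_sub_distrib]
  simp only [sum_const, card_univ, Fintype.card_fin, nsmul_eq_mul, sum_ite_eq, sum_ite_eq',
    mem_univ, if_true, mul_one]
  simp_rw [← mul_sum]
  simp only [sum_ite_eq, mem_univ, if_true, sum_const, card_univ, Fintype.card_fin, nsmul_eq_mul,
    mul_one]
  rw [← mul_assoc]
  refine mul_le_mul_of_nonneg_right ?_ hN
  have h2 : (1 - θ) * (n ^ 3 * q) ≤ (n * (n * n) - n * n - n * n - n * n) * q := by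
    have h3 : 3 * n ^ 2 * q ≤ θ * n ^ 3 * q := by
      refine mul_le_mul_of_nonneg_right ?_ hq0
      calc 3 * (n:ℝ) ^ 2 ≤ d * n ^ 2 := mul_le_mul_of_nonneg_right hd (by positivity)
        _ = _ := by rw [← P.hθ]; ring
    linarith
  refine le_trans ?_ h2
  rw [hnq]
  have h3 : θ * (8 / 27 * d ^ 3) ≤ θ * (d - 1) ^ 3 := mul_le_mul_of_nonneg_left hx3 hθ0.le
  have h4 : 0 ≤ θ * (48800 * θ * d ^ 3) := by positivity
  have h5 : 0 ≤ θ * (d - 1) ^ 3 := by have : 0 ≤ d - 1 := by linarith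
                                      positivity
  nlinarith

end TriangleSecondMoment

section Translation
variable {n : ℕ} {G M : SimpleGraph (Fin n)}

lemma gDeg_eq (G : SimpleGraph (Fin n)) (v : Fin n) : (gDeg G v : ℝ) = ∑ w, ind G v w := by
  classical
  simp only [gDeg, ind]
  rw [Nat.card_eq_fintype_card, Fintype.card_subtype, card_filter]
  push_cast
  exact sum_congr rfl fun w _ => by congr

lemma isRegularGraph_iff {k : ℕ} : IsRegularGraph G k ↔ G ∈ fam (k : ℝ) ⊥ := by
  simp only [IsRegularGraph, mem_fam, bot_le, true_and, ← gDeg_eq, Nat.cast_inj]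

lemma expec_mu (k : ℕ) (f : SimpleGraph (Fin n) → ℝ) :
    expec (mu n k) f = tot (k : ℝ) ⊥ f / cnt (k : ℝ) (⊥ : SimpleGraph (Fin n)) := by
  classical
  have h : (Nat.card {H : SimpleGraph (Fin n) // IsRegularGraph H k} : ℝ) =
      cnt (k : ℝ) (⊥ : SimpleGraph (Fin n)) := by
    rw [cnt_eq_card, Nat.card_congr (Equiv.subtypeEquivRight fun G => isRegularGraph_iff),
      Nat.card_eq_fintype_card, Fintype.card_coe]
  rw [expec, tsum_fintype, tot, sum_div, ← sum_subset (subset_univ (fam (k : ℝ) ⊥))]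
  · refine sum_congr rfl fun G hG => ?_
    rw [mu, if_pos (isRegularGraph_iff.2 hG), h]
    ring
  · intro G _ hG
    rw [mu, if_neg (mt isRegularGraph_iff.1 hG), zero_mul]

lemma triCount_eq (G : SimpleGraph (Fin n)) : (triCount G : ℝ) = triHom G / 6 := by
  classical
  have h1 : ∑ s ∈ univ.filter (fun s => G.IsNClique 3 s), ∑ a ∈ s, ∑ b ∈ s, ∑ c ∈ s,
      ind G a b * ind G b c * ind G c a = triHom G := by
    have e (s : Finset (Fin n)) : ∑ a ∈ s, ∑ b ∈ s, ∑ c ∈ s,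
        ind G a b * ind G b c * ind G c a = ∑ a, ∑ b, ∑ c,
          if a ∈ s ∧ b ∈ s ∧ c ∈ s then ind G a b * ind G b c * ind G c a else 0 := by
      simp only [ite_and, sum_ite_irrel, sum_const_zero, sum_ite_mem, univ_inter]
    simp_rw [e]
    rw [triHom, sum_comm]
    refine sum_congr rfl fun a _ => ?_
    rw [sum_comm]
    refine sum_congr rfl fun b _ => ?_
    rw [sum_comm]
    refine sum_congr rfl fun c _ => ?_
    by_cases h : G.Adj a b ∧ G.Adj b c ∧ G.Adj c a
    · obtain ⟨hab, hbc, hca⟩ := h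
      rw [← sum_filter, sum_const, filter_filter]
      have : univ.filter (fun s : Finset (Fin n) => G.IsNClique 3 s ∧ a ∈ s ∧ b ∈ s ∧ c ∈ s) =
          {{a, b, c}} := by
        ext s
        simp only [mem_filter, mem_univ, true_and, mem_singleton]
        constructor
        · rintro ⟨hs, h1, h2, h3⟩
          refine (eq_of_subset_of_card_le ?_ ?_).symm
          · intro x; simp only [mem_insert, mem_singleton]; rintro (rfl | rfl | rfl) <;> assumption
          · rw [hs.card_eq, card_eq_three.2 ⟨a, b, c, hab.ne, hca.ne.symm, hbc.ne, rfl⟩]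
        · rintro rfl
          exact ⟨SimpleGraph.is3Clique_triple_iff.2 ⟨hab, hca.symm, hbc⟩, by simp, by simp, by simp⟩
      rw [this]; simp
    · have : ind G a b * ind G b c * ind G c a = 0 := by
        by_cases k1 : G.Adj a b
        · by_cases k2 : G.Adj b c
          · rw [ind_of_not_adj fun k3 => h ⟨k1, k2, k3⟩]; ring
          · rw [ind_of_not_adj k2]; ring
        · rw [ind_of_not_adj k1]; ring
      simp [this]
  have h2 : ∀ s ∈ univ.filter (fun s => G.IsNClique 3 s), ∑ a ∈ s, ∑ b ∈ s, ∑ c ∈ s,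
      ind G a b * ind G b c * ind G c a = 6 := by
    intro s hs
    obtain ⟨a, b, c, hab, hac, hbc, rfl⟩ := SimpleGraph.is3Clique_iff.1 (mem_filter.1 hs).2
    exact sum_triangle_eq_six hab hbc hac.symm
  rw [← h1, sum_congr rfl h2, triCount, Nat.card_eq_fintype_card, Fintype.card_subtype]
  simp

open Classical in
lemma pmCount_eq (G : SimpleGraph (Fin n)) :
    (pmCount G : ℝ) = ∑ M ∈ fam 1 (⊥ : SimpleGraph (Fin n)), if M ≤ G then 1 else 0 := by
  rw [pmCount, Nat.card_eq_fintype_card, Fintype.card_subtype, ← sum_filter, sum_const]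
  have : univ.filter (fun M => M ≤ G ∧ IsRegularGraph M 1) =
      (fam 1 (⊥ : SimpleGraph (Fin n))).filter fun M => M ≤ G := by
    ext M
    simp only [mem_filter, mem_univ, true_and, isRegularGraph_iff, Nat.cast_one]
    tauto
  rw [this]; simp

open Classical in
lemma tot_ite_le {d : ℝ} (M : SimpleGraph (Fin n)) (φ : SimpleGraph (Fin n) → ℝ) :
    tot d ⊥ (fun G => (if M ≤ G then 1 else 0) * φ G) = tot d M φ := by
  have : fam d M = (fam d ⊥).filter fun G => M ≤ G := by
    ext G; simp only [mem_filter, mem_fam, bot_le, true_and]; tauto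
  rw [tot, tot, this, sum_filter]
  exact sum_congr rfl fun G _ => by split_ifs <;> simp

lemma tot_pmCount_mul {d : ℝ} (φ : SimpleGraph (Fin n) → ℝ) :
    tot d ⊥ (fun G => pmCount G * φ G) = ∑ M ∈ fam 1 (⊥ : SimpleGraph (Fin n)), tot d M φ := by
  classical
  simp_rw [pmCount_eq, sum_mul, tot_sum, tot_ite_le]

lemma tot_pmCount {d : ℝ} : tot d (⊥ : SimpleGraph (Fin n)) (fun G => (pmCount G : ℝ)) =
    ∑ M ∈ fam 1 (⊥ : SimpleGraph (Fin n)), cnt d M := by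
  have := tot_pmCount_mul (n := n) (d := d) fun _ => 1
  simp only [mul_one] at this
  exact this

lemma tot_pmCount_sq {d : ℝ} :
    tot d (⊥ : SimpleGraph (Fin n)) (fun G => (pmCount G : ℝ) * pmCount G) =
    ∑ M ∈ fam 1 (⊥ : SimpleGraph (Fin n)), ∑ M' ∈ fam 1 (⊥ : SimpleGraph (Fin n)),
      cnt d (M ⊔ M') := by
  classical
  rw [tot_pmCount_mul]
  refine sum_congr rfl fun M _ => ?_
  rw [← tot_ite_le M]
  simp_rw [pmCount_eq, mul_sum, tot_sum]
  refine sum_congr rfl fun M' _ => ?_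
  rw [cnt, ← tot_ite_le (M ⊔ M')]
  refine tot_congr fun G _ => ?_
  by_cases h1 : M ≤ G <;> by_cases h2 : M' ≤ G <;> simp [h1, h2]

end Translation

section Residual
variable {n k : ℕ} {x y : SimpleGraph (Fin n) → ℝ}

lemma varia_sub_affine (hN : cnt (k : ℝ) (⊥ : SimpleGraph (Fin n)) ≠ 0) (a b : ℝ) :
    varia (mu n k) (fun G => y G - (a * x G + b)) =
      varia (mu n k) y - 2 * a * covar (mu n k) x y + a ^ 2 * varia (mu n k) x := by
  have e1 (G : SimpleGraph (Fin n)) : (y G - (a * x G + b)) * (y G - (a * x G + b)) =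
      y G * y G + a ^ 2 * (x G * x G) + (-2 * a) * (x G * y G) + (-2 * b) * y G +
        2 * a * b * x G + b ^ 2 := by ring
  have e2 (G : SimpleGraph (Fin n)) : y G - (a * x G + b) = y G + -a * x G + -b := by ring
  rw [varia, covar, funext e1, funext e2]
  simp only [varia, covar, expec_mu]
  simp only [tot_add, tot_mul_left, tot_const]
  field_simp
  ring

lemma varia_residual_le (hx : 0 < varia (mu n k) x) (a b : ℝ) :
    varia (mu n k) (fun G => y G - (covar (mu n k) x y / varia (mu n k) x * x G + b)) ≤
      varia (mu n k) y - 2 * a * covar (mu n k) x y + a ^ 2 * varia (mu n k) x := by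
  have hN : cnt (k : ℝ) (⊥ : SimpleGraph (Fin n)) ≠ 0 := by
    intro h
    rw [varia, covar, expec_mu, expec_mu, h] at hx
    simp at hx
  rw [varia_sub_affine hN]
  have : 0 ≤ varia (mu n k) x * (a - covar (mu n k) x y / varia (mu n k) x) ^ 2 :=
    mul_nonneg hx.le (sq_nonneg _)
  refine le_of_sub_nonneg (this.trans (le_of_eq ?_))
  field_simp
  ring

lemma covar_triCount (y : SimpleGraph (Fin n) → ℝ) :
    covar (mu n k) (fun G => (triCount G : ℝ)) y =
      (tot (k : ℝ) (⊥ : SimpleGraph (Fin n)) (fun G => y G * triHom G) / cnt (k : ℝ)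
          (⊥ : SimpleGraph (Fin n)) -
        tot (k : ℝ) (⊥ : SimpleGraph (Fin n)) triHom / cnt (k : ℝ) (⊥ : SimpleGraph (Fin n)) *
          (tot (k : ℝ) (⊥ : SimpleGraph (Fin n)) y / cnt (k : ℝ) (⊥ : SimpleGraph (Fin n)))) /
              6 := by
  have e1 (G : SimpleGraph (Fin n)) : triHom G / 6 * y G = 1 / 6 * (y G * triHom G) := by ring
  have e2 (G : SimpleGraph (Fin n)) : triHom G / 6 = 1 / 6 * triHom G := by ring
  simp only [covar, expec_mu, triCount_eq, e1]
  simp only [e2, tot_mul_left]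
  ring

lemma varia_triCount :
    varia (mu n k) (fun G => (triCount G : ℝ)) =
      (tot (k : ℝ) (⊥ : SimpleGraph (Fin n)) (fun G => triHom G * triHom G) / cnt (k : ℝ)
          (⊥ : SimpleGraph (Fin n)) -
        (tot (k : ℝ) (⊥ : SimpleGraph (Fin n)) triHom / cnt (k : ℝ) (⊥ : SimpleGraph (Fin n)))
            ^ 2) / 36 := by
  have e1 (G : SimpleGraph (Fin n)) : (triCount G : ℝ) * triHom G = 1 / 6 *
      (triHom G * triHom G) := by
    rw [triCount_eq]; ring
  have e2 (G : SimpleGraph (Fin n)) : (triCount G : ℝ) = 1 / 6 * triHom G := by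
    rw [triCount_eq]; ring
  rw [varia, covar_triCount]
  simp only [e1, tot_mul_left]
  simp only [e2, tot_mul_left]
  ring

lemma residual_variance_le {x e θ C Y η τ₁ τ₂ : ℝ} (hx : 2 ≤ x) (he : 0 ≤ e) (hθ : 0 < θ)
    (hθ1 : θ ≤ 1 / 10 ^ 6) (hθx : θ ≤ 1 / x ^ 4)
    (hY : Y ≤ (1 + 1 / (6 * x ^ 3) + C / x ^ 4) * e ^ 2)
    (hη : η ≤ (x ^ 3 - 1) * (1 + 52 * θ) * e) (h1 : τ₁ ≤ x ^ 3 * (1 + 52 * θ))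
    (h1' : x ^ 3 * (1 - 200000 * θ) ≤ τ₁) (h2 : τ₂ ≤ (6 + x ^ 3 * (1 + 100 * θ)) * τ₁) :
    (Y - e ^ 2) - 2 * -(e / x ^ 3) * ((η - τ₁ * e) / 6) +
      (-(e / x ^ 3)) ^ 2 * ((τ₂ - τ₁ ^ 2) / 36) ≤ (C + 80000) / x ^ 4 * e ^ 2 := by
  have hx3 : 0 < x ^ 3 := by positivity
  have p2 : 2 * (e / x ^ 3) * ((η - τ₁ * e) / 6) ≤ (-(1 / (3 * x ^ 3)) + 70000 * θ) * e ^ 2 := by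
    have h3 : η - τ₁ * e ≤ (-1 + 200052 * θ * x ^ 3) * e := by
      have := mul_le_mul_of_nonneg_right h1' he
      have : 0 ≤ θ * e := by positivity
      nlinarith
    calc 2 * (e / x ^ 3) * ((η - τ₁ * e) / 6) = e / (3 * x ^ 3) * (η - τ₁ * e) := by
          field_simp; ring
      _ ≤ e / (3 * x ^ 3) * ((-1 + 200052 * θ * x ^ 3) * e) :=
          mul_le_mul_of_nonneg_left h3 (by positivity)
      _ = (-(1 / (3 * x ^ 3)) + 66684 * θ) * e ^ 2 := by field_simp; ring
      _ ≤ _ := by gcongr; norm_num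
  have p3 : (-(e / x ^ 3)) ^ 2 * ((τ₂ - τ₁ ^ 2) / 36) ≤ (1 / (6 * x ^ 3) + 10000 * θ) * e ^ 2 := by
    have hτ : 0 ≤ τ₁ := le_trans (mul_nonneg hx3.le (by linarith)) h1'
    have h3 : τ₂ - τ₁ ^ 2 ≤ 6 * x ^ 3 + 300000 * θ * x ^ 6 := by
      have h4 : τ₁ * (x ^ 3 * (1 + 100 * θ) - τ₁) ≤
          x ^ 3 * (1 + 52 * θ) * (x ^ 3 * (200100 * θ)) :=
        (mul_le_mul_of_nonneg_left (by linarith) hτ).trans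
          (mul_le_mul_of_nonneg_right h1 (by positivity))
      have h5 : x ^ 3 * (1 + 52 * θ) * (x ^ 3 * (200100 * θ)) ≤ 250000 * θ * x ^ 6 := by
        have : (1 + 52 * θ) * 200100 ≤ 250000 := by linarith
        calc _ = (1 + 52 * θ) * 200100 * (θ * x ^ 6) := by ring
          _ ≤ 250000 * (θ * x ^ 6) := mul_le_mul_of_nonneg_right this (by positivity)
          _ = _ := by ring
      have h6 : θ * x ^ 3 ≤ θ * x ^ 6 :=
        mul_le_mul_of_nonneg_left (pow_le_pow_right₀ (by linarith) (by norm_num)) hθ.le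
      nlinarith
    calc (-(e / x ^ 3)) ^ 2 * ((τ₂ - τ₁ ^ 2) / 36) = e ^ 2 / (36 * x ^ 6) * (τ₂ - τ₁ ^ 2) := by
          field_simp
      _ ≤ e ^ 2 / (36 * x ^ 6) * (6 * x ^ 3 + 300000 * θ * x ^ 6) :=
          mul_le_mul_of_nonneg_left h3 (by positivity)
      _ = (1 / (6 * x ^ 3) + 25000 / 3 * θ) * e ^ 2 := by field_simp; ring
      _ ≤ _ := by gcongr; norm_num
  have h3 : θ * e ^ 2 ≤ 1 / x ^ 4 * e ^ 2 := mul_le_mul_of_nonneg_right hθx (sq_nonneg _)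
  have e1 : (1 + 1 / (6 * x ^ 3) + C / x ^ 4) * e ^ 2 + (-(1 / (3 * x ^ 3)) + 70000 * θ) * e ^ 2 +
      (1 / (6 * x ^ 3) + 10000 * θ) * e ^ 2 = e ^ 2 + C / x ^ 4 * e ^ 2 + 80000 * (θ * e ^ 2) := by
    field_simp; ring
  have e2 : (C + 80000) / x ^ 4 * e ^ 2 = C / x ^ 4 * e ^ 2 + 80000 * (1 / x ^ 4 * e ^ 2) := by
    ring
  linarith

end Residual

lemma params_of_le {m c : ℕ} (hm : 10 ^ 8 ≤ 2 * m) (h : (c + 2 : ℝ) ^ 10 ≤ 2 * m) (hc : 1 ≤ c) :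
    Params (2 * m) (c + 2) ((c + 2) / (2 * m)) := by
  have hm' : (10 ^ 8 : ℝ) ≤ 2 * m := by exact_mod_cast hm
  have hc' : (1 : ℝ) ≤ c := by exact_mod_cast hc
  refine ⟨by linarith, ?_, ?_⟩
  · push_cast
    refine le_of_pow_le_pow_left₀ (n := 5) (by norm_num) (by positivity) ?_
    calc (10 ^ 6 * (c + 2 : ℝ) ^ 2) ^ 5 = (10 : ℝ) ^ 30 * (c + 2 : ℝ) ^ 10 := by ring
      _ ≤ (2 * m : ℝ) ^ 4 * (2 * m : ℝ) := by
          refine mul_le_mul ?_ h (by positivity) (by positivity)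
          calc (10 ^ 30 : ℝ) ≤ (10 ^ 8) ^ 4 := by norm_num
            _ ≤ _ := pow_le_pow_left₀ (by norm_num) hm' 4
      _ = (2 * m : ℝ) ^ 5 := by ring
  · push_cast
    exact div_mul_cancel₀ _ (by linarith)

end RegPM

/-- There are `C > 0` and `n₀` such that for every even `n = 2m ≥ n₀`
and `3 ≤ d ≤ n^{1/10}`: with `X` the triangle count and `Y` the perfect-matching count of
`G ~ μ_{d,n}`, if `Var(X) > 0` and `Y* = aX + b` with `a = Cov(X,Y)/Var(X)` and
`b = E[Y] - a E[X]`, then `Var(Y - Y*) ≤ C E[Y]² / d⁴`. -/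
theorem statement_15 :
    ∃ C : ℝ, 0 < C ∧ ∃ n₀ : ℕ,
      ∀ m d : ℕ, n₀ ≤ 2*m → 3 ≤ d → (d : ℝ) ≤ ((2*m : ℕ) : ℝ) ^ ((1:ℝ)/10) →
        0 < varia (mu (2*m) d) (fun G => (triCount G : ℝ)) →
        varia (mu (2*m) d)
            (fun G => (pmCount G : ℝ) -
              (covar (mu (2*m) d) (fun H => (triCount H : ℝ)) (fun H => (pmCount H : ℝ)) /
                  varia (mu (2*m) d) (fun H => (triCount H : ℝ)) * (triCount G : ℝ) +
                (expec (mu (2*m) d) (fun H => (pmCount H : ℝ)) -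
                  covar (mu (2*m) d) (fun H => (triCount H : ℝ))
                      (fun H => (pmCount H : ℝ)) /
                    varia (mu (2*m) d) (fun H => (triCount H : ℝ)) *
                    expec (mu (2*m) d) (fun H => (triCount H : ℝ))))) ≤
          C * (expec (mu (2*m) d) (fun H => (pmCount H : ℝ))) ^ 2 / (d : ℝ) ^ 4 := by
  open RegPM Finset in
  obtain ⟨C, hC, hR⟩ := exists_momentRatio_le
  refine ⟨6 * (C + 80000), by positivity, 10 ^ 8, fun m d hm hd hdn hv => ?_⟩
  obtain ⟨c, rfl⟩ : ∃ c, d = c + 2 := ⟨d - 2, by omega⟩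
  have hc : 1 ≤ c := by omega
  have hcR : (1 : ℝ) ≤ c := by exact_mod_cast hc
  have hmR : (10 ^ 8 : ℝ) ≤ 2 * m := by exact_mod_cast hm
  have hpow : (c + 2 : ℝ) ^ 10 ≤ 2 * m := by
    have := pow_le_pow_left₀ (by positivity) hdn 10
    rw [← Real.rpow_natCast, ← Real.rpow_natCast, ← Real.rpow_mul (by positivity)] at this
    norm_num at this
    exact_mod_cast this
  have P := params_of_le hm hpow hc
  have hθx : (c + 2 : ℝ) / (2 * m) ≤ 1 / (c + 1 : ℝ) ^ 4 := by
    rw [div_le_div_iff₀ (by linarith) (by positivity), one_mul]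
    calc (c + 2 : ℝ) * (c + 1 : ℝ) ^ 4 ≤ (c + 2 : ℝ) * (c + 2 : ℝ) ^ 9 := by
          refine mul_le_mul_of_nonneg_left ?_ (by positivity)
          exact (pow_le_pow_left₀ (by positivity) (by linarith) 4).trans
            (pow_le_pow_right₀ (by linarith) (by norm_num))
      _ = (c + 2 : ℝ) ^ 10 := by ring
      _ ≤ _ := hpow
  have hR' := hR m c hc hpow (by have := P.hn; push_cast at this; exact this)
  refine (varia_residual_le hv (-(expec (mu (2 * m) (c + 2)) (fun H => (pmCount H : ℝ)) /
    (c + 1 : ℝ) ^ 3)) _).trans ?_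
  have hN : 0 < cnt ((c + 2 : ℕ) : ℝ) (⊥ : SimpleGraph (Fin (2 * m))) := by
    refine lt_of_le_of_ne cnt_nonneg fun h => ?_
    rw [varia, covar, expec_mu, expec_mu, ← h] at hv
    simp at hv
  have hd2 : ((c + 2 : ℕ) : ℝ) = c + 2 := by push_cast; ring
  have hsup := sum_cnt_sup_le rfl P
  have hη : tot (c + 2 : ℝ) (⊥ : SimpleGraph (Fin (2 * m))) (fun G => (pmCount G : ℝ) * triHom G) ≤
      ((c + 1 : ℝ) ^ 3 - 1) * (1 + 52 * ((c + 2) / (2 * m))) *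
        ∑ M ∈ fam 1 (⊥ : SimpleGraph (Fin (2 * m))), cnt (c + 2 : ℝ) M := by
    rw [tot_pmCount_mul, mul_sum]
    refine sum_le_sum fun M hM => (tot_matching_triHom_le P hM).trans (le_of_eq ?_)
    ring
  have h1 := tot_bot_triHom_le P
  have h1' := tot_bot_triHom_ge P
  have h2 := tot_triHom_sq_le P
  have hdx : (c + 2 - 1 : ℝ) = c + 1 := by ring
  rw [hdx] at h1 h1' h2
  have hsq : varia (mu (2 * m) (c + 2)) (fun H => (pmCount H : ℝ)) =
      (∑ M ∈ fam 1 (⊥ : SimpleGraph (Fin (2 * m))), ∑ M' ∈ fam 1 (⊥ : SimpleGraph (Fin (2 * m))),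
        cnt (c + 2 : ℝ) (M ⊔ M')) / cnt (c + 2 : ℝ) (⊥ : SimpleGraph (Fin (2 * m))) -
      ((∑ M ∈ fam 1 (⊥ : SimpleGraph (Fin (2 * m))), cnt (c + 2 : ℝ) M) /
        cnt (c + 2 : ℝ) (⊥ : SimpleGraph (Fin (2 * m)))) ^ 2 := by
    rw [varia, covar, expec_mu, expec_mu, hd2, tot_pmCount_sq, tot_pmCount, sq]
  rw [hsq, covar_triCount, varia_triCount, expec_mu, hd2, tot_pmCount]
  rw [hd2] at hN
  set N := cnt (c + 2 : ℝ) (⊥ : SimpleGraph (Fin (2 * m)))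
  set S := ∑ M ∈ fam 1 (⊥ : SimpleGraph (Fin (2 * m))), cnt (c + 2 : ℝ) M
  have hS : 0 ≤ S := sum_nonneg fun M _ => cnt_nonneg
  have hx4 : (C + 80000) / (c + 1 : ℝ) ^ 4 ≤ 6 * (C + 80000) / (c + 2 : ℝ) ^ 4 := by
    have h6 : (c + 2 : ℝ) ^ 4 ≤ 6 * (c + 1 : ℝ) ^ 4 := by
      calc (c + 2 : ℝ) ^ 4 ≤ (3 / 2 * (c + 1 : ℝ)) ^ 4 :=
            pow_le_pow_left₀ (by positivity) (by linarith) 4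
        _ = 81 / 16 * (c + 1 : ℝ) ^ 4 := by ring
        _ ≤ _ := by gcongr; norm_num
    rw [div_le_div_iff₀ (by positivity) (by positivity)]
    calc (C + 80000) * (c + 2 : ℝ) ^ 4 ≤ (C + 80000) * (6 * (c + 1 : ℝ) ^ 4) := by gcongr
      _ = _ := by ring
  have hθ1 : (c + 2 : ℝ) / (2 * m) ≤ 1 / 10 ^ 6 := by
    have := P.θd
    have := P.θ_pos
    nlinarith
  refine (residual_variance_le (x := (c + 1 : ℝ)) (by linarith) (div_nonneg hS hN.le) P.θ_pos hθ1
    hθx (C := C) ?_ ?_ ?_ ?_ ?_).trans ?_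
  · rw [div_le_iff₀ hN, div_pow, ← mul_div_assoc, div_mul_eq_mul_div, le_div_iff₀ (by positivity)]
    have := hsup.trans (mul_le_mul_of_nonneg_right hR' (sq_nonneg S))
    rw [sq N, ← mul_assoc]
    exact mul_le_mul_of_nonneg_right this hN.le
  · rw [div_le_iff₀ hN, mul_assoc, div_mul_cancel₀ _ hN.ne']
    exact hη
  · rw [div_le_iff₀ hN]
    exact h1
  · rw [le_div_iff₀ hN]
    exact h1'
  · rw [div_le_iff₀ hN, mul_assoc, div_mul_cancel₀ _ hN.ne']
    exact h2
  · rw [mul_div_right_comm]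
    exact mul_le_mul_of_nonneg_right hx4 (sq_nonneg _)
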